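/- Let Ω ⊂ ℝ² be a smooth bounded strictly star-shaped domain, g : ∂Ω → Γ smooth of degree d, and let u_ε solve Δu_ε = ε⁻²∇W(u_ε) in Ω with u_ε = g on ∂Ω. Then for every p ∈ [1,2) there is a constant C_p, independent of ε, such that ‖∇u_ε‖_{L^p(Ω)} ≤ C_p for all ε > 0. -/

import Mathlib

open Complex Metric MeasureTheory Filter Set Topology Bornology

noncomputable section

/-- The Laplacian of a map `u : ℂ → ℂ`, viewing `ℂ ≅ ℝ²`. -/
def lapC (u : ℂ → ℂ) (x : ℂ) : ℂ :=
  fderiv ℝ (fun y => fderiv ℝ u y 1) x 1 +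
    fderiv ℝ (fun y => fderiv ℝ u y Complex.I) x Complex.I

/-- The Laplacian of a function `h : ℂ → ℝ`. -/
def lapR (h : ℂ → ℝ) (x : ℂ) : ℝ :=
  fderiv ℝ (fun y => fderiv ℝ h y 1) x 1 +
    fderiv ℝ (fun y => fderiv ℝ h y Complex.I) x Complex.I

/-- `|∇u|²` for `u : ℂ → ℂ`. -/
def gradSq (u : ℂ → ℂ) (x : ℂ) : ℝ :=
  ‖fderiv ℝ u x 1‖ ^ 2 + ‖fderiv ℝ u x Complex.I‖ ^ 2

/-- The gradient `∇W` of a potential `W : ℂ → ℝ`, as a point of `ℂ ≅ ℝ²`. -/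
def gradW (W : ℂ → ℝ) (x : ℂ) : ℂ :=
  (fderiv ℝ W x 1 : ℂ) + (fderiv ℝ W x Complex.I : ℂ) * Complex.I

/-- The Ginzburg–Landau type energy `E_ε(u) = ∫_Ω [½|∇u|² + W(u)/ε²]`. -/
def energy (W : ℂ → ℝ) (Ω : Set ℂ) (ε : ℝ) (u : ℂ → ℂ) : ℝ :=
  ∫ x in Ω, ((1 / 2) * gradSq u x + W (u x) / ε ^ 2)

/-- `Γ` is a smooth simple closed curve of length `2π`, with (`2π`-periodic) arclength
parametrization `τ` (so that the point `τ(e^{is})` of the paper is `τ s` here). -/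
structure ArcParam (Γ : Set ℂ) (τ : ℝ → ℂ) : Prop where
  smooth : ContDiff ℝ (⊤ : ℕ∞) τ
  periodic : Function.Periodic τ (2 * Real.pi)
  arclength : ∀ s, ‖deriv τ s‖ = 1
  inj : ∀ s t : ℝ, τ s = τ t → ∃ k : ℤ, s - t = 2 * Real.pi * k
  srange : Set.range τ = Γ

/-- The hypotheses (h1)–(h5) on the potential `W`: smooth, nonnegative, vanishing exactly
on `Γ`, non-degenerate near `Γ`, and radially coercive outside `B_{R₀} ⊇ Γ`. -/
structure PotentialHyp (Γ : Set ℂ) (W : ℂ → ℝ) (R₀ : ℝ) : Prop where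
  smooth : ContDiff ℝ (⊤ : ℕ∞) W
  nonneg : ∀ z, 0 ≤ W z
  zeros : W ⁻¹' {0} = Γ
  nondeg : ∃ μ > 0, ∃ δ > 0, ∀ z : ℂ,
    Metric.infDist z Γ < δ → μ * Metric.infDist z Γ ^ 2 ≤ W z
  R0_large : ∀ z ∈ Γ, ‖z‖ < R₀
  coercive : ∀ z : ℂ, R₀ < ‖z‖ →
    0 ≤ (gradW W z).re * z.re + (gradW W z).im * z.im

/-- `u` is a (globally smooth) solution of `Δu = ε⁻² ∇W(u)` in `Ω`. -/
def SolvesGL (W : ℂ → ℝ) (Ω : Set ℂ) (ε : ℝ) (u : ℂ → ℂ) : Prop :=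
  ContDiff ℝ (⊤ : ℕ∞) u ∧ ∀ x ∈ Ω, lapC u x = (ε ^ 2)⁻¹ • gradW W (u x)

/-- The decomposition `u = τ(e^{iφ}) + t·n⃗(τ(e^{iφ}))` on the set `s`, where `t` is the
signed distance of `u` to `Γ` and `φ` is a (global) phase; the unit normal to `Γ` at `τ s`
is `i·τ'(s)`. -/
def PhaseDecomp (Γ : Set ℂ) (τ : ℝ → ℂ) (s : Set ℂ) (u : ℂ → ℂ) (t φ : ℂ → ℝ) : Prop :=
  ContinuousOn t s ∧ ContinuousOn φ s ∧
    ∀ x ∈ s, u x = τ (φ x) + (t x : ℂ) * (Complex.I * deriv τ (φ x)) ∧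
      |t x| = Metric.infDist (u x) Γ

/-- `γ` is an `L`-periodic arclength parametrization of the (smooth) boundary of `Ω`. -/
structure BoundaryParam (Ω : Set ℂ) (γ : ℝ → ℂ) (L : ℝ) : Prop where
  Lpos : 0 < L
  smooth : ContDiff ℝ (⊤ : ℕ∞) γ
  periodic : Function.Periodic γ L
  arclength : ∀ s, ‖deriv γ s‖ = 1
  inj : ∀ s t : ℝ, γ s = γ t → ∃ k : ℤ, s - t = L * k
  srange : Set.range γ = frontier Ω

/-- `n` is the outward unit normal field along the boundary parametrization `γ` of `Ω`. -/
structure OutwardNormal (Ω : Set ℂ) (γ : ℝ → ℂ) (n : ℝ → ℂ) : Prop where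
  unit : ∀ s, ‖n s‖ = 1
  orth : ∀ s, (n s).re * (deriv γ s).re + (n s).im * (deriv γ s).im = 0
  outward : ∀ s, ∀ᶠ r in nhdsWithin (0 : ℝ) (Set.Ioi (0 : ℝ)), γ s + Complex.ofReal r * n s ∉ closure Ω

/-- The maximum principle for the phase (Proposition 2.2) holds with constants `δ₁`, `m`:
for every critical point `u` of `E_ε` on a bounded simply connected domain `ω`, continuous on
`closure ω` and with `dist(u,Γ) ≤ δ₁` there, the functions `φ ∓ m t²/2` attain their
min/max on `∂ω`. -/
def MaxPrinciple (Γ : Set ℂ) (τ : ℝ → ℂ) (W : ℂ → ℝ) (δ₁ m : ℝ) : Prop :=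
  ∀ (ω : Set ℂ) (ε : ℝ) (u : ℂ → ℂ) (t φ : ℂ → ℝ),
    IsOpen ω → Bornology.IsBounded ω → ω.Nonempty → SimplyConnectedSpace ↥ω →
    0 < ε → ContDiffOn ℝ (⊤ : ℕ∞) u ω → ContinuousOn u (closure ω) →
    (∀ x ∈ ω, lapC u x = (ε ^ 2)⁻¹ • gradW W (u x)) →
    (∀ x ∈ closure ω, Metric.infDist (u x) Γ ≤ δ₁) →
    PhaseDecomp Γ τ (closure ω) u t φ →
    sInf ((fun x => φ x - m * t x ^ 2 / 2) '' closure ω) =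
        sInf ((fun x => φ x - m * t x ^ 2 / 2) '' frontier ω) ∧
      sSup ((fun x => φ x + m * t x ^ 2 / 2) '' closure ω) =
        sSup ((fun x => φ x + m * t x ^ 2 / 2) '' frontier ω)

/-! ### Directional derivatives of maps on the plane -/

/-- The derivative of `f` in the direction `e`. -/
def pd {E : Type*} [NormedAddCommGroup E] [NormedSpace ℝ E] (e : ℂ) (f : ℂ → E) (x : ℂ) : E :=
  fderiv ℝ f x e

section pd
variable {E F : Type*} [NormedAddCommGroup E] [NormedSpace ℝ E] [NormedAddCommGroup F]
  [NormedSpace ℝ F]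

lemma ContDiff.pd {f : ℂ → E} (hf : ContDiff ℝ (⊤ : ℕ∞) f) (e : ℂ) :
    ContDiff ℝ (⊤ : ℕ∞) (pd e f) := by
  unfold _root_.pd
  exact (hf.fderiv_right (by simp)).clm_apply contDiff_const

lemma ContDiff.diffAt {f : ℂ → E} (hf : ContDiff ℝ (⊤ : ℕ∞) f) (x : ℂ) :
    DifferentiableAt ℝ f x := (hf.differentiable (by simp)) x

lemma pd_comm {f : ℂ → E} (hf : ContDiff ℝ (⊤ : ℕ∞) f) (e e' x : ℂ) :
    pd e (pd e' f) x = pd e' (pd e f) x := by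
  have h1 : ∀ e e', pd e (pd e' f) x = fderiv ℝ (fderiv ℝ f) x e e' := by
    intro e e'
    have hd : DifferentiableAt ℝ (fderiv ℝ f) x :=
      ((hf.fderiv_right (m := (⊤ : ℕ∞)) (by simp)).differentiable (by simp)) x
    unfold pd
    rw [fderiv_clm_apply hd (differentiableAt_const e')]
    simp
  rw [h1, h1]
  exact (hf.contDiffAt.isSymmSndFDerivAt
    (by rw [minSmoothness_of_isRCLikeNormedField]; exact WithTop.coe_le_coe.2 (le_top (a := (2 : ℕ∞))))) e e'

lemma pd_comp {f : ℂ → E} {u : ℂ → ℂ} (hf : ContDiff ℝ (⊤ : ℕ∞) f)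
    (hu : ContDiff ℝ (⊤ : ℕ∞) u) (e x : ℂ) :
    pd e (fun y => f (u y)) x = fderiv ℝ f (u x) (pd e u x) := by
  unfold pd
  rw [fderiv_fun_comp x (hf.diffAt _) (hu.diffAt _)]
  rfl

lemma pd_add {f g : ℂ → E} (hf : ContDiff ℝ (⊤ : ℕ∞) f) (hg : ContDiff ℝ (⊤ : ℕ∞) g) (e x : ℂ) :
    pd e (fun y => f y + g y) x = pd e f x + pd e g x := by
  unfold pd
  rw [fderiv_fun_add (hf.diffAt _) (hg.diffAt _)]
  rfl

lemma pd_sub {f g : ℂ → E} (hf : ContDiff ℝ (⊤ : ℕ∞) f) (hg : ContDiff ℝ (⊤ : ℕ∞) g) (e x : ℂ) :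
    pd e (fun y => f y - g y) x = pd e f x - pd e g x := by
  unfold pd
  rw [fderiv_fun_sub (hf.diffAt _) (hg.diffAt _)]
  rfl

lemma pd_const (c : E) (e x : ℂ) : pd e (fun _ => c) x = 0 := by
  simp [pd]

lemma pd_mul {f g : ℂ → ℝ} (hf : ContDiff ℝ (⊤ : ℕ∞) f) (hg : ContDiff ℝ (⊤ : ℕ∞) g) (e x : ℂ) :
    pd e (fun y => f y * g y) x = f x * pd e g x + g x * pd e f x := by
  unfold pd
  rw [fderiv_fun_mul (hf.diffAt _) (hg.diffAt _)]
  simp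

lemma pd_clm (T : E →L[ℝ] F) {f : ℂ → E} (hf : ContDiff ℝ (⊤ : ℕ∞) f) (e x : ℂ) :
    pd e (fun y => T (f y)) x = T (pd e f x) := by
  unfold pd
  rw [fderiv_fun_comp x T.differentiableAt (hf.diffAt _)]
  simp

lemma pd_re {f : ℂ → ℂ} (hf : ContDiff ℝ (⊤ : ℕ∞) f) (e x : ℂ) :
    pd e (fun y => (f y).re) x = (pd e f x).re := pd_clm Complex.reCLM hf e x

lemma pd_im {f : ℂ → ℂ} (hf : ContDiff ℝ (⊤ : ℕ∞) f) (e x : ℂ) :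
    pd e (fun y => (f y).im) x = (pd e f x).im := pd_clm Complex.imCLM hf e x

lemma ContDiff.re' {f : ℂ → ℂ} (hf : ContDiff ℝ (⊤ : ℕ∞) f) :
    ContDiff ℝ (⊤ : ℕ∞) (fun y => (f y).re) := Complex.reCLM.contDiff.comp hf

lemma ContDiff.im' {f : ℂ → ℂ} (hf : ContDiff ℝ (⊤ : ℕ∞) f) :
    ContDiff ℝ (⊤ : ℕ∞) (fun y => (f y).im) := Complex.imCLM.contDiff.comp hf

lemma fderiv_eq_pd (f : ℂ → E) (x ξ : ℂ) :
    fderiv ℝ f x ξ = ξ.re • pd 1 f x + ξ.im • pd I f x := by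
  unfold pd
  rw [← map_smul, ← map_smul, ← map_add]
  congr 1
  apply Complex.ext <;> simp

end pd

/-! ### Domains on which the divergence theorem holds -/

/-- A bounded open set with a smooth closed boundary curve `γ`, strictly star-shaped around the
origin, on which the divergence theorem holds with outward normal `n`. -/
structure StarDomain (Ω : Set ℂ) (γ n : ℝ → ℂ) (L c σ : ℝ) : Prop where
  isOpen : IsOpen Ω
  bdd : Bornology.IsBounded Ω
  Lpos : 0 < L
  cpos : 0 < c
  smooth : ContDiff ℝ (⊤ : ℕ∞) γ
  smooth_n : ContDiff ℝ (⊤ : ℕ∞) n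
  per : Function.Periodic γ L
  per_n : Function.Periodic n L
  unit : ∀ s, (n s).re ^ 2 + (n s).im ^ 2 = 1
  sgn : σ ^ 2 = 1
  tangent : ∀ s, deriv γ s = σ * (I * n s)
  star : ∀ s, c ≤ (γ s).re * (n s).re + (γ s).im * (n s).im
  bdry : frontier Ω = range γ
  ibp : ∀ X Y : ℂ → ℝ, ContDiff ℝ (⊤ : ℕ∞) X → ContDiff ℝ (⊤ : ℕ∞) Y →
    ∫ x in Ω, (pd 1 X x + pd I Y x) =
      ∫ s in (0 : ℝ)..L, (X (γ s) * (n s).re + Y (γ s) * (n s).im)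

namespace StarDomain
variable {Ω : Set ℂ} {γ n : ℝ → ℂ} {L c σ : ℝ}

lemma isCompact (H : StarDomain Ω γ n L c σ) : IsCompact (closure Ω) :=
  H.bdd.isCompact_closure

lemma integrableOn (H : StarDomain Ω γ n L c σ) {f : ℂ → ℝ} (hf : Continuous f) :
    IntegrableOn f Ω :=
  (hf.continuousOn.integrableOn_compact H.isCompact).mono_set subset_closure

lemma hasDerivAt (H : StarDomain Ω γ n L c σ) (s : ℝ) : HasDerivAt γ (σ * (I * n s)) s := by
  rw [← H.tangent]
  exact ((H.smooth.differentiable (by simp)) s).hasDerivAt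

lemma hasDerivAt_comp (H : StarDomain Ω γ n L c σ) {f : ℂ → ℝ} (hf : ContDiff ℝ (⊤ : ℕ∞) f)
    (s : ℝ) : HasDerivAt (fun s => f (γ s))
      (σ * (pd I f (γ s) * (n s).re - pd 1 f (γ s) * (n s).im)) s := by
  have h := (hf.diffAt (γ s)).hasFDerivAt.comp_hasDerivAt s (H.hasDerivAt s)
  refine h.congr_deriv ?_
  rw [fderiv_eq_pd]
  simp
  ring

lemma continuous (H : StarDomain Ω γ n L c σ) : Continuous γ := H.smooth.continuous

lemma continuous_n (H : StarDomain Ω γ n L c σ) : Continuous n := H.smooth_n.continuous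

lemma continuous_comp (H : StarDomain Ω γ n L c σ) {f : ℂ → ℝ} (hf : ContDiff ℝ (⊤ : ℕ∞) f) :
    Continuous (fun s => f (γ s)) := hf.continuous.comp H.continuous

lemma setIntegral_mono (H : StarDomain Ω γ n L c σ) {f g : ℂ → ℝ} (hf : Continuous f)
    (hg : Continuous g) (h : ∀ x ∈ Ω, f x ≤ g x) : ∫ x in Ω, f x ≤ ∫ x in Ω, g x :=
  setIntegral_mono_on (H.integrableOn hf) (H.integrableOn hg) H.isOpen.measurableSet h

/-- The Hessian of a smooth function vanishing on the boundary is controlled in `L²` by the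
Laplacian and the normal derivative. -/
lemma hessian_bound (H : StarDomain Ω γ n L c σ) :
    ∃ K : ℝ, 0 ≤ K ∧ ∀ a : ℂ → ℝ, ContDiff ℝ (⊤ : ℕ∞) a → (∀ s, a (γ s) = 0) →
      ∫ x in Ω, (pd 1 (pd 1 a) x ^ 2 + 2 * pd 1 (pd I a) x ^ 2 + pd I (pd I a) x ^ 2) ≤
        (∫ x in Ω, (pd 1 (pd 1 a) x + pd I (pd I a) x) ^ 2) +
          K * ∫ s in (0 : ℝ)..L, (pd 1 a (γ s) ^ 2 + pd I a (γ s) ^ 2) := by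
  have hnr : ContDiff ℝ (⊤ : ℕ∞) (fun s => (n s).re) := Complex.reCLM.contDiff.comp H.smooth_n
  have hni : ContDiff ℝ (⊤ : ℕ∞) (fun s => (n s).im) := Complex.imCLM.contDiff.comp H.smooth_n
  have hcr : Continuous (deriv fun s => (n s).re) := hnr.continuous_deriv (by simp)
  have hci : Continuous (deriv fun s => (n s).im) := hni.continuous_deriv (by simp)
  obtain ⟨K, hK⟩ := (isCompact_Icc (a := (0 : ℝ)) (b := L)).exists_bound_of_continuousOn
    (f := fun s => (n s).re * deriv (fun s => (n s).im) s -
      deriv (fun s => (n s).re) s * (n s).im)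
    ((hnr.continuous.mul hci).sub (hcr.mul hni.continuous)).continuousOn
  refine ⟨|K|, abs_nonneg _, fun a ha h0 => ?_⟩
  have h1 := ha.pd 1
  have h2 := ha.pd I
  have h11 := h1.pd 1
  have h12 := h2.pd 1
  have h22 := h2.pd I
  set α : ℝ → ℝ := fun s => pd 1 a (γ s) with hα
  set β : ℝ → ℝ := fun s => pd I a (γ s) with hβ
  set α' : ℝ → ℝ := fun s => σ * (pd I (pd 1 a) (γ s) * (n s).re - pd 1 (pd 1 a) (γ s) * (n s).im)
    with hα'
  set β' : ℝ → ℝ := fun s => σ * (pd I (pd I a) (γ s) * (n s).re - pd 1 (pd I a) (γ s) * (n s).im)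
    with hβ'
  have dα : ∀ s, HasDerivAt α (α' s) s := fun s => H.hasDerivAt_comp h1 s
  have dβ : ∀ s, HasDerivAt β (β' s) s := fun s => H.hasDerivAt_comp h2 s
  have cα : Continuous α := H.continuous_comp h1
  have cβ : Continuous β := H.continuous_comp h2
  have cα' : Continuous α' := continuous_const.mul
    (((H.continuous_comp (h1.pd I)).mul hnr.continuous).sub
      ((H.continuous_comp h11).mul hni.continuous))
  have cβ' : Continuous β' := continuous_const.mul
    (((H.continuous_comp h22).mul hnr.continuous).sub
      ((H.continuous_comp h12).mul hni.continuous))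
  have hpar : ∫ s in (0 : ℝ)..L, (α s * β' s + α' s * β s) = 0 := by
    have := intervalIntegral.integral_eq_sub_of_hasDerivAt (a := 0) (b := L)
      (f := fun s => α s * β s) (f' := fun s => α s * β' s + α' s * β s)
      (fun s _ => ((dα s).mul (dβ s)).congr_deriv (by ring))
      (Continuous.intervalIntegrable (by fun_prop) _ _)
    rw [this]
    have : γ L = γ 0 := by simpa using H.per 0
    simp [hα, hβ, this]
  have htan : ∀ s, β s * (n s).re - α s * (n s).im = 0 := by
    intro s
    have h := H.hasDerivAt_comp ha s
    have h' : HasDerivAt (fun s => a (γ s)) 0 s := by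
      simp only [h0]; exact hasDerivAt_const _ _
    have := h.unique h'
    rcases mul_eq_zero.1 this with h | h
    · have := H.sgn; rw [h] at this; norm_num at this
    · exact h
  have key : ∀ s, |α s * β' s - α' s * β s| ≤ |K| * (α s ^ 2 + β s ^ 2) ∨ s ∉ Icc 0 L := by
    intro s
    by_cases hs : s ∈ Icc 0 L
    swap
    · right; exact hs
    left
    have e1 : HasDerivAt (fun s => (n s).re) (deriv (fun s => (n s).re) s) s :=
      ((hnr.differentiable (by simp)) s).hasDerivAt
    have e2 : HasDerivAt (fun s => (n s).im) (deriv (fun s => (n s).im) s) s :=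
      ((hni.differentiable (by simp)) s).hasDerivAt
    have e3 : HasDerivAt (fun s => β s * (n s).re - α s * (n s).im) 0 s := by
      simp only [htan]; exact hasDerivAt_const _ _
    have e4 := (((dβ s).mul e1).sub ((dα s).mul e2)).unique e3
    have hK' := hK s hs
    rw [Real.norm_eq_abs] at hK'
    have hu := H.unit s
    have ht := htan s
    set p := (n s).re
    set q := (n s).im
    set p' := deriv (fun s => (n s).re) s
    set q' := deriv (fun s => (n s).im) s
    have hA : α s = (α s * p + β s * q) * p := by linear_combination (-q) * ht - α s * hu
    have hB : β s = (α s * p + β s * q) * q := by linear_combination p * ht - β s * hu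
    set b := α s * p + β s * q
    have e5 : α s * β' s - α' s * β s = b ^ 2 * (p * q' - p' * q) := by
      have e6 : β' s * p - α' s * q = α s * q' - β s * p' := by
        linarith
      calc α s * β' s - α' s * β s = b * (β' s * p - α' s * q) := by
            linear_combination (β' s) * hA - (α' s) * hB
        _ = b * (α s * q' - β s * p') := by rw [e6]
        _ = _ := by linear_combination b * q' * hA - b * p' * hB
    have e7 : α s ^ 2 + β s ^ 2 = b ^ 2 := by
      linear_combination (α s + b * p) * hA + (β s + b * q) * hB + b ^ 2 * hu
    rw [e5, e7, abs_mul, abs_of_nonneg (sq_nonneg b), mul_comm]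
    exact mul_le_mul_of_nonneg_right (hK'.trans (le_abs_self K)) (sq_nonneg b)
  have hσ : |σ| = 1 := by
    have := H.sgn
    have h2 : |σ| ^ 2 = 1 := by rw [sq_abs]; exact this
    nlinarith [abs_nonneg σ]
  have hB := H.ibp (fun x => pd 1 a x * pd I (pd I a) x) (fun x => -(pd 1 a x * pd 1 (pd I a) x))
    (h1.mul h22) (h1.mul h12).neg
  have hB1 : ∀ x, pd 1 (fun x => pd 1 a x * pd I (pd I a) x) x +
      pd I (fun x => -(pd 1 a x * pd 1 (pd I a) x)) x =
      pd 1 (pd 1 a) x * pd I (pd I a) x - pd 1 (pd I a) x ^ 2 := by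
    intro x
    have : (fun x => -(pd 1 a x * pd 1 (pd I a) x)) =
        fun x => (-pd 1 a x) * pd 1 (pd I a) x := by ext; ring
    rw [pd_mul h1 h22, this, pd_mul h1.neg h12]
    have e1 : pd I (fun x => -pd 1 a x) x = - pd I (pd 1 a) x := by
      unfold pd
      rw [fderiv_fun_neg]
      rfl
    rw [e1, pd_comm ha I 1, pd_comm h2 I 1]
    ring
  have hB2 : ∀ s, pd 1 a (γ s) * pd I (pd I a) (γ s) * (n s).re +
      -(pd 1 a (γ s) * pd 1 (pd I a) (γ s)) * (n s).im = σ * (α s * β' s) := by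
    intro s
    simp only [hα, hβ']
    linear_combination (-(pd 1 a (γ s) * pd I (pd I a) (γ s) * (n s).re +
      -(pd 1 a (γ s) * pd 1 (pd I a) (γ s)) * (n s).im)) * H.sgn
  simp only [hB1, hB2] at hB
  rw [intervalIntegral.integral_const_mul] at hB
  have hsplit : 2 * ∫ s in (0 : ℝ)..L, α s * β' s =
      ∫ s in (0 : ℝ)..L, (α s * β' s - α' s * β s) := by
    have e1 : ∫ s in (0 : ℝ)..L, (α s * β' s - α' s * β s) +  (α s * β' s + α' s * β s) =
      (∫ s in (0 : ℝ)..L, (α s * β' s - α' s * β s)) +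
      ∫ s in (0 : ℝ)..L, (α s * β' s + α' s * β s) :=
      intervalIntegral.integral_add
        (Continuous.intervalIntegrable (by fun_prop) _ _)
        (Continuous.intervalIntegrable (by fun_prop) _ _)
    rw [hpar, add_zero] at e1
    rw [← e1, ← intervalIntegral.integral_const_mul]
    congr 1; ext s; ring
  have hbd : |∫ s in (0 : ℝ)..L, (α s * β' s - α' s * β s)| ≤
      |K| * ∫ s in (0 : ℝ)..L, (α s ^ 2 + β s ^ 2) := by
    rw [← intervalIntegral.integral_const_mul]
    refine (intervalIntegral.abs_integral_le_integral_abs H.Lpos.le).trans ?_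
    refine intervalIntegral.integral_mono_on H.Lpos.le ?_ ?_ ?_
    · exact ((cα.mul cβ').sub (cα'.mul cβ)).abs.intervalIntegrable _ _
    · exact (continuous_const.mul ((cα.pow 2).add (cβ.pow 2))).intervalIntegrable _ _
    · intro s hs
      rcases key s with h | h
      · exact h
      · exact absurd hs h
  have hfin : ∫ x in Ω, (pd 1 (pd 1 a) x ^ 2 + 2 * pd 1 (pd I a) x ^ 2 + pd I (pd I a) x ^ 2) =
      (∫ x in Ω, (pd 1 (pd 1 a) x + pd I (pd I a) x) ^ 2) -
        2 * ∫ x in Ω, (pd 1 (pd 1 a) x * pd I (pd I a) x - pd 1 (pd I a) x ^ 2) := by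
    rw [← integral_const_mul, ← integral_sub]
    · congr 1; ext x; ring
    · exact H.integrableOn ((h11.continuous.add h22.continuous).pow 2)
    · exact H.integrableOn (continuous_const.mul
        ((h11.continuous.mul h22.continuous).sub (h12.continuous.pow 2)))
  rw [hfin, hB]
  have : |σ * ∫ s in (0 : ℝ)..L, (α s * β' s - α' s * β s)| ≤
      |K| * ∫ s in (0 : ℝ)..L, (α s ^ 2 + β s ^ 2) := by
    rw [abs_mul, hσ, one_mul]; exact hbd
  have h3 := neg_le_of_abs_le this
  rw [← hsplit] at h3
  linarith

/-- Interpolation: the `L⁴` norm of the gradient of a bounded function vanishing on the boundary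
is controlled by the `L²` norm of its Hessian. -/
lemma grad_fourth_bound (H : StarDomain Ω γ n L c σ) {a : ℂ → ℝ} (ha : ContDiff ℝ (⊤ : ℕ∞) a)
    (h0 : ∀ s, a (γ s) = 0) {M : ℝ} (hM : ∀ x ∈ Ω, |a x| ≤ M) :
    ∫ x in Ω, (pd 1 a x ^ 2 + pd I a x ^ 2) ^ 2 ≤
      27 * M ^ 2 * ∫ x in Ω, (pd 1 (pd 1 a) x ^ 2 + 2 * pd 1 (pd I a) x ^ 2 +
        pd I (pd I a) x ^ 2) := by
  have h1 := ha.pd 1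
  have h2 := ha.pd I
  have h11 := h1.pd 1
  have h12 := h2.pd 1
  have h22 := h2.pd I
  have hq : ContDiff ℝ (⊤ : ℕ∞) (fun x => pd 1 a x * pd 1 a x + pd I a x * pd I a x) :=
    (h1.mul h1).add (h2.mul h2)
  set q : ℂ → ℝ := fun x => pd 1 a x * pd 1 a x + pd I a x * pd I a x with hqdef
  have hB := H.ibp (fun x => (a x * q x) * pd 1 a x) (fun x => (a x * q x) * pd I a x)
    ((ha.mul hq).mul h1) ((ha.mul hq).mul h2)
  simp only [h0, zero_mul, add_zero, intervalIntegral.integral_zero] at hB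
  set R : ℂ → ℝ := fun x => q x * (pd 1 (pd 1 a) x + pd I (pd I a) x) +
    2 * (pd 1 a x * (pd 1 (pd 1 a) x * pd 1 a x + pd 1 (pd I a) x * pd I a x) +
      pd I a x * (pd 1 (pd I a) x * pd 1 a x + pd I (pd I a) x * pd I a x)) with hR
  have hB1 : ∀ x, pd 1 (fun x => (a x * q x) * pd 1 a x) x +
      pd I (fun x => (a x * q x) * pd I a x) x = q x ^ 2 + a x * R x := by
    intro x
    rw [pd_mul (ha.mul hq) h1, pd_mul (ha.mul hq) h2, pd_mul ha hq, pd_mul ha hq, hqdef,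
      pd_add (h1.mul h1) (h2.mul h2), pd_add (h1.mul h1) (h2.mul h2), pd_mul h1 h1, pd_mul h1 h1,
      pd_mul h2 h2, pd_mul h2 h2, pd_comm ha I 1]
    simp only [hR, hqdef]
    ring
  simp only [hB1] at hB
  have cq := hq.continuous
  have cR : Continuous R := by
    have := h1.continuous
    have := h2.continuous
    have := h11.continuous
    have := h12.continuous
    have := h22.continuous
    fun_prop
  have hle : ∀ x ∈ Ω, (pd 1 a x ^ 2 + pd I a x ^ 2) ^ 2 ≤ 2 * (q x ^ 2 + a x * R x) +
      27 * M ^ 2 * (pd 1 (pd 1 a) x ^ 2 + 2 * pd 1 (pd I a) x ^ 2 + pd I (pd I a) x ^ 2) := by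
    intro x hx
    have hMx := hM x hx
    have ha2 : a x ^ 2 ≤ M ^ 2 := by
      rw [← sq_abs]; exact pow_le_pow_left₀ (abs_nonneg _) hMx 2
    set p := pd 1 a x
    set r := pd I a x
    set A := pd 1 (pd 1 a) x
    set B := pd 1 (pd I a) x
    set D := pd I (pd I a) x
    have hqx : q x = p ^ 2 + r ^ 2 := by simp only [hqdef]; ring
    have hRx : R x = A * (3 * p ^ 2 + r ^ 2) + B * (4 * p * r) + D * (p ^ 2 + 3 * r ^ 2) := by
      simp only [hR, hqdef]; ring
    have hRsq : R x ^ 2 ≤ 27 * (A ^ 2 + 2 * B ^ 2 + D ^ 2) * q x ^ 2 := by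
      have g1 : (A * (3 * p ^ 2 + r ^ 2)) ^ 2 ≤ 9 * A ^ 2 * q x ^ 2 := by
        rw [hqx, mul_pow]
        have : (3 * p ^ 2 + r ^ 2) ^ 2 ≤ 9 * (p ^ 2 + r ^ 2) ^ 2 := by
          nlinarith [sq_nonneg p, sq_nonneg r, mul_nonneg (sq_nonneg p) (sq_nonneg r),
            sq_nonneg (r ^ 2)]
        nlinarith [sq_nonneg A, mul_le_mul_of_nonneg_left this (sq_nonneg A)]
      have g2 : (D * (p ^ 2 + 3 * r ^ 2)) ^ 2 ≤ 9 * D ^ 2 * q x ^ 2 := by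
        rw [hqx, mul_pow]
        have : (p ^ 2 + 3 * r ^ 2) ^ 2 ≤ 9 * (p ^ 2 + r ^ 2) ^ 2 := by
          nlinarith [sq_nonneg p, sq_nonneg r, mul_nonneg (sq_nonneg p) (sq_nonneg r),
            sq_nonneg (p ^ 2)]
        nlinarith [sq_nonneg D, mul_le_mul_of_nonneg_left this (sq_nonneg D)]
      have g3 : (B * (4 * p * r)) ^ 2 ≤ 18 * B ^ 2 * q x ^ 2 := by
        rw [hqx, mul_pow]
        have : (4 * p * r) ^ 2 ≤ 18 * (p ^ 2 + r ^ 2) ^ 2 := by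
          nlinarith [mul_nonneg (sq_nonneg p) (sq_nonneg r), sq_nonneg (r ^ 2), sq_nonneg (p ^ 2)]
        nlinarith [sq_nonneg B, mul_le_mul_of_nonneg_left this (sq_nonneg B)]
      rw [hRx]
      set X := A * (3 * p ^ 2 + r ^ 2)
      set Y := B * (4 * p * r)
      set Z := D * (p ^ 2 + 3 * r ^ 2)
      nlinarith [sq_nonneg (X - Y), sq_nonneg (Y - Z), sq_nonneg (X - Z)]
    have hS : 0 ≤ A ^ 2 + 2 * B ^ 2 + D ^ 2 := by positivity
    set S := A ^ 2 + 2 * B ^ 2 + D ^ 2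
    have hX : (a x * R x) ^ 2 ≤ (27 * M ^ 2 * S) * q x ^ 2 := by
      rw [mul_pow]
      calc a x ^ 2 * R x ^ 2 ≤ M ^ 2 * (27 * S * q x ^ 2) :=
            mul_le_mul ha2 hRsq (sq_nonneg _) (sq_nonneg _)
        _ = _ := by ring
    have hT : 0 ≤ 27 * M ^ 2 * S := by positivity
    set T := 27 * M ^ 2 * S
    rw [← hqx]
    have hY : |a x * R x| ≤ (q x ^ 2 + T) / 2 := by
      apply abs_le_of_sq_le_sq
      · nlinarith [sq_nonneg (q x ^ 2 - T)]
      · positivity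
    have := neg_le_of_abs_le hY
    linarith
  have hcont : Continuous fun x => 27 * M ^ 2 * (pd 1 (pd 1 a) x ^ 2 + 2 * pd 1 (pd I a) x ^ 2 +
      pd I (pd I a) x ^ 2) := continuous_const.mul
    (((h11.continuous.pow 2).add (continuous_const.mul (h12.continuous.pow 2))).add
      (h22.continuous.pow 2))
  have cM : Continuous fun x => 2 * (q x ^ 2 + a x * R x) :=
    continuous_const.mul ((cq.pow 2).add (ha.continuous.mul cR))
  have c1 := h1.continuous
  have c2 := h2.continuous
  have := H.setIntegral_mono (by fun_prop) (by fun_prop) hle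
  refine this.trans (le_of_eq ?_)
  rw [integral_add (H.integrableOn cM) (H.integrableOn hcont), integral_const_mul, hB,
    integral_const_mul]
  ring

end StarDomain

/-! ### The Pohozaev identity -/

lemma contDiff_re : ContDiff ℝ (⊤ : ℕ∞) (fun x : ℂ => x.re) := Complex.reCLM.contDiff

lemma contDiff_im : ContDiff ℝ (⊤ : ℕ∞) (fun x : ℂ => x.im) := Complex.imCLM.contDiff

lemma pd_re_id (e x : ℂ) : pd e (fun x : ℂ => x.re) x = e.re := by
  unfold pd
  rw [show (fun x : ℂ => x.re) = Complex.reCLM from rfl, Complex.reCLM.fderiv]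
  rfl

lemma pd_im_id (e x : ℂ) : pd e (fun x : ℂ => x.im) x = e.im := by
  unfold pd
  rw [show (fun x : ℂ => x.im) = Complex.imCLM from rfl, Complex.imCLM.fderiv]
  rfl

namespace StarDomain
variable {Ω : Set ℂ} {γ n : ℝ → ℂ} {L c σ : ℝ}

lemma pohozaev_scalar (H : StarDomain Ω γ n L c σ) {a : ℂ → ℝ} (ha : ContDiff ℝ (⊤ : ℕ∞) a) :
    ∫ x in Ω, (x.re * pd 1 a x + x.im * pd I a x) * (pd 1 (pd 1 a) x + pd I (pd I a) x) =
      ∫ s in (0 : ℝ)..L, (((γ s).re * pd 1 a (γ s) + (γ s).im * pd I a (γ s)) *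
        (pd 1 a (γ s) * (n s).re + pd I a (γ s) * (n s).im) -
        1 / 2 * ((γ s).re * (n s).re + (γ s).im * (n s).im) *
          (pd 1 a (γ s) ^ 2 + pd I a (γ s) ^ 2)) := by
  have h1 := ha.pd 1
  have h2 := ha.pd I
  have hx := contDiff_re
  have hy := contDiff_im
  have hE : ContDiff ℝ (⊤ : ℕ∞) (fun x : ℂ => x.re * pd 1 a x + x.im * pd I a x) :=
    (hx.mul h1).add (hy.mul h2)
  have hq : ContDiff ℝ (⊤ : ℕ∞) (fun x => pd 1 a x * pd 1 a x + pd I a x * pd I a x) :=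
    (h1.mul h1).add (h2.mul h2)
  have hc : ContDiff ℝ (⊤ : ℕ∞) (fun _ : ℂ => (1 / 2 : ℝ)) := contDiff_const
  have hB := H.ibp
    (fun x => (x.re * pd 1 a x + x.im * pd I a x) * pd 1 a x -
      ((1 / 2 : ℝ) * x.re) * (pd 1 a x * pd 1 a x + pd I a x * pd I a x))
    (fun x => (x.re * pd 1 a x + x.im * pd I a x) * pd I a x -
      ((1 / 2 : ℝ) * x.im) * (pd 1 a x * pd 1 a x + pd I a x * pd I a x))
    ((hE.mul h1).sub ((hc.mul hx).mul hq)) ((hE.mul h2).sub ((hc.mul hy).mul hq))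
  calc _ = _ := ?_
    _ = _ := hB
    _ = _ := ?_
  · congr 1
    ext x
    rw [pd_sub (hE.mul h1) ((hc.mul hx).mul hq), pd_sub (hE.mul h2) ((hc.mul hy).mul hq),
      pd_mul hE h1, pd_mul hE h2, pd_mul (hc.mul hx) hq, pd_mul (hc.mul hy) hq,
      pd_mul hc hx, pd_mul hc hy, pd_add (hx.mul h1) (hy.mul h2), pd_add (hx.mul h1) (hy.mul h2),
      pd_add (h1.mul h1) (h2.mul h2), pd_add (h1.mul h1) (h2.mul h2), pd_mul hx h1, pd_mul hx h1,
      pd_mul hy h2, pd_mul hy h2, pd_mul h1 h1, pd_mul h1 h1, pd_mul h2 h2, pd_mul h2 h2,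
      pd_comm ha I 1]
    simp only [pd_re_id, pd_im_id, pd_const, one_re, one_im, I_re, I_im]
    ring
  · congr 1
    ext s
    ring

lemma pohozaev_potential (H : StarDomain Ω γ n L c σ) {V : ℂ → ℝ} (hV : ContDiff ℝ (⊤ : ℕ∞) V)
    (h0 : ∀ s, V (γ s) = 0) :
    ∫ x in Ω, (2 * V x + (x.re * pd 1 V x + x.im * pd I V x)) = 0 := by
  have hx := contDiff_re
  have hy := contDiff_im
  have hB := H.ibp (fun x => x.re * V x) (fun x => x.im * V x) (hx.mul hV) (hy.mul hV)
  simp only [h0, mul_zero, zero_mul, add_zero, intervalIntegral.integral_zero] at hB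
  rw [← hB]
  congr 1
  ext x
  rw [pd_mul hx hV, pd_mul hy hV]
  simp only [pd_re_id, pd_im_id, one_re, I_im]
  ring

lemma tangential_eq (H : StarDomain Ω γ n L c σ) {a h : ℂ → ℝ} (ha : ContDiff ℝ (⊤ : ℕ∞) a)
    (hh : ContDiff ℝ (⊤ : ℕ∞) h) (heq : ∀ s, a (γ s) = h (γ s)) (s : ℝ) :
    pd I a (γ s) * (n s).re - pd 1 a (γ s) * (n s).im =
      pd I h (γ s) * (n s).re - pd 1 h (γ s) * (n s).im := by
  have h1 := H.hasDerivAt_comp ha s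
  simp only [heq] at h1
  have h2 := h1.unique (H.hasDerivAt_comp hh s)
  have hσ : σ ≠ 0 := by
    intro h; have := H.sgn; rw [h] at this; norm_num at this
  exact mul_left_cancel₀ hσ h2

lemma pohozaev_boundary (H : StarDomain Ω γ n L c σ) {h : ℂ → ℝ} (hh : ContDiff ℝ (⊤ : ℕ∞) h) :
    ∃ K : ℝ, 0 ≤ K ∧ ∀ a : ℂ → ℝ, ContDiff ℝ (⊤ : ℕ∞) a → (∀ s, a (γ s) = h (γ s)) →
      c / 4 * (∫ s in (0 : ℝ)..L, (pd 1 a (γ s) ^ 2 + pd I a (γ s) ^ 2)) - K ≤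
      ∫ x in Ω, (x.re * pd 1 a x + x.im * pd I a x) * (pd 1 (pd 1 a) x + pd I (pd I a) x) := by
  have cγ := H.continuous
  have cn := H.continuous_n
  have cnr : Continuous fun s => (n s).re := by fun_prop
  have cni : Continuous fun s => (n s).im := by fun_prop
  obtain ⟨T, hT⟩ := (isCompact_Icc (a := (0 : ℝ)) (b := L)).exists_bound_of_continuousOn
    (f := fun s => pd I h (γ s) * (n s).re - pd 1 h (γ s) * (n s).im)
    (((H.continuous_comp (hh.pd I)).mul cnr).sub
      ((H.continuous_comp (hh.pd 1)).mul cni)).continuousOn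
  obtain ⟨D, hD⟩ := (isCompact_Icc (a := (0 : ℝ)) (b := L)).exists_bound_of_continuousOn
    (f := γ) cγ.continuousOn
  have hc := H.cpos
  have hL := H.Lpos
  set K₀ := (|D| / 2 + D ^ 2 / c + c / 4) * T ^ 2 with hK₀
  refine ⟨L * K₀, by positivity, fun a ha heq => ?_⟩
  rw [H.pohozaev_scalar ha]
  have c1 := H.continuous_comp (ha.pd 1)
  have c2 := H.continuous_comp (ha.pd I)
  have hmono := intervalIntegral.integral_mono_on (μ := volume) hL.le
    (f := fun s => c / 4 * (pd 1 a (γ s) ^ 2 + pd I a (γ s) ^ 2) - K₀)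
    (g := fun s => (((γ s).re * pd 1 a (γ s) + (γ s).im * pd I a (γ s)) *
        (pd 1 a (γ s) * (n s).re + pd I a (γ s) * (n s).im) -
        1 / 2 * ((γ s).re * (n s).re + (γ s).im * (n s).im) *
          (pd 1 a (γ s) ^ 2 + pd I a (γ s) ^ 2)))
    (Continuous.intervalIntegrable (by fun_prop) _ _)
    (Continuous.intervalIntegrable (by fun_prop) _ _) ?_
  · rw [intervalIntegral.integral_sub (Continuous.intervalIntegrable (by fun_prop) _ _)
      (Continuous.intervalIntegrable (by fun_prop) _ _), intervalIntegral.integral_const_mul] at hmono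
    simpa using hmono
  · intro s hs
    have ht := H.tangential_eq ha hh heq s
    have hTs := hT s hs
    simp only [Real.norm_eq_abs] at hTs
    rw [← ht] at hTs
    have hDs := hD s hs
    have hst := H.star s
    have hu := H.unit s
    have hnorm : (γ s).re ^ 2 + (γ s).im ^ 2 ≤ D ^ 2 := by
      have := pow_le_pow_left₀ (norm_nonneg _) hDs 2
      rw [← Complex.normSq_eq_norm_sq, Complex.normSq_apply] at this
      nlinarith
    set p := pd 1 a (γ s)
    set r := pd I a (γ s)
    set x := (γ s).re
    set y := (γ s).im
    set n1 := (n s).re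
    set n2 := (n s).im
    have hTs2 : (r * n1 - p * n2) ^ 2 ≤ T ^ 2 := by
      rw [← sq_abs]; exact pow_le_pow_left₀ (abs_nonneg _) hTs 2
    set aT := r * n1 - p * n2 with haT
    set aN := p * n1 + r * n2 with haN
    set gn := x * n1 + y * n2 with hgn
    set gt := y * n1 - x * n2 with hgt
    have e1 : x * p + y * r = gn * aN + gt * aT := by
      simp only [hgn, haN, hgt, haT]
      linear_combination (-(x * p + y * r)) * hu
    have e2 : p ^ 2 + r ^ 2 = aN ^ 2 + aT ^ 2 := by
      simp only [haN, haT]; linear_combination (-(p ^ 2 + r ^ 2)) * hu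
    have e3 : gn ^ 2 + gt ^ 2 ≤ D ^ 2 := by
      have : gn ^ 2 + gt ^ 2 = x ^ 2 + y ^ 2 := by
        simp only [hgn, hgt]; linear_combination (x ^ 2 + y ^ 2) * hu
      linarith
    have e4 : gn ≤ |D| := by
      have : |gn| ≤ |D| := sq_le_sq.1 (by nlinarith [sq_nonneg gt])
      exact (le_abs_self _).trans this
    have e5 : gt ^ 2 ≤ D ^ 2 := by nlinarith [sq_nonneg gn]
    show c / 4 * (p ^ 2 + r ^ 2) - K₀ ≤ (x * p + y * r) * aN - 1 / 2 * gn * (p ^ 2 + r ^ 2)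
    rw [e1, e2]
    have f1 : c * aN ^ 2 ≤ gn * aN ^ 2 := mul_le_mul_of_nonneg_right hst (sq_nonneg _)
    have f2 : gn * aT ^ 2 ≤ |D| * T ^ 2 :=
      (mul_le_mul_of_nonneg_right e4 (sq_nonneg _)).trans
        (mul_le_mul_of_nonneg_left hTs2 (abs_nonneg _))
    have f3 : -(gt * aT * aN) ≤ c / 4 * aN ^ 2 + D ^ 2 / c * T ^ 2 := by
      have g1 : gt ^ 2 * aT ^ 2 ≤ D ^ 2 * T ^ 2 := mul_le_mul e5 hTs2 (sq_nonneg _) (sq_nonneg _)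
      have g2 : -(gt * aT * aN) ≤ c / 4 * aN ^ 2 + (gt ^ 2 * aT ^ 2) / c := by
        have : c / 4 * aN ^ 2 + (gt ^ 2 * aT ^ 2) / c + gt * aT * aN =
          (c * aN / 2 + gt * aT) ^ 2 / c := by
          field_simp; ring
        have : 0 ≤ (c * aN / 2 + gt * aT) ^ 2 / c := by positivity
        linarith
      have g3 : (gt ^ 2 * aT ^ 2) / c ≤ D ^ 2 * T ^ 2 / c := div_le_div_of_nonneg_right g1 hc.le
      have : D ^ 2 / c * T ^ 2 = D ^ 2 * T ^ 2 / c := by ring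
      linarith
    have f4 : c / 4 * aT ^ 2 ≤ c / 4 * T ^ 2 := mul_le_mul_of_nonneg_left hTs2 (by positivity)
    have : K₀ = |D| * T ^ 2 / 2 + D ^ 2 / c * T ^ 2 + c / 4 * T ^ 2 := by rw [hK₀]; ring
    have e6 : (gn * aN + gt * aT) * aN - 1 / 2 * gn * (aN ^ 2 + aT ^ 2) =
      1 / 2 * (gn * aN ^ 2) + gt * aT * aN - 1 / 2 * (gn * aT ^ 2) := by ring
    have e7 : 0 ≤ |D| * T ^ 2 := by positivity
    rw [this, e6]
    clear_value aN aT gn gt K₀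
    clear hK₀
    linarith

end StarDomain

lemma gradSq_eq {u : ℂ → ℂ} (hu : ContDiff ℝ (⊤ : ℕ∞) u) (x : ℂ) :
    gradSq u x = (pd 1 (fun y => (u y).re) x ^ 2 + pd I (fun y => (u y).re) x ^ 2) +
      (pd 1 (fun y => (u y).im) x ^ 2 + pd I (fun y => (u y).im) x ^ 2) := by
  rw [pd_re hu, pd_re hu, pd_im hu, pd_im hu]
  unfold gradSq
  rw [← Complex.normSq_eq_norm_sq, ← Complex.normSq_eq_norm_sq, Complex.normSq_apply,
    Complex.normSq_apply]
  unfold pd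
  ring

lemma contDiff_gradSq {u : ℂ → ℂ} (hu : ContDiff ℝ (⊤ : ℕ∞) u) :
    ContDiff ℝ (⊤ : ℕ∞) (gradSq u) := by
  rw [funext (gradSq_eq hu)]
  exact (((hu.re'.pd 1).pow 2).add ((hu.re'.pd I).pow 2)).add
    (((hu.im'.pd 1).pow 2).add ((hu.im'.pd I).pow 2))

lemma gradSq_nonneg (u : ℂ → ℂ) (x : ℂ) : 0 ≤ gradSq u x := by unfold gradSq; positivity

lemma SolvesGL.lap_re {W : ℂ → ℝ} {Ω : Set ℂ} {ε : ℝ} {u : ℂ → ℂ} (h : SolvesGL W Ω ε u)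
    {x : ℂ} (hx : x ∈ Ω) :
    pd 1 (pd 1 fun y => (u y).re) x + pd I (pd I fun y => (u y).re) x =
      (ε ^ 2)⁻¹ * pd 1 W (u x) := by
  have h2 := congrArg Complex.re (h.2 x hx)
  have e : ∀ e, (pd e fun y => (u y).re) = fun y => (pd e u y).re :=
    fun e => funext fun y => pd_re h.1 e y
  have e2 : (gradW W (u x)).re = pd 1 W (u x) := by simp [gradW, pd]
  rw [Complex.smul_re, e2, smul_eq_mul] at h2
  rw [e, e, pd_re (h.1.pd 1), pd_re (h.1.pd I)]
  exact h2

lemma SolvesGL.lap_im {W : ℂ → ℝ} {Ω : Set ℂ} {ε : ℝ} {u : ℂ → ℂ} (h : SolvesGL W Ω ε u)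
    {x : ℂ} (hx : x ∈ Ω) :
    pd 1 (pd 1 fun y => (u y).im) x + pd I (pd I fun y => (u y).im) x =
      (ε ^ 2)⁻¹ * pd I W (u x) := by
  have h2 := congrArg Complex.im (h.2 x hx)
  have e : ∀ e, (pd e fun y => (u y).im) = fun y => (pd e u y).im :=
    fun e => funext fun y => pd_im h.1 e y
  have e2 : (gradW W (u x)).im = pd I W (u x) := by simp [gradW, pd]
  rw [Complex.smul_im, e2, smul_eq_mul] at h2
  rw [e, e, pd_im (h.1.pd 1), pd_im (h.1.pd I)]
  exact h2

lemma pd_comp' {f : ℂ → ℝ} {u : ℂ → ℂ} (hf : ContDiff ℝ (⊤ : ℕ∞) f)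
    (hu : ContDiff ℝ (⊤ : ℕ∞) u) (e x : ℂ) :
    pd e (fun y => f (u y)) x = pd 1 f (u x) * pd e (fun y => (u y).re) x +
      pd I f (u x) * pd e (fun y => (u y).im) x := by
  rw [pd_comp hf hu, fderiv_eq_pd, pd_re hu, pd_im hu]
  simp
  ring

/-- Pohozaev bound: for solutions on a strictly star-shaped domain the potential energy and the
boundary gradient are bounded independently of `ε`. -/
lemma StarDomain.pohozaev_bound {Ω : Set ℂ} {γ n : ℝ → ℂ} {L c σ : ℝ}
    (H : StarDomain Ω γ n L c σ) {W : ℂ → ℝ} (hW : ContDiff ℝ (⊤ : ℕ∞) W) (hW0 : ∀ z, 0 ≤ W z)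
    {g : ℂ → ℂ} (hg : ContDiff ℝ (⊤ : ℕ∞) g) (hWg : ∀ s, W (g (γ s)) = 0) :
    ∃ C : ℝ, 0 ≤ C ∧ ∀ (ε : ℝ) (u : ℂ → ℂ), SolvesGL W Ω ε u →
      (∀ s, u (γ s) = g (γ s)) →
      (ε ^ 2)⁻¹ * (∫ x in Ω, W (u x)) ≤ C ∧ ∫ s in (0 : ℝ)..L, gradSq u (γ s) ≤ C := by
  obtain ⟨K₁, hK₁, h1⟩ := H.pohozaev_boundary hg.re'
  obtain ⟨K₂, hK₂, h2⟩ := H.pohozaev_boundary hg.im'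
  have hc := H.cpos
  refine ⟨(K₁ + K₂) * (1 + 4 / c), by positivity, fun ε u hu hb => ?_⟩
  have hus := hu.1
  have hre := h1 _ hus.re' (fun s => by rw [hb])
  have him := h2 _ hus.im' (fun s => by rw [hb])
  have hV : ContDiff ℝ (⊤ : ℕ∞) (fun x => W (u x)) := hW.comp hus
  have hP := H.pohozaev_potential hV (fun s => by rw [hb]; exact hWg s)
  have ca1 := (hus.re'.pd 1).continuous
  have ca2 := (hus.re'.pd I).continuous
  have cb1 := (hus.im'.pd 1).continuous
  have cb2 := (hus.im'.pd I).continuous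
  have ca11 := ((hus.re'.pd 1).pd 1).continuous
  have ca22 := ((hus.re'.pd I).pd I).continuous
  have cb11 := ((hus.im'.pd 1).pd 1).continuous
  have cb22 := ((hus.im'.pd I).pd I).continuous
  have cV := hV.continuous
  have cV1 := (hV.pd 1).continuous
  have cV2 := (hV.pd I).continuous
  have cγ := H.continuous
  have hsum : (∫ x in Ω, (x.re * pd 1 (fun y => (u y).re) x + x.im * pd I (fun y => (u y).re) x) *
        (pd 1 (pd 1 (fun y => (u y).re)) x + pd I (pd I (fun y => (u y).re)) x)) +
      (∫ x in Ω, (x.re * pd 1 (fun y => (u y).im) x + x.im * pd I (fun y => (u y).im) x) *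
        (pd 1 (pd 1 (fun y => (u y).im)) x + pd I (pd I (fun y => (u y).im)) x)) =
      (ε ^ 2)⁻¹ * ∫ x in Ω, (x.re * pd 1 (fun y => W (u y)) x +
        x.im * pd I (fun y => W (u y)) x) := by
    rw [← integral_add (H.integrableOn (by fun_prop)) (H.integrableOn (by fun_prop)),
      ← integral_const_mul]
    refine setIntegral_congr_fun H.isOpen.measurableSet fun x hx => ?_
    rw [hu.lap_re hx, hu.lap_im hx, pd_comp' hW hus, pd_comp' hW hus]
    ring
  rw [integral_add (H.integrableOn (by fun_prop)) (H.integrableOn (by fun_prop)),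
    integral_const_mul] at hP
  have hB : ∫ s in (0 : ℝ)..L, gradSq u (γ s) =
      (∫ s in (0 : ℝ)..L, (pd 1 (fun y => (u y).re) (γ s) ^ 2 +
        pd I (fun y => (u y).re) (γ s) ^ 2)) +
      ∫ s in (0 : ℝ)..L, (pd 1 (fun y => (u y).im) (γ s) ^ 2 +
        pd I (fun y => (u y).im) (γ s) ^ 2) := by
    rw [← intervalIntegral.integral_add (Continuous.intervalIntegrable (by fun_prop) _ _)
      (Continuous.intervalIntegrable (by fun_prop) _ _)]
    simp only [gradSq_eq hus]
  have hpos : 0 ≤ ∫ s in (0 : ℝ)..L, gradSq u (γ s) :=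
    intervalIntegral.integral_nonneg H.Lpos.le fun s _ => gradSq_nonneg u _
  have hWpos : 0 ≤ (ε ^ 2)⁻¹ * ∫ x in Ω, W (u x) :=
    mul_nonneg (by positivity) (integral_nonneg fun x => hW0 _)
  have hmain : c / 4 * (∫ s in (0 : ℝ)..L, gradSq u (γ s)) +
      2 * ((ε ^ 2)⁻¹ * ∫ x in Ω, W (u x)) ≤ K₁ + K₂ := by
    rw [hB]
    have : (ε ^ 2)⁻¹ * ∫ x in Ω, (x.re * pd 1 (fun y => W (u y)) x +
        x.im * pd I (fun y => W (u y)) x) = - (2 * ((ε ^ 2)⁻¹ * ∫ x in Ω, W (u x))) := by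
      linear_combination (ε ^ 2)⁻¹ * hP
    linarith
  constructor
  · have : 0 ≤ c / 4 * (∫ s in (0 : ℝ)..L, gradSq u (γ s)) := by positivity
    have : 0 ≤ (K₁ + K₂) * (4 / c) := by positivity
    linarith
  · have h3 : c / 4 * (∫ s in (0 : ℝ)..L, gradSq u (γ s)) ≤ K₁ + K₂ := by linarith
    have h4 : (∫ s in (0 : ℝ)..L, gradSq u (γ s)) ≤ (K₁ + K₂) * (4 / c) := by
      have := mul_le_mul_of_nonneg_right h3 (show 0 ≤ 4 / c by positivity)
      have e : c / 4 * (∫ s in (0 : ℝ)..L, gradSq u (γ s)) * (4 / c) =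
        ∫ s in (0 : ℝ)..L, gradSq u (γ s) := by field_simp
      linarith
    linarith

/-! ### Geometry of the target curve -/

/-- The Euclidean inner product on the plane. -/
def dot (a b : ℂ) : ℝ := a.re * b.re + a.im * b.im

lemma dot_sub (a b c : ℂ) : dot a (b - c) = dot a b - dot a c := by simp [dot]; ring
lemma dot_smul (r : ℝ) (a b : ℂ) : dot a (r • b) = r * dot a b := by simp [dot]; ring

lemma norm_sq_eq (a : ℂ) : ‖a‖ ^ 2 = a.re ^ 2 + a.im ^ 2 := by
  rw [Complex.sq_norm, normSq_apply]; ring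

lemma norm_sq_eq_dot (a : ℂ) : ‖a‖ ^ 2 = dot a a := by rw [norm_sq_eq]; unfold dot; ring

lemma abs_dot_le (a b : ℂ) : |dot a b| ≤ ‖a‖ * ‖b‖ := by
  apply abs_le_of_sq_le_sq _ (by positivity)
  rw [mul_pow, norm_sq_eq, norm_sq_eq]
  unfold dot
  nlinarith [sq_nonneg (a.re * b.im - a.im * b.re)]

lemma Function.Periodic.exists_norm_le {E : Type*} [NormedAddCommGroup E] {f : ℝ → E} {T : ℝ}
    (hf : Function.Periodic f T) (hT : 0 < T) (hc : Continuous f) : ∃ K, 0 < K ∧ ∀ s, ‖f s‖ ≤ K := by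
  obtain ⟨K, hK⟩ := (isCompact_Icc (a := 0) (b := T)).exists_bound_of_continuousOn hc.continuousOn
  refine ⟨max K 1, by positivity, fun s => ?_⟩
  obtain ⟨y, hy, hys⟩ := hf.exists_mem_Ico₀ hT s
  rw [hys]
  exact (hK y (Ico_subset_Icc_self hy)).trans (le_max_left _ _)

lemma Function.Periodic.deriv' {E : Type*} [NormedAddCommGroup E] [NormedSpace ℝ E] {f : ℝ → E}
    {T : ℝ} (hf : Function.Periodic f T) : Function.Periodic (deriv f) T := by
  intro s
  rw [← deriv_comp_add_const]
  congr 1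
  ext x
  exact hf x

lemma quadratic_taylor {τ : ℝ → ℂ} (hs : ContDiff ℝ (⊤ : ℕ∞) τ) {T : ℝ} (hT : 0 < T)
    (hp : Function.Periodic τ T) :
    ∃ K, 0 < K ∧ ∀ s h, ‖τ (s + h) - τ s - h • deriv τ s‖ ≤ K * h ^ 2 := by
  have h1 : ContDiff ℝ (⊤ : ℕ∞) (deriv τ) := by
    have : ContDiff ℝ ((⊤ : ℕ∞) + 1) τ := hs
    exact (contDiff_succ_iff_deriv.1 this).2.2
  have h2 : Continuous (deriv (deriv τ)) := h1.continuous_deriv (by simp)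
  obtain ⟨K, hK0, hK⟩ := hp.deriv'.deriv'.exists_norm_le hT h2
  refine ⟨K, hK0, fun s h => ?_⟩
  have hL : ∀ x y : ℝ, ‖deriv τ y - deriv τ x‖ ≤ K * ‖y - x‖ := fun x y =>
    convex_univ.norm_image_sub_le_of_norm_deriv_le
      (fun z _ => (h1.differentiable (by simp)) z) (fun z _ => hK z) (mem_univ _) (mem_univ _)
  have hd : ∀ x, HasDerivAt (fun x => τ (s + x) - x • deriv τ s) (deriv τ (s + x) - deriv τ s) x := by
    intro x
    have a1 : HasDerivAt (fun x => τ (s + x)) (deriv τ (s + x)) x := by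
      have := ((hs.differentiable (by simp)) (s + x)).hasDerivAt
      exact this.comp_const_add s x
    have a2 : HasDerivAt (fun x : ℝ => x • deriv τ s) ((1 : ℝ) • deriv τ s) x :=
      (hasDerivAt_id x).smul_const _
    exact (a1.fun_sub a2).congr_deriv (by simp)
  have := (convex_uIcc (0:ℝ) h).norm_image_sub_le_of_norm_hasDerivWithin_le (C := K * |h|)
    (fun x _ => (hd x).hasDerivWithinAt) (fun x hx => ?_) (left_mem_uIcc) (right_mem_uIcc)
  · simp only [add_zero, zero_smul, sub_zero, Real.norm_eq_abs] at this
    calc _ = ‖τ (s + h) - h • deriv τ s - τ s‖ := by congr 1; abel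
      _ ≤ _ := this
      _ = K * h ^ 2 := by rw [mul_assoc, ← sq, sq_abs]
  · refine (hL s (s + x)).trans ?_
    have : |x| ≤ |h| := by
      have := abs_sub_left_of_mem_uIcc hx
      simpa using this
    simpa using mul_le_mul_of_nonneg_left this hK0.le

namespace ArcParam
variable {Γ : Set ℂ} {τ : ℝ → ℂ}

lemma contDiff_deriv (H : ArcParam Γ τ) : ContDiff ℝ (⊤ : ℕ∞) (deriv τ) := by
  have : ContDiff ℝ ((⊤ : ℕ∞) + 1) τ := H.smooth
  exact (contDiff_succ_iff_deriv.1 this).2.2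

lemma hasDerivAt (H : ArcParam Γ τ) (s : ℝ) : HasDerivAt τ (deriv τ s) s :=
  ((H.smooth.differentiable (by simp)) s).hasDerivAt

/-- The chord-arc property of a simple closed curve. -/
lemma chord_arc (H : ArcParam Γ τ) :
    ∃ C, 0 < C ∧ ∀ s s' : ℝ, ∃ k : ℤ, |s - s' - 2 * Real.pi * k| ≤ C * ‖τ s - τ s'‖ := by
  obtain ⟨K, hK0, hK⟩ := quadratic_taylor H.smooth Real.two_pi_pos H.periodic
  set S : Set (ℝ × ℝ) := Icc 0 (2 * Real.pi) ×ˢ (Icc (-Real.pi) Real.pi ∩ {h | 1 / (2 * K) ≤ |h|})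
    with hS
  have hSc : IsCompact S := isCompact_Icc.prod
    (isCompact_Icc.inter_right (isClosed_le continuous_const continuous_abs))
  have hτ := H.smooth.continuous
  have hSp : ∀ p ∈ S, 0 < ‖τ (p.1 + p.2) - τ p.1‖ := by
    rintro ⟨s, h⟩ ⟨-, hh, hh'⟩
    simp only [norm_pos_iff, sub_ne_zero]
    intro heq
    obtain ⟨k, hk⟩ := H.inj _ _ heq
    simp only [mem_ofPred_eq, mem_Icc, add_sub_cancel_left] at hh hh' hk
    have hpi := Real.pi_pos
    have : k = 0 := by
      have h1 : (k : ℝ) < 1 := by nlinarith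
      have h2 : (-1 : ℝ) < k := by nlinarith
      have h1' : k < 1 := by exact_mod_cast h1
      have h2' : -1 < k := by exact_mod_cast h2
      omega
    subst this
    simp only [Int.cast_zero, mul_zero] at hk
    rw [hk, abs_zero] at hh'
    have : 0 < 1 / (2 * K) := by positivity
    linarith
  obtain ⟨m, hm0, hm⟩ : ∃ m > 0, ∀ p ∈ S, m ≤ ‖τ (p.1 + p.2) - τ p.1‖ :=
    hSc.exists_forall_le' (by fun_prop) hSp
  refine ⟨max 2 (Real.pi / m), by positivity, fun s s' => ?_⟩
  obtain ⟨y, hy, k1, hk1⟩ : ∃ y ∈ Icc 0 (2 * Real.pi), ∃ k : ℤ, s' - 2 * Real.pi * k = y := by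
    refine ⟨toIcoMod Real.two_pi_pos 0 s', ?_, toIcoDiv Real.two_pi_pos 0 s', ?_⟩
    · have := toIcoMod_mem_Ico Real.two_pi_pos 0 s'
      rw [zero_add] at this
      exact Ico_subset_Icc_self this
    · rw [← self_sub_toIcoDiv_zsmul, zsmul_eq_mul]; ring
  obtain ⟨h, hh, k2, hk2⟩ : ∃ h ∈ Icc (-Real.pi) Real.pi, ∃ k : ℤ, s - s' - 2 * Real.pi * k = h := by
    refine ⟨toIcoMod Real.two_pi_pos (-Real.pi) (s - s'), ?_, toIcoDiv Real.two_pi_pos (-Real.pi) (s - s'), ?_⟩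
    · have := toIcoMod_mem_Ico Real.two_pi_pos (-Real.pi) (s - s')
      have h2 : -Real.pi + 2 * Real.pi = Real.pi := by ring
      rw [h2] at this
      exact Ico_subset_Icc_self this
    · rw [← self_sub_toIcoDiv_zsmul, zsmul_eq_mul]; ring
  refine ⟨k2, ?_⟩
  rw [hk2]
  have hper : ∀ (k : ℤ) x, τ (x - 2 * Real.pi * k) = τ x := by
    intro k x
    rw [mul_comm]; exact H.periodic.sub_int_mul_eq k
  have e1 : τ y = τ s' := by rw [← hk1, hper]
  have e2 : τ (y + h) = τ s := by
    rw [← hk1, ← hk2, ← hper (k1 + k2) s]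
    congr 1; push_cast; ring
  rw [← e1, ← e2]
  by_cases hsm : 1 / (2 * K) ≤ |h|
  · have := hm (y, h) ⟨hy, hh, hsm⟩
    simp only at this
    have h1 : |h| ≤ Real.pi := abs_le.2 hh
    calc |h| ≤ Real.pi / m * m := by rw [div_mul_cancel₀ _ hm0.ne']; exact h1
      _ ≤ _ := by gcongr; exact le_max_right _ _
  · have h3 := hK y h
    have h4 : ‖h • deriv τ y‖ = |h| := by rw [norm_smul, H.arclength]; simp
    have h5 : ‖h • deriv τ y‖ ≤ ‖τ (y + h) - τ y‖ + ‖τ (y + h) - τ y - h • deriv τ y‖ := by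
      have := norm_sub_le (τ (y + h) - τ y) (τ (y + h) - τ y - h • deriv τ y)
      simpa using this
    have h6 : K * h ^ 2 ≤ |h| / 2 := by
      rw [not_le, lt_div_iff₀ (by positivity)] at hsm
      rw [← sq_abs]
      nlinarith [abs_nonneg h]
    have h7 : |h| ≤ 2 * ‖τ (y + h) - τ y‖ := by linarith
    refine h7.trans ?_
    gcongr
    exact le_max_left _ _

/-- Small normal displacements realize the distance to the curve. -/
lemma abs_le_infDist (H : ArcParam Γ τ) :
    ∃ t₀ > 0, ∀ s t : ℝ, |t| ≤ t₀ → |t| ≤ infDist (τ s + t • (I * deriv τ s)) Γ := by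
  obtain ⟨K, hK0, hK⟩ := quadratic_taylor H.smooth Real.two_pi_pos H.periodic
  obtain ⟨C, hC0, hC⟩ := H.chord_arc
  refine ⟨1 / (2 * (K * C ^ 2)), by positivity, fun s t ht => ?_⟩
  have hne : Γ.Nonempty := by rw [← H.srange]; exact range_nonempty _
  refine (le_infDist hne).2 ?_
  rw [← H.srange]
  rintro _ ⟨s', rfl⟩
  obtain ⟨k, hk⟩ := hC s' s
  set h := s' - s - 2 * Real.pi * k with hh
  have e1 : τ s' = τ (s + h) := by
    have : s + h = s' - k * (2 * Real.pi) := by rw [hh]; ring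
    rw [this]; exact (H.periodic.sub_int_mul_eq k).symm
  rw [e1] at hk ⊢
  set D := τ (s + h) - τ s with hD
  clear_value D h
  have h1 := hK s h
  rw [← hD] at h1
  set N := I * deriv τ s with hN
  have hN1 : ‖N‖ = 1 := by rw [hN, norm_mul, H.arclength]; simp
  have hdN : dot N (deriv τ s) = 0 := by rw [hN]; simp [dot]; ring
  have h2 : |dot N D| ≤ K * h ^ 2 := by
    have : dot N D = dot N (D - h • deriv τ s) := by rw [dot_sub, dot_smul, hdN]; ring
    rw [this]
    refine (abs_dot_le _ _).trans ?_
    rw [hN1, one_mul]; exact h1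
  have h3 : h ^ 2 ≤ C ^ 2 * ‖D‖ ^ 2 := by
    rw [← mul_pow]; exact sq_le_sq' (by linarith [neg_abs_le h]) ((le_abs_self _).trans hk)
  have h4 : |2 * t * dot N D| ≤ ‖D‖ ^ 2 := by
    rw [abs_mul, abs_mul, abs_two]
    have : |dot N D| ≤ K * C ^ 2 * ‖D‖ ^ 2 := by
      refine h2.trans ?_
      rw [mul_assoc]; gcongr
    calc 2 * |t| * |dot N D| ≤ 2 * (1 / (2 * (K * C ^ 2))) * (K * C ^ 2 * ‖D‖ ^ 2) := by gcongr
      _ = _ := by field_simp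
  rw [dist_eq_norm]
  apply abs_le_of_sq_le_sq _ (by positivity)
  have h5 : τ s + t • N - τ (s + h) = t • N - D := by rw [hD]; abel
  have hNN : dot N N = 1 := by rw [← norm_sq_eq_dot, hN1]; norm_num
  have h6 : dot (t • N - D) (t • N - D) = t ^ 2 * dot N N - 2 * t * dot N D + ‖D‖ ^ 2 := by
    rw [norm_sq_eq_dot]; simp [dot]; ring
  rw [h5, norm_sq_eq_dot, h6, hNN]
  have := le_abs_self (2 * t * dot N D)
  nlinarith

lemma isCompact (H : ArcParam Γ τ) : IsCompact Γ := by
  have : Γ = τ '' Icc 0 (2 * Real.pi) := by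
    rw [← H.srange]
    refine Subset.antisymm ?_ (image_subset_range _ _)
    rintro _ ⟨s, rfl⟩
    obtain ⟨y, hy, h⟩ := H.periodic.exists_mem_Ico₀ Real.two_pi_pos s
    exact ⟨y, Ico_subset_Icc_self hy, h.symm⟩
  rw [this]
  exact isCompact_Icc.image H.smooth.continuous

lemma nonempty (H : ArcParam Γ τ) : Γ.Nonempty := by
  rw [← H.srange]; exact range_nonempty _

lemma mem (H : ArcParam Γ τ) (s : ℝ) : τ s ∈ Γ := by
  rw [← H.srange]; exact mem_range_self _

lemma periodic_sub (_H : ArcParam Γ τ) {E : Type*} {G : ℝ → E}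
    (hG : Function.Periodic G (2 * Real.pi)) (s : ℝ) (k : ℤ) : G (s - 2 * Real.pi * k) = G s := by
  rw [mul_comm]; exact hG.sub_int_mul_eq k

open scoped Manifold ContDiff in
/-- Smooth periodic functions of the arclength extend to smooth functions on the plane. -/
lemma exists_extension (H : ArcParam Γ τ) {E : Type*} [NormedAddCommGroup E] [NormedSpace ℝ E]
    {G : ℝ → E} (hG : ContDiff ℝ (⊤ : ℕ∞) G) (hp : Function.Periodic G (2 * Real.pi)) :
    ∃ f : ℂ → E, ContDiff ℝ (⊤ : ℕ∞) f ∧ ∀ s, f (τ s) = G s := by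
  obtain ⟨C, hC0, hC⟩ := H.chord_arc
  have ht : ∀ z : ℂ, Convex ℝ {v : E | ∀ s, τ s = z → v = G s} := by
    intro z v hv w hw a b _ _ hab s hs
    rw [hv s hs, hw s hs, ← add_smul, hab, one_smul]
  have hloc : ∀ x : ℂ, ∃ U ∈ 𝓝 x, ∃ g : ℂ → E, ContMDiffOn 𝓘(ℝ, ℂ) 𝓘(ℝ, E) (⊤ : ℕ∞) g U ∧
      ∀ y ∈ U, g y ∈ {v : E | ∀ s, τ s = y → v = G s} := by
    intro x
    by_cases hx : x ∈ Γ
    · rw [← H.srange] at hx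
      obtain ⟨s₀, rfl⟩ := hx
      set p : ℂ → ℝ := fun z => dot (z - τ s₀) (deriv τ s₀) with hpdef
      have hpsm : ContDiff ℝ (⊤ : ℕ∞) p := by
        simp only [hpdef, dot]
        exact ((Complex.reCLM.contDiff.comp (contDiff_id.sub contDiff_const)).mul contDiff_const).add
          ((Complex.imCLM.contDiff.comp (contDiff_id.sub contDiff_const)).mul contDiff_const)
      set ψ : ℝ → ℝ := fun s => p (τ s) with hψdef
      have hψsm : ContDiff ℝ (⊤ : ℕ∞) ψ := hpsm.comp H.smooth
      have hψd : ∀ s, HasDerivAt ψ (dot (deriv τ s) (deriv τ s₀)) s := by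
        intro s
        have h1 := H.hasDerivAt s
        have h2 : HasDerivAt (fun s => (τ s).re) (deriv τ s).re s :=
          (Complex.reCLM.hasFDerivAt).comp_hasDerivAt s h1
        have h3 : HasDerivAt (fun s => (τ s).im) (deriv τ s).im s :=
          (Complex.imCLM.hasFDerivAt).comp_hasDerivAt s h1
        have h4 := ((h2.sub_const (τ s₀).re).mul_const (deriv τ s₀).re).fun_add
          ((h3.sub_const (τ s₀).im).mul_const (deriv τ s₀).im)
        exact h4
      have hψ0 : HasFDerivAt ψ ((ContinuousLinearEquiv.refl ℝ ℝ : ℝ ≃L[ℝ] ℝ) : ℝ →L[ℝ] ℝ) s₀ := by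
        have h1 := (hψd s₀).hasFDerivAt
        rw [← norm_sq_eq_dot, H.arclength] at h1
        refine h1.congr_fderiv ?_
        ext; simp
      set e := (hψsm.contDiffAt (x := s₀)).toOpenPartialHomeomorph ψ hψ0 (by simp) with he
      have hes : s₀ ∈ e.source := ContDiffAt.mem_toOpenPartialHomeomorph_source _ _ _
      have hecoe : ∀ s, e s = ψ s := fun s => rfl
      have hopen1 : IsOpen {s | dot (deriv τ s) (deriv τ s₀) ≠ 0} := by
        have := H.contDiff_deriv.continuous
        refine isOpen_ne_fun ?_ continuous_const
        unfold dot; fun_prop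
      set T := e.target ∩ e.symm ⁻¹' {s | dot (deriv τ s) (deriv τ s₀) ≠ 0} with hT
      have hTo : IsOpen T := e.isOpen_inter_preimage_symm hopen1
      have hT0 : p (τ s₀) ∈ T := by
        refine ⟨e.map_source hes, ?_⟩
        simp only [mem_preimage]
        have : e.symm (p (τ s₀)) = s₀ := e.left_inv hes
        rw [this]
        simp [← norm_sq_eq_dot, H.arclength]
      obtain ⟨ρ, hρ0, hρ⟩ := Metric.isOpen_iff.1 e.open_source s₀ hes
      refine ⟨p ⁻¹' T ∩ ball (τ s₀) (ρ / C), ?_, fun z => G (e.symm (p z)), ?_, ?_⟩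
      · exact ((hTo.preimage hpsm.continuous).inter isOpen_ball).mem_nhds
          ⟨hT0, mem_ball_self (by positivity)⟩
      · refine ContDiffOn.contMDiffOn ?_
        rintro z ⟨hz, -⟩
        have h1 : ContDiffAt ℝ (⊤ : ℕ∞) e.symm (p z) :=
          e.contDiffAt_symm_deriv hz.2 hz.1 (hψd _) hψsm.contDiffAt
        exact (hG.contDiffAt.comp z (h1.comp z hpsm.contDiffAt)).contDiffWithinAt
      · rintro y ⟨hy1, hy2⟩ s rfl
        obtain ⟨k, hk⟩ := hC s s₀
        rw [mem_ball, dist_eq_norm, lt_div_iff₀ hC0] at hy2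
        have hmem : s - 2 * Real.pi * k ∈ e.source := by
          apply hρ
          rw [mem_ball, Real.dist_eq]
          have : s - 2 * Real.pi * k - s₀ = s - s₀ - 2 * Real.pi * k := by ring
          rw [this]; linarith
        have := e.left_inv hmem
        have h2 : e (s - 2 * Real.pi * k) = p (τ s) := by
          rw [hecoe, hψdef]; simp only; rw [H.periodic_sub H.periodic]
        rw [h2] at this
        simp only
        rw [this, H.periodic_sub hp]
    · refine ⟨Γᶜ, H.isCompact.isClosed.isOpen_compl.mem_nhds hx, fun _ => 0,
        contMDiffOn_const, ?_⟩
      rintro y hy s rfl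
      exact absurd (H.mem s) hy
  obtain ⟨f, hf⟩ := exists_contMDiffMap_forall_mem_convex_of_local 𝓘(ℝ, ℂ) (n := (⊤ : ℕ∞)) ht hloc
  exact ⟨f, f.contMDiff.contDiff, fun s => hf (τ s) s rfl⟩

end ArcParam

/-! ### Second derivative test and estimates near the target curve -/

lemma IsLocalMax.deriv_deriv_nonpos {f : ℝ → ℝ} {x : ℝ} (h : IsLocalMax f x)
    (hc : ContinuousAt f x) : deriv (deriv f) x ≤ 0 := by
  by_contra! hp
  have hmin := isLocalMin_of_deriv_deriv_pos hp h.deriv_eq_zero hc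
  have heq : f =ᶠ[𝓝 x] fun _ => f x := by
    filter_upwards [h, hmin] with y h1 h2 using le_antisymm h1 h2
  have := heq.deriv.deriv_eq
  rw [this] at hp
  simp at hp

lemma hasDerivAt_line {f : ℂ → ℝ} (hf : ContDiff ℝ (⊤ : ℕ∞) f) (z ξ : ℂ) (t : ℝ) :
    HasDerivAt (fun t : ℝ => f (z + t • ξ)) (pd ξ f (z + t • ξ)) t := by
  have h2 : HasDerivAt (fun t : ℝ => z + t • ξ) ξ t := by
    simpa using ((hasDerivAt_id t).smul_const ξ).const_add z
  exact (hf.diffAt _).hasFDerivAt.comp_hasDerivAt t h2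

lemma pd_eq (f : ℂ → ℝ) (x ξ : ℂ) : pd ξ f x = ξ.re * pd 1 f x + ξ.im * pd I f x :=
  fderiv_eq_pd f x ξ

lemma pd_pd_eq {f : ℂ → ℝ} (hf : ContDiff ℝ (⊤ : ℕ∞) f) (x ξ : ℂ) :
    pd ξ (pd ξ f) x = ξ.re ^ 2 * pd 1 (pd 1 f) x + 2 * ξ.re * ξ.im * pd 1 (pd I f) x +
      ξ.im ^ 2 * pd I (pd I f) x := by
  have h := pd_comm hf 1 I x
  rw [pd_eq, pd_comm hf 1 ξ, pd_comm hf I ξ, pd_eq (pd 1 f), pd_eq (pd I f), ← h]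
  ring

lemma deriv_deriv_line {f : ℂ → ℝ} (hf : ContDiff ℝ (⊤ : ℕ∞) f) (z ξ : ℂ) (t : ℝ) :
    deriv (deriv (fun t : ℝ => f (z + t • ξ))) t = pd ξ (pd ξ f) (z + t • ξ) := by
  have : deriv (fun t : ℝ => f (z + t • ξ)) = fun t => pd ξ f (z + t • ξ) :=
    funext fun t => (hasDerivAt_line hf z ξ t).deriv
  rw [this]
  exact (hasDerivAt_line (hf.pd ξ) z ξ t).deriv

lemma pd_pd_nonpos_of_isLocalMax {f : ℂ → ℝ} (hf : ContDiff ℝ (⊤ : ℕ∞) f) {z : ℂ}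
    (h : IsLocalMax f z) (ξ : ℂ) : pd ξ (pd ξ f) z ≤ 0 := by
  have hc : Continuous (fun t : ℝ => z + t • ξ) := by fun_prop
  have h2 : IsLocalMax (fun t : ℝ => f (z + t • ξ)) 0 := by
    have ht : Tendsto (fun t : ℝ => z + t • ξ) (𝓝 0) (𝓝 z) := by
      simpa using hc.tendsto 0
    have := ht.eventually h
    filter_upwards [this] with t ht
    simpa using ht
  have := h2.deriv_deriv_nonpos (hf.continuous.comp hc).continuousAt
  rw [deriv_deriv_line hf] at this
  simpa using this

section dist
variable {Γ : Set ℂ} {R : ℝ}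

lemma exists_lipschitz_const {Q : ℂ → ℝ} (hQ : ContDiff ℝ (⊤ : ℕ∞) Q) (R : ℝ) :
    ∃ C, 0 ≤ C ∧ ∀ z w, ‖z‖ ≤ R → ‖w‖ ≤ R → |Q z - Q w| ≤ C * ‖z - w‖ := by
  have hc : Continuous (fun z => fderiv ℝ Q z) := hQ.continuous_fderiv (by simp)
  obtain ⟨C, hC⟩ := (isCompact_closedBall (0:ℂ) R).exists_bound_of_continuousOn hc.continuousOn
  refine ⟨max C 0, le_max_right _ _, fun z w hz hw => ?_⟩
  exact (convex_closedBall (0:ℂ) R).norm_image_sub_le_of_norm_fderiv_le (𝕜 := ℝ)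
    (fun x _ => hQ.diffAt x) (fun x hx => (hC x hx).trans (le_max_left _ _))
    (by simpa using hw) (by simpa using hz)

lemma exists_sub_le_infDist (hc : IsCompact Γ) (hne : Γ.Nonempty) (hR : ∀ z ∈ Γ, ‖z‖ ≤ R)
    {Q : ℂ → ℝ} (hQ : ContDiff ℝ (⊤ : ℕ∞) Q) :
    ∃ C, 0 ≤ C ∧ ∀ z, ‖z‖ ≤ R → ∃ p ∈ Γ, |Q z - Q p| ≤ C * infDist z Γ := by
  obtain ⟨C, hC0, hC⟩ := exists_lipschitz_const hQ R
  refine ⟨C, hC0, fun z hz => ?_⟩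
  obtain ⟨p, hp, hd⟩ := hc.exists_infDist_eq_dist hne z
  refine ⟨p, hp, ?_⟩
  rw [hd, dist_eq_norm]
  exact hC z p hz (hR p hp)

lemma exists_le_infDist (hc : IsCompact Γ) (hne : Γ.Nonempty) (hR : ∀ z ∈ Γ, ‖z‖ ≤ R)
    {Q : ℂ → ℝ} (hQ : ContDiff ℝ (⊤ : ℕ∞) Q) (h0 : ∀ p ∈ Γ, Q p = 0) :
    ∃ C, 0 ≤ C ∧ ∀ z, ‖z‖ ≤ R → |Q z| ≤ C * infDist z Γ := by
  obtain ⟨C, hC0, hC⟩ := exists_sub_le_infDist hc hne hR hQ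
  refine ⟨C, hC0, fun z hz => ?_⟩
  obtain ⟨p, hp, h⟩ := hC z hz
  simpa [h0 p hp] using h

lemma exists_le_infDist_sq (hc : IsCompact Γ) (hne : Γ.Nonempty) (hR : ∀ z ∈ Γ, ‖z‖ ≤ R)
    {Q : ℂ → ℝ} (hQ : ContDiff ℝ (⊤ : ℕ∞) Q) (h0 : ∀ p ∈ Γ, Q p = 0)
    (h1 : ∀ p ∈ Γ, pd 1 Q p = 0) (h2 : ∀ p ∈ Γ, pd I Q p = 0) :
    ∃ C, 0 ≤ C ∧ ∀ z, ‖z‖ ≤ R → |Q z| ≤ C * infDist z Γ ^ 2 := by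
  obtain ⟨C1, hC10, hC1⟩ := exists_le_infDist hc hne hR (hQ.pd 1) h1
  obtain ⟨C2, hC20, hC2⟩ := exists_le_infDist hc hne hR (hQ.pd I) h2
  refine ⟨C1 + C2, by positivity, fun z hz => ?_⟩
  obtain ⟨p, hp, hd⟩ := hc.exists_infDist_eq_dist hne z
  have key : ∀ w ∈ segment ℝ p z, ‖fderiv ℝ Q w‖ ≤ (C1 + C2) * infDist z Γ := by
    intro w hw
    have hwR : ‖w‖ ≤ R := by
      have := (convex_closedBall (0:ℂ) R).segment_subset (x := p) (y := z)
        (by simpa using hR p hp) (by simpa using hz) hw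
      simpa using this
    have hwd : infDist w Γ ≤ infDist z Γ := by
      refine (infDist_le_dist_of_mem hp).trans ?_
      rw [hd]
      obtain ⟨a, b, ha, hb, hab, rfl⟩ := hw
      rw [dist_eq_norm, dist_eq_norm]
      have : a • p + b • z - p = b • (z - p) := by
        have : a = 1 - b := by linarith
        rw [this]; module
      rw [this, norm_smul, Real.norm_of_nonneg hb]
      have : b ≤ 1 := by linarith
      exact mul_le_of_le_one_left (norm_nonneg _) this
    have hd0 : 0 ≤ infDist w Γ := infDist_nonneg
    refine ContinuousLinearMap.opNorm_le_bound _ (by have : 0 ≤ infDist z Γ := infDist_nonneg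
                                                     positivity) fun ξ => ?_
    have e : fderiv ℝ Q w ξ = ξ.re * pd 1 Q w + ξ.im * pd I Q w := fderiv_eq_pd Q w ξ
    rw [e, Real.norm_eq_abs]
    have a1 := hC1 w hwR
    have a2 := hC2 w hwR
    calc |ξ.re * pd 1 Q w + ξ.im * pd I Q w| ≤ |ξ.re| * |pd 1 Q w| + |ξ.im| * |pd I Q w| := by
          rw [← abs_mul, ← abs_mul]; exact abs_add_le _ _
      _ ≤ ‖ξ‖ * (C1 * infDist z Γ) + ‖ξ‖ * (C2 * infDist z Γ) := by
          gcongr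
          · exact abs_re_le_norm ξ
          · exact a1.trans (by gcongr)
          · exact abs_im_le_norm ξ
          · exact a2.trans (by gcongr)
      _ = _ := by ring
  have := (convex_segment p z).norm_image_sub_le_of_norm_fderiv_le (𝕜 := ℝ)
    (fun x _ => hQ.diffAt x) key (left_mem_segment ℝ p z) (right_mem_segment ℝ p z)
  rw [h0 p hp, sub_zero, ← dist_eq_norm, ← hd, Real.norm_eq_abs] at this
  rw [sq, ← mul_assoc]
  exact this

end dist

lemma ArcParam.hasDerivAt_comp {Γ : Set ℂ} {τ : ℝ → ℂ} (H : ArcParam Γ τ) {f : ℂ → ℝ}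
    (hf : ContDiff ℝ (⊤ : ℕ∞) f) (s : ℝ) : HasDerivAt (fun s => f (τ s))
      ((deriv τ s).re * pd 1 f (τ s) + (deriv τ s).im * pd I f (τ s)) s := by
  have h := (hf.diffAt (τ s)).hasFDerivAt.comp_hasDerivAt s (H.hasDerivAt s)
  exact h.congr_deriv (fderiv_eq_pd _ _ _)

/-- If `f` is constant along the curve, its tangential derivative vanishes. -/
lemma ArcParam.tangential_eq_zero {Γ : Set ℂ} {τ : ℝ → ℂ} (H : ArcParam Γ τ) {f : ℂ → ℝ}
    (hf : ContDiff ℝ (⊤ : ℕ∞) f) {k : ℝ} (h0 : ∀ s, f (τ s) = k) (s : ℝ) :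
    (deriv τ s).re * pd 1 f (τ s) + (deriv τ s).im * pd I f (τ s) = 0 := by
  refine (H.hasDerivAt_comp hf s).unique ?_
  simp only [h0]
  exact hasDerivAt_const _ _

namespace PotentialHyp
variable {Γ : Set ℂ} {W : ℂ → ℝ} {R₀ : ℝ} {τ : ℝ → ℂ}

lemma eq_zero_iff (hW : PotentialHyp Γ W R₀) {z : ℂ} : W z = 0 ↔ z ∈ Γ := by
  rw [← hW.zeros]; rfl

lemma pd_eq_zero (hW : PotentialHyp Γ W R₀) {z : ℂ} (hz : z ∈ Γ) (e : ℂ) : pd e W z = 0 := by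
  have h : IsLocalMin W z := by
    refine Eventually.of_forall fun x => ?_
    rw [hW.eq_zero_iff.2 hz]
    exact hW.nonneg x
  have := h.fderiv_eq_zero
  simp [pd, this]

lemma infDist_sq_le (hW : PotentialHyp Γ W R₀) (R : ℝ) :
    ∃ C, 0 ≤ C ∧ ∀ z, ‖z‖ ≤ R → infDist z Γ ^ 2 ≤ C * W z := by
  obtain ⟨μ, hμ, δ, hδ, hμδ⟩ := hW.nondeg
  have hcd : Continuous (fun z => infDist z Γ) := continuous_infDist_pt Γ
  set K := closedBall (0:ℂ) R ∩ {z | δ ≤ infDist z Γ} with hK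
  have hKc : IsCompact K := (isCompact_closedBall (0:ℂ) R).inter_right (isClosed_le continuous_const hcd)
  obtain ⟨m, hm0, hm⟩ : ∃ m > 0, ∀ z ∈ K, m ≤ W z := by
    refine hKc.exists_forall_le' hW.smooth.continuous.continuousOn ?_
    rintro z ⟨-, hz⟩
    refine lt_of_le_of_ne (hW.nonneg z) fun h => ?_
    have : z ∈ Γ := hW.eq_zero_iff.1 h.symm
    simp only [mem_ofPred_eq, infDist_zero_of_mem this] at hz
    linarith
  obtain ⟨D, hD⟩ := hKc.exists_bound_of_continuousOn (f := fun z => infDist z Γ ^ 2)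
    (hcd.pow 2).continuousOn
  refine ⟨max (1 / μ) (D / m), le_max_of_le_left (by positivity), fun z hz => ?_⟩
  by_cases h : infDist z Γ < δ
  · have h1 := hμδ z h
    calc infDist z Γ ^ 2 = 1 / μ * (μ * infDist z Γ ^ 2) := by field_simp
      _ ≤ 1 / μ * W z := by gcongr
      _ ≤ _ := mul_le_mul_of_nonneg_right (le_max_left _ _) (hW.nonneg z)
  · have hzK : z ∈ K := ⟨by simpa using hz, not_lt.1 h⟩
    have h1 := hD z hzK
    have h2 := hm z hzK
    rw [Real.norm_of_nonneg (by positivity)] at h1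
    have hD0 : 0 ≤ D := (sq_nonneg _).trans h1
    calc infDist z Γ ^ 2 ≤ D := h1
      _ = D / m * m := by field_simp
      _ ≤ D / m * W z := by gcongr
      _ ≤ _ := mul_le_mul_of_nonneg_right (le_max_right _ _) (hW.nonneg z)

/-- The Hessian of the potential in the normal direction is bounded below along the curve. -/
lemma exists_le_laplacian (hW : PotentialHyp Γ W R₀) (hΓ : ArcParam Γ τ) :
    ∃ c > 0, ∀ s, c ≤ pd (I * deriv τ s) (pd (I * deriv τ s) W) (τ s) := by
  obtain ⟨μ, hμ, δ, hδ, hμδ⟩ := hW.nondeg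
  obtain ⟨t₀, ht₀, ht⟩ := hΓ.abs_le_infDist
  refine ⟨2 * μ, by positivity, fun s => ?_⟩
  set N := I * deriv τ s with hN
  have hN1 : ‖N‖ = 1 := by rw [hN, norm_mul, hΓ.arclength]; simp
  have hmax : IsLocalMax (fun t : ℝ => μ * t ^ 2 - W (τ s + t • N)) 0 := by
    have : ∀ᶠ t in 𝓝 (0:ℝ), |t| < min t₀ δ := by
      have := Metric.ball_mem_nhds (0:ℝ) (ε := min t₀ δ) (by positivity)
      filter_upwards [this] with t h
      simpa using h
    filter_upwards [this] with t h
    have h1 := ht s t (h.le.trans (min_le_left _ _))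
    have h2 : infDist (τ s + t • N) Γ ≤ |t| := by
      refine (infDist_le_dist_of_mem (hΓ.mem s)).trans ?_
      simp [dist_eq_norm, hN1]
    have h3 := hμδ (τ s + t • N) (h2.trans_lt (h.trans_le (min_le_right _ _)))
    have h4 : infDist (τ s + t • N) Γ = |t| := le_antisymm h2 h1
    rw [h4, sq_abs] at h3
    simp [hW.eq_zero_iff.2 (hΓ.mem s)]
    exact h3
  have hd1 : ∀ t : ℝ, HasDerivAt (fun t : ℝ => μ * t ^ 2 - W (τ s + t • N))
      (μ * (2 * t) - pd N W (τ s + t • N)) t := by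
    intro t
    have := (((hasDerivAt_pow 2 t).const_mul μ).fun_sub (hasDerivAt_line hW.smooth (τ s) N t))
    simpa using this
  have hd2 : deriv (deriv (fun t : ℝ => μ * t ^ 2 - W (τ s + t • N))) 0 =
      μ * 2 - pd N (pd N W) (τ s) := by
    rw [funext fun t => (hd1 t).deriv]
    have := (((hasDerivAt_id (0:ℝ)).const_mul 2).const_mul μ).fun_sub
      (hasDerivAt_line (hW.smooth.pd N) (τ s) N 0)
    simpa using this.deriv
  have := hmax.deriv_deriv_nonpos (hd1 0).continuousAt
  rw [hd2] at this
  linarith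

end PotentialHyp

/-! ### Adapted frames along the target curve -/

section quadratic
variable {Γ : Set ℂ} {R : ℝ}

/-- A family of quadratic forms degenerating in the direction `T` along `Γ` is close to a multiple
of the square of the component normal to `T`. -/
lemma exists_quadratic_sub_le (hc : IsCompact Γ) (hne : Γ.Nonempty) (hR : ∀ z ∈ Γ, ‖z‖ ≤ R)
    {p q r T₁ T₂ : ℂ → ℝ} (hp : ContDiff ℝ (⊤ : ℕ∞) p)
    (hq : ContDiff ℝ (⊤ : ℕ∞) q) (hr : ContDiff ℝ (⊤ : ℕ∞) r) (hT₁ : ContDiff ℝ (⊤ : ℕ∞) T₁)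
    (hT₂ : ContDiff ℝ (⊤ : ℕ∞) T₂) (hu : ∀ z ∈ Γ, T₁ z ^ 2 + T₂ z ^ 2 = 1)
    (h1 : ∀ z ∈ Γ, 2 * p z * T₁ z + q z * T₂ z = 0)
    (h2 : ∀ z ∈ Γ, q z * T₁ z + 2 * r z * T₂ z = 0) :
    ∃ C, 0 ≤ C ∧ ∀ z, ‖z‖ ≤ R → ∀ x y : ℝ,
      |p z * x ^ 2 + q z * x * y + r z * y ^ 2 - (p z + r z) * (T₁ z * y - T₂ z * x) ^ 2| ≤
        C * infDist z Γ * (x ^ 2 + y ^ 2) := by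
  obtain ⟨C1, hC10, hC1⟩ := exists_le_infDist hc hne hR
    (Q := fun z => p z - (p z + r z) * T₂ z ^ 2) (by fun_prop) (fun z hz => by
      linear_combination (T₁ z / 2) * h1 z hz - p z * hu z hz - (T₂ z / 2) * h2 z hz)
  obtain ⟨C2, hC20, hC2⟩ := exists_le_infDist hc hne hR
    (Q := fun z => q z + 2 * (p z + r z) * T₁ z * T₂ z) (by fun_prop) (fun z hz => by
      linear_combination T₂ z * h1 z hz + T₁ z * h2 z hz - q z * hu z hz)
  obtain ⟨C3, hC30, hC3⟩ := exists_le_infDist hc hne hR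
    (Q := fun z => r z - (p z + r z) * T₁ z ^ 2) (by fun_prop) (fun z hz => by
      linear_combination (T₂ z / 2) * h2 z hz - r z * hu z hz - (T₁ z / 2) * h1 z hz)
  refine ⟨C1 + C2 + C3, by positivity, fun z hz x y => ?_⟩
  have a1 := abs_le.1 (hC1 z hz)
  have a2 := abs_le.1 (hC2 z hz)
  have a3 := abs_le.1 (hC3 z hz)
  set d := infDist z Γ with hd
  have hd0 : 0 ≤ d := infDist_nonneg
  have e : p z * x ^ 2 + q z * x * y + r z * y ^ 2 - (p z + r z) * (T₁ z * y - T₂ z * x) ^ 2 =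
    (p z - (p z + r z) * T₂ z ^ 2) * x ^ 2 + (q z + 2 * (p z + r z) * T₁ z * T₂ z) * (x * y) +
      (r z - (p z + r z) * T₁ z ^ 2) * y ^ 2 := by ring
  rw [e]
  have b1 := abs_mul (p z - (p z + r z) * T₂ z ^ 2) (x ^ 2)
  have b2 := abs_mul (q z + 2 * (p z + r z) * T₁ z * T₂ z) (x * y)
  have b3 := abs_mul (r z - (p z + r z) * T₁ z ^ 2) (y ^ 2)
  have hxy : |x * y| ≤ x ^ 2 + y ^ 2 := by
    rw [abs_le]; constructor <;> nlinarith [sq_nonneg (x + y), sq_nonneg (x - y)]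
  calc _ ≤ |(p z - (p z + r z) * T₂ z ^ 2) * x ^ 2| +
        |(q z + 2 * (p z + r z) * T₁ z * T₂ z) * (x * y)| +
        |(r z - (p z + r z) * T₁ z ^ 2) * y ^ 2| := abs_add_three _ _ _
    _ ≤ (C1 * d) * (x ^ 2 + y ^ 2) + (C2 * d) * (x ^ 2 + y ^ 2) + (C3 * d) * (x ^ 2 + y ^ 2) := by
      rw [b1, b2, b3, abs_of_nonneg (sq_nonneg x), abs_of_nonneg (sq_nonneg y)]
      gcongr
      · exact hC1 z hz
      · nlinarith
      · exact hC2 z hz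
      · exact hC3 z hz
      · nlinarith
    _ = _ := by ring

end quadratic

lemma exists_abs_le {Q : ℂ → ℝ} (hQ : ContDiff ℝ (⊤ : ℕ∞) Q) (R : ℝ) :
    ∃ C, 0 ≤ C ∧ ∀ z, ‖z‖ ≤ R → |Q z| ≤ C := by
  obtain ⟨C, hC⟩ := (isCompact_closedBall (0:ℂ) R).exists_bound_of_continuousOn hQ.continuous.continuousOn
  exact ⟨max C 0, le_max_right _ _, fun z hz => (hC z (by simpa using hz)).trans (le_max_left _ _)⟩

/-- Vector fields `A`, `B`, `T` on the plane extending the unit tangent of `Γ`, such that the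
derivative of `A` is antisymmetric and the derivative of `B` is symmetric along `Γ`, together with
the resulting estimates in terms of the distance to `Γ`. -/
structure TargetFrame (Γ : Set ℂ) (W A₁ A₂ B₁ B₂ T₁ T₂ : ℂ → ℝ) (R C c₁ : ℝ) : Prop where
  smooth_A₁ : ContDiff ℝ (⊤ : ℕ∞) A₁
  smooth_A₂ : ContDiff ℝ (⊤ : ℕ∞) A₂
  smooth_B₁ : ContDiff ℝ (⊤ : ℕ∞) B₁
  smooth_B₂ : ContDiff ℝ (⊤ : ℕ∞) B₂
  smooth_T₁ : ContDiff ℝ (⊤ : ℕ∞) T₁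
  smooth_T₂ : ContDiff ℝ (⊤ : ℕ∞) T₂
  C_nonneg : 0 ≤ C
  pos : 0 < c₁
  dist_sq_le : ∀ z, ‖z‖ ≤ R → infDist z Γ ^ 2 ≤ C * W z
  grad_sq_le : ∀ z, ‖z‖ ≤ R → pd 1 W z ^ 2 + pd I W z ^ 2 ≤ C * W z
  le_hessian : ∀ z, ‖z‖ ≤ R → ∀ x y : ℝ,
    c₁ * (T₁ z * y - T₂ z * x) ^ 2 ≤
      pd 1 (pd 1 W) z * x ^ 2 + 2 * pd 1 (pd I W) z * x * y + pd I (pd I W) z * y ^ 2 +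
        C * infDist z Γ * (x ^ 2 + y ^ 2)
  antisymm_A : ∀ z, ‖z‖ ≤ R → ∀ x y : ℝ,
    |pd 1 A₁ z * x ^ 2 + (pd I A₁ z + pd 1 A₂ z) * x * y + pd I A₂ z * y ^ 2| ≤
      C * infDist z Γ * (x ^ 2 + y ^ 2) + C * (T₁ z * y - T₂ z * x) ^ 2
  A_grad : ∀ z, ‖z‖ ≤ R → |A₁ z * pd 1 W z + A₂ z * pd I W z| ≤ C * W z
  A_sub_B₁ : ∀ z, ‖z‖ ≤ R → |A₁ z - B₁ z| ≤ C * infDist z Γ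
  A_sub_B₂ : ∀ z, ‖z‖ ≤ R → |A₂ z - B₂ z| ≤ C * infDist z Γ
  symm_B : ∀ z, ‖z‖ ≤ R → |pd 1 B₂ z - pd I B₁ z| ≤ C * infDist z Γ
  sq_le : ∀ z, ‖z‖ ≤ R → ∀ x y : ℝ, x ^ 2 + y ^ 2 ≤ (B₁ z * x + B₂ z * y) ^ 2 +
    (T₁ z * y - T₂ z * x) ^ 2 + C * infDist z Γ * (x ^ 2 + y ^ 2)
  A_le : ∀ z, ‖z‖ ≤ R → |A₁ z| ≤ C ∧ |A₂ z| ≤ C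
  B_le : ∀ z, ‖z‖ ≤ R → |B₁ z| ≤ C ∧ |B₂ z| ≤ C
  dist_le : ∀ z, ‖z‖ ≤ R → infDist z Γ ≤ C

section frame
variable {Γ : Set ℂ} {W : ℂ → ℝ} {R₀ : ℝ} {τ : ℝ → ℂ}

lemma pd_add_mul_mul {T f h : ℂ → ℝ} (hT : ContDiff ℝ (⊤ : ℕ∞) T) (hf : ContDiff ℝ (⊤ : ℕ∞) f)
    (hh : ContDiff ℝ (⊤ : ℕ∞) h) {z : ℂ} (hz : f z = 0) (e : ℂ) :
    pd e (fun z => T z + f z * (h z * T z)) z = pd e T z + h z * T z * pd e f z := by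
  rw [pd_add hT (by fun_prop), pd_mul hf (by fun_prop), hz]
  ring

lemma ArcParam.exists_extension_div (H : ArcParam Γ τ) {Q l : ℂ → ℝ}
    (hQ : ContDiff ℝ (⊤ : ℕ∞) Q) (hl : ContDiff ℝ (⊤ : ℕ∞) l) (h0 : ∀ s, l (τ s) ≠ 0) :
    ∃ h : ℂ → ℝ, ContDiff ℝ (⊤ : ℕ∞) h ∧ ∀ z ∈ Γ, h z * l z = Q z := by
  obtain ⟨h, hh, hs⟩ := H.exists_extension (G := fun s => Q (τ s) / l (τ s))
    ((hQ.comp H.smooth).div (hl.comp H.smooth) h0) (fun s => by simp only [H.periodic s])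
  refine ⟨h, hh, fun z hz => ?_⟩
  rw [← H.srange] at hz
  obtain ⟨s, rfl⟩ := hz
  rw [hs, div_mul_cancel₀ _ (h0 s)]

set_option maxHeartbeats 1600000 in
theorem PotentialHyp.exists_targetFrame (hW : PotentialHyp Γ W R₀) (hΓ : ArcParam Γ τ) {R : ℝ}
    (hR : ∀ z ∈ Γ, ‖z‖ ≤ R) :
    ∃ A₁ A₂ B₁ B₂ T₁ T₂ C c₁, TargetFrame Γ W A₁ A₂ B₁ B₂ T₁ T₂ R C c₁ := by
  have hc := hΓ.isCompact
  have hne := hΓ.nonempty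
  have sW := hW.smooth
  have sW1 := sW.pd 1
  have sW2 := sW.pd I
  have sW11 := sW1.pd 1
  have sW12 := sW2.pd 1
  have sW22 := sW2.pd I
  obtain ⟨T, hT, hTτ⟩ := hΓ.exists_extension hΓ.contDiff_deriv hΓ.periodic.deriv'
  obtain ⟨T₁, hT₁, eT₁⟩ : ∃ T₁ : ℂ → ℝ, ContDiff ℝ (⊤ : ℕ∞) T₁ ∧ ∀ s, T₁ (τ s) = (deriv τ s).re :=
    ⟨_, hT.re', fun s => by rw [hTτ]⟩
  obtain ⟨T₂, hT₂, eT₂⟩ : ∃ T₂ : ℂ → ℝ, ContDiff ℝ (⊤ : ℕ∞) T₂ ∧ ∀ s, T₂ (τ s) = (deriv τ s).im :=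
    ⟨_, hT.im', fun s => by rw [hTτ]⟩
  have d11 := hT₁.pd 1
  have d12 := hT₁.pd I
  have d21 := hT₂.pd 1
  have d22 := hT₂.pd I
  -- facts along the curve
  have unit : ∀ z ∈ Γ, T₁ z ^ 2 + T₂ z ^ 2 = 1 := by
    rw [← hΓ.srange]
    rintro _ ⟨s, rfl⟩
    rw [eT₁, eT₂, ← norm_sq_eq, hΓ.arclength]; norm_num
  have tang : ∀ {f : ℂ → ℝ} {k : ℝ}, ContDiff ℝ (⊤ : ℕ∞) f → (∀ z ∈ Γ, f z = k) →
      ∀ z ∈ Γ, T₁ z * pd 1 f z + T₂ z * pd I f z = 0 := by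
    intro f k hf h0
    rw [← hΓ.srange]
    rintro _ ⟨s, rfl⟩
    rw [eT₁, eT₂]
    exact hΓ.tangential_eq_zero hf (fun s => h0 _ (hΓ.mem s)) s
  have w1 : ∀ z ∈ Γ, pd 1 W z = 0 := fun z hz => hW.pd_eq_zero hz 1
  have w2 : ∀ z ∈ Γ, pd I W z = 0 := fun z hz => hW.pd_eq_zero hz I
  have symW : ∀ z, pd I (pd 1 W) z = pd 1 (pd I W) z := fun z => pd_comm sW I 1 z
  have t1 : ∀ z ∈ Γ, T₁ z * pd 1 (pd 1 W) z + T₂ z * pd 1 (pd I W) z = 0 := by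
    intro z hz; have := tang sW1 w1 z hz; rwa [symW] at this
  have t2 : ∀ z ∈ Γ, T₁ z * pd 1 (pd I W) z + T₂ z * pd I (pd I W) z = 0 := tang sW2 w2
  have t3 : ∀ z ∈ Γ, T₁ z * (T₁ z * pd 1 T₁ z + T₂ z * pd 1 T₂ z) +
      T₂ z * (T₁ z * pd I T₁ z + T₂ z * pd I T₂ z) = 0 := by
    intro z hz
    have := tang (f := fun z => T₁ z * T₁ z + T₂ z * T₂ z) (k := 1) (by fun_prop)
      (fun z hz => by have := unit z hz; linarith) z hz
    simp only [pd_add (hT₁.mul hT₁) (hT₂.mul hT₂), pd_mul hT₁ hT₁, pd_mul hT₂ hT₂] at this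
    linarith
  set l : ℂ → ℝ := fun z => pd 1 (pd 1 W) z + pd I (pd I W) z with hl
  have sl : ContDiff ℝ (⊤ : ℕ∞) l := sW11.add sW22
  obtain ⟨c, hc0, hcl'⟩ := hW.exists_le_laplacian hΓ
  have hcl : ∀ z ∈ Γ, c ≤ l z := by
    intro z hz
    have h1 := t1 z hz
    have h2 := t2 z hz
    have h3 := unit z hz
    rw [← hΓ.srange] at hz
    obtain ⟨s, rfl⟩ := hz
    have := hcl' s
    rw [pd_pd_eq sW] at this
    rw [eT₁, eT₂] at h1 h2 h3
    have e1 : (I * deriv τ s).re = -(deriv τ s).im := by simp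
    have e2 : (I * deriv τ s).im = (deriv τ s).re := by simp
    rw [e1, e2] at this
    simp only [hl]
    refine this.trans (le_of_eq ?_)
    linear_combination -(deriv τ s).re * h1 - (deriv τ s).im * h2 +
      (pd 1 (pd 1 W) (τ s) + pd I (pd I W) (τ s)) * h3
  have hl0 : ∀ s, l (τ s) ≠ 0 := fun s => (hc0.trans_le (hcl _ (hΓ.mem s))).ne'
  set f : ℂ → ℝ := fun z => T₁ z * pd I W z - T₂ z * pd 1 W z with hf
  have sf : ContDiff ℝ (⊤ : ℕ∞) f := (hT₁.mul sW2).sub (hT₂.mul sW1)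
  have f0 : ∀ z ∈ Γ, f z = 0 := fun z hz => by simp [hf, w1 z hz, w2 z hz]
  have f1 : ∀ z ∈ Γ, pd 1 f z = -(l z * T₂ z) := by
    intro z hz
    simp only [hf, pd_sub (hT₁.mul sW2) (hT₂.mul sW1), pd_mul hT₁ sW2, pd_mul hT₂ sW1, w1 z hz,
      w2 z hz, hl]
    linear_combination t2 z hz
  have f2 : ∀ z ∈ Γ, pd I f z = l z * T₁ z := by
    intro z hz
    simp only [hf, pd_sub (hT₁.mul sW2) (hT₂.mul sW1), pd_mul hT₁ sW2, pd_mul hT₂ sW1, w1 z hz,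
      w2 z hz, hl, symW]
    linear_combination -t1 z hz
  clear_value f l
  obtain ⟨h, sh, hh⟩ := hΓ.exists_extension_div (l := l)
    (Q := fun z => 2 * pd 1 T₁ z * T₁ z * T₂ z - (pd I T₁ z + pd 1 T₂ z) * (T₁ z ^ 2 - T₂ z ^ 2) -
      2 * pd I T₂ z * T₁ z * T₂ z) (by fun_prop) sl hl0
  obtain ⟨k, sk, hk⟩ := hΓ.exists_extension_div (l := l)
    (Q := fun z => pd 1 T₂ z - pd I T₁ z) (by fun_prop) sl hl0
  obtain ⟨A₁, hA₁, eA₁⟩ : ∃ A₁ : ℂ → ℝ, ContDiff ℝ (⊤ : ℕ∞) A₁ ∧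
    A₁ = fun z => T₁ z + f z * (h z * T₁ z) := ⟨_, by fun_prop, rfl⟩
  obtain ⟨A₂, hA₂, eA₂⟩ : ∃ A₂ : ℂ → ℝ, ContDiff ℝ (⊤ : ℕ∞) A₂ ∧
    A₂ = fun z => T₂ z + f z * (h z * T₂ z) := ⟨_, by fun_prop, rfl⟩
  obtain ⟨B₁, hB₁, eB₁⟩ : ∃ B₁ : ℂ → ℝ, ContDiff ℝ (⊤ : ℕ∞) B₁ ∧
    B₁ = fun z => T₁ z + f z * (k z * T₁ z) := ⟨_, by fun_prop, rfl⟩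
  obtain ⟨B₂, hB₂, eB₂⟩ : ∃ B₂ : ℂ → ℝ, ContDiff ℝ (⊤ : ℕ∞) B₂ ∧
    B₂ = fun z => T₂ z + f z * (k z * T₂ z) := ⟨_, by fun_prop, rfl⟩
  have dA₁ : ∀ z ∈ Γ, ∀ e, pd e A₁ z = pd e T₁ z + h z * T₁ z * pd e f z := fun z hz e => by
    rw [eA₁]; exact pd_add_mul_mul hT₁ sf sh (f0 z hz) e
  have dA₂ : ∀ z ∈ Γ, ∀ e, pd e A₂ z = pd e T₂ z + h z * T₂ z * pd e f z := fun z hz e => by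
    rw [eA₂]; exact pd_add_mul_mul hT₂ sf sh (f0 z hz) e
  have dB₁ : ∀ z ∈ Γ, ∀ e, pd e B₁ z = pd e T₁ z + k z * T₁ z * pd e f z := fun z hz e => by
    rw [eB₁]; exact pd_add_mul_mul hT₁ sf sk (f0 z hz) e
  have dB₂ : ∀ z ∈ Γ, ∀ e, pd e B₂ z = pd e T₂ z + k z * T₂ z * pd e f z := fun z hz e => by
    rw [eB₂]; exact pd_add_mul_mul hT₂ sf sk (f0 z hz) e
  have vA₁ : ∀ z ∈ Γ, A₁ z = T₁ z := fun z hz => by rw [eA₁]; simp [f0 z hz]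
  have vA₂ : ∀ z ∈ Γ, A₂ z = T₂ z := fun z hz => by rw [eA₂]; simp [f0 z hz]
  have vB₁ : ∀ z ∈ Γ, B₁ z = T₁ z := fun z hz => by rw [eB₁]; simp [f0 z hz]
  have vB₂ : ∀ z ∈ Γ, B₂ z = T₂ z := fun z hz => by rw [eB₂]; simp [f0 z hz]
  clear eA₁ eA₂ eB₁ eB₂
  have qA : ∀ z ∈ Γ, pd 1 A₁ z * T₁ z ^ 2 + (pd I A₁ z + pd 1 A₂ z) * T₁ z * T₂ z +
      pd I A₂ z * T₂ z ^ 2 = 0 := by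
    intro z hz
    rw [dA₁ z hz, dA₁ z hz, dA₂ z hz, dA₂ z hz, f1 z hz, f2 z hz]
    linear_combination t3 z hz
  have qA' : ∀ z ∈ Γ, -2 * pd 1 A₁ z * T₁ z * T₂ z + (pd I A₁ z + pd 1 A₂ z) *
      (T₁ z ^ 2 - T₂ z ^ 2) + 2 * pd I A₂ z * T₁ z * T₂ z = 0 := by
    intro z hz
    rw [dA₁ z hz, dA₁ z hz, dA₂ z hz, dA₂ z hz, f1 z hz, f2 z hz]
    linear_combination hh z hz + h z * l z * (T₁ z ^ 2 + T₂ z ^ 2 + 1) * unit z hz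
  -- constants
  obtain ⟨C1, hC10, hC1⟩ := hW.infDist_sq_le R
  obtain ⟨C2, hC20, hC2⟩ := exists_le_infDist hc hne hR sW1 w1
  obtain ⟨C3, hC30, hC3⟩ := exists_le_infDist hc hne hR sW2 w2
  obtain ⟨C4, hC40, hC4⟩ := exists_quadratic_sub_le hc hne hR (p := pd 1 (pd 1 W))
    (q := fun z => 2 * pd 1 (pd I W) z) (r := pd I (pd I W)) sW11 (by fun_prop) sW22 hT₁ hT₂ unit
    (fun z hz => by linear_combination 2 * t1 z hz) (fun z hz => by linear_combination 2 * t2 z hz)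
  obtain ⟨C5, hC50, hC5⟩ := exists_sub_le_infDist hc hne hR sl
  obtain ⟨C6, hC60, hC6⟩ := exists_quadratic_sub_le hc hne hR (p := pd 1 A₁)
    (q := fun z => pd I A₁ z + pd 1 A₂ z) (r := pd I A₂) (hA₁.pd 1)
    ((hA₁.pd I).add (hA₂.pd 1)) (hA₂.pd I) hT₁ hT₂ unit
    (fun z hz => by
      linear_combination 2 * T₁ z * qA z hz - T₂ z * qA' z hz -
        (2 * pd 1 A₁ z * T₁ z + (pd I A₁ z + pd 1 A₂ z) * T₂ z) * unit z hz)
    (fun z hz => by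
      linear_combination 2 * T₂ z * qA z hz + T₁ z * qA' z hz -
        (2 * pd I A₂ z * T₂ z + (pd I A₁ z + pd 1 A₂ z) * T₁ z) * unit z hz)
  obtain ⟨C7, hC70, hC7⟩ := exists_abs_le (Q := fun z => pd 1 A₁ z + pd I A₂ z)
    ((hA₁.pd 1).add (hA₂.pd I)) R
  obtain ⟨C8, hC80, hC8⟩ := exists_le_infDist_sq hc hne hR
    (Q := fun z => A₁ z * pd 1 W z + A₂ z * pd I W z) ((hA₁.mul sW1).add (hA₂.mul sW2))
    (fun z hz => by simp [w1 z hz, w2 z hz])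
    (fun z hz => by
      simp only [pd_add (hA₁.mul sW1) (hA₂.mul sW2), pd_mul hA₁ sW1, pd_mul hA₂ sW2, w1 z hz,
        w2 z hz, vA₁ z hz, vA₂ z hz]
      linear_combination t1 z hz)
    (fun z hz => by
      simp only [pd_add (hA₁.mul sW1) (hA₂.mul sW2), pd_mul hA₁ sW1, pd_mul hA₂ sW2, w1 z hz,
        w2 z hz, vA₁ z hz, vA₂ z hz, symW]
      linear_combination t2 z hz)
  obtain ⟨C9, hC90, hC9⟩ := exists_le_infDist hc hne hR (Q := fun z => A₁ z - B₁ z)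
    (hA₁.sub hB₁) (fun z hz => by simp [vA₁ z hz, vB₁ z hz])
  obtain ⟨C10, hC100, hC10'⟩ := exists_le_infDist hc hne hR (Q := fun z => A₂ z - B₂ z)
    (hA₂.sub hB₂) (fun z hz => by simp [vA₂ z hz, vB₂ z hz])
  obtain ⟨C11, hC110, hC11⟩ := exists_le_infDist hc hne hR (Q := fun z => pd 1 B₂ z - pd I B₁ z)
    ((hB₂.pd 1).sub (hB₁.pd I)) (fun z hz => by
      simp only [dB₁ z hz, dB₂ z hz, f1 z hz, f2 z hz]
      linear_combination -hk z hz - k z * l z * unit z hz)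
  obtain ⟨C12, hC120, hC12⟩ := exists_le_infDist hc hne hR
    (Q := fun z => 1 - B₁ z ^ 2 - T₂ z ^ 2) (by fun_prop)
    (fun z hz => by rw [vB₁ z hz]; linarith [unit z hz])
  obtain ⟨C13, hC130, hC13⟩ := exists_le_infDist hc hne hR
    (Q := fun z => T₁ z * T₂ z - B₁ z * B₂ z) (by fun_prop)
    (fun z hz => by rw [vB₁ z hz, vB₂ z hz]; ring)
  obtain ⟨C14, hC140, hC14⟩ := exists_le_infDist hc hne hR
    (Q := fun z => 1 - B₂ z ^ 2 - T₁ z ^ 2) (by fun_prop)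
    (fun z hz => by rw [vB₂ z hz]; linarith [unit z hz])
  obtain ⟨C15, hC150, hC15⟩ := exists_abs_le (Q := fun z => T₁ z ^ 2 + T₂ z ^ 2) (by fun_prop) R
  obtain ⟨C16, hC160, hC16⟩ := exists_abs_le hA₁ R
  obtain ⟨C17, hC170, hC17⟩ := exists_abs_le hA₂ R
  obtain ⟨C18, hC180, hC18⟩ := exists_abs_le hB₁ R
  obtain ⟨C19, hC190, hC19⟩ := exists_abs_le hB₂ R
  obtain ⟨C, hC0, k1, k2, k3, k4, k5, k6, k7, k8, k9, k10, k11, k12, k13, k14, k15⟩ :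
      ∃ C : ℝ, 0 ≤ C ∧ C1 ≤ C ∧ (C2 ^ 2 + C3 ^ 2) * C1 ≤ C ∧ C4 + C5 * C15 ≤ C ∧ C6 ≤ C ∧
        C7 ≤ C ∧ C8 * C1 ≤ C ∧ C9 ≤ C ∧ C10 ≤ C ∧ C11 ≤ C ∧ C12 + 2 * C13 + C14 ≤ C ∧
        C16 ≤ C ∧ C17 ≤ C ∧ C18 ≤ C ∧ C19 ≤ C ∧ 2 * R ≤ C := by
    refine ⟨C1 + (C2 ^ 2 + C3 ^ 2) * C1 + (C4 + C5 * C15) + C6 + C7 + C8 * C1 + C9 + C10 + C11 +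
      (C12 + 2 * C13 + C14) + C16 + C17 + C18 + C19 + |2 * R|, by positivity, ?_⟩
    have p1 : 0 ≤ (C2 ^ 2 + C3 ^ 2) * C1 := by positivity
    have p2 : 0 ≤ C5 * C15 := by positivity
    have p3 : 0 ≤ C8 * C1 := by positivity
    have p4 := abs_nonneg (2 * R)
    have p5 := le_abs_self (2 * R)
    refine ⟨?_, ?_, ?_, ?_, ?_, ?_, ?_, ?_, ?_, ?_, ?_, ?_, ?_, ?_, ?_⟩ <;> linarith
  have hd0 : ∀ z, 0 ≤ infDist z Γ := fun z => infDist_nonneg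
  refine ⟨A₁, A₂, B₁, B₂, T₁, T₂, C, c,
    { smooth_A₁ := hA₁, smooth_A₂ := hA₂, smooth_B₁ := hB₁, smooth_B₂ := hB₂
      smooth_T₁ := hT₁, smooth_T₂ := hT₂, C_nonneg := hC0, pos := hc0
      dist_sq_le := fun z hz => (hC1 z hz).trans (mul_le_mul_of_nonneg_right k1 (hW.nonneg z))
      grad_sq_le := fun z hz => ?_
      le_hessian := fun z hz x y => ?_
      antisymm_A := fun z hz x y => ?_
      A_grad := fun z hz => ?_
      A_sub_B₁ := fun z hz => (hC9 z hz).trans (mul_le_mul_of_nonneg_right k7 (hd0 z))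
      A_sub_B₂ := fun z hz => (hC10' z hz).trans (mul_le_mul_of_nonneg_right k8 (hd0 z))
      symm_B := fun z hz => (hC11 z hz).trans (mul_le_mul_of_nonneg_right k9 (hd0 z))
      sq_le := fun z hz x y => ?_
      A_le := fun z hz => ⟨(hC16 z hz).trans k11, (hC17 z hz).trans k12⟩
      B_le := fun z hz => ⟨(hC18 z hz).trans k13, (hC19 z hz).trans k14⟩
      dist_le := fun z hz => ?_ }⟩
  · calc pd 1 W z ^ 2 + pd I W z ^ 2 ≤ (C2 * infDist z Γ) ^ 2 + (C3 * infDist z Γ) ^ 2 :=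
          add_le_add (sq_le_sq.2 ((hC2 z hz).trans (le_abs_self _)))
            (sq_le_sq.2 ((hC3 z hz).trans (le_abs_self _)))
      _ = (C2 ^ 2 + C3 ^ 2) * infDist z Γ ^ 2 := by ring
      _ ≤ (C2 ^ 2 + C3 ^ 2) * (C1 * W z) := by gcongr; exact hC1 z hz
      _ = (C2 ^ 2 + C3 ^ 2) * C1 * W z := by ring
      _ ≤ _ := mul_le_mul_of_nonneg_right k2 (hW.nonneg z)
  · have a1 := (abs_le.1 (hC4 z hz x y)).1
    obtain ⟨p, hp, a2⟩ := hC5 z hz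
    have a3 := (abs_le.1 a2).1
    have a4 := hcl p hp
    have a5 : c ≤ l z + C5 * infDist z Γ := by linarith
    have a6 : (T₁ z * y - T₂ z * x) ^ 2 ≤ C15 * (x ^ 2 + y ^ 2) := by
      have := (le_abs_self _).trans (hC15 z hz)
      nlinarith [sq_nonneg (T₁ z * x + T₂ z * y), sq_nonneg x, sq_nonneg y]
    have a7 := mul_le_mul_of_nonneg_right a5 (sq_nonneg (T₁ z * y - T₂ z * x))
    have a8 := mul_le_mul_of_nonneg_left a6 (mul_nonneg hC50 (hd0 z))
    have a9 := mul_le_mul_of_nonneg_right k3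
      (mul_nonneg (hd0 z) (add_nonneg (sq_nonneg x) (sq_nonneg y)))
    have e : l z = pd 1 (pd 1 W) z + pd I (pd I W) z := congrFun hl z
    rw [e] at a7
    linarith
  · refine (abs_sub_abs_le_abs_sub _ _).trans (hC6 z hz x y) |> sub_le_iff_le_add.1 |>.trans ?_
    rw [abs_mul, abs_of_nonneg (sq_nonneg (T₁ z * y - T₂ z * x))]
    have := hC7 z hz
    have h0 := hd0 z
    gcongr
    exact this.trans k5
  · refine (hC8 z hz).trans ?_
    calc C8 * infDist z Γ ^ 2 ≤ C8 * (C1 * W z) := by gcongr; exact hC1 z hz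
      _ = C8 * C1 * W z := by ring
      _ ≤ _ := mul_le_mul_of_nonneg_right k6 (hW.nonneg z)
  · have a1 := (abs_le.1 (hC12 z hz)).2
    have a2 := hC13 z hz
    have a3 := (abs_le.1 (hC14 z hz)).2
    have b1 := mul_le_mul_of_nonneg_right a1 (sq_nonneg x)
    have b3 := mul_le_mul_of_nonneg_right a3 (sq_nonneg y)
    have b2 : (T₁ z * T₂ z - B₁ z * B₂ z) * (x * y) ≤ C13 * infDist z Γ * (x ^ 2 + y ^ 2) := by
      refine (le_abs_self _).trans ?_
      rw [abs_mul]
      have hxy : |x * y| ≤ x ^ 2 + y ^ 2 := by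
        rw [abs_le]; constructor <;> nlinarith [sq_nonneg (x + y), sq_nonneg (x - y)]
      have := hd0 z
      gcongr
    have b4 := mul_le_mul_of_nonneg_right k10
      (mul_nonneg (hd0 z) (add_nonneg (sq_nonneg x) (sq_nonneg y)))
    have b5 := mul_nonneg (mul_nonneg hC120 (hd0 z)) (sq_nonneg y)
    have b6 := mul_nonneg (mul_nonneg hC140 (hd0 z)) (sq_nonneg x)
    linarith
  · obtain ⟨p, hp⟩ := hne
    refine (infDist_le_dist_of_mem hp).trans ?_
    rw [dist_eq_norm]
    have := norm_sub_le z p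
    have := hR p hp
    linarith
end frame

/-! ### The maximum principle -/

lemma pd_pd_sq {a : ℂ → ℝ} (ha : ContDiff ℝ (⊤ : ℕ∞) a) (e x : ℂ) :
    pd e (pd e (fun x => a x * a x)) x = 2 * (pd e a x ^ 2 + a x * pd e (pd e a) x) := by
  have h : pd e (fun x => a x * a x) = fun x => a x * pd e a x + a x * pd e a x :=
    funext fun x => pd_mul ha ha e x
  have hae := ha.pd e
  rw [h, pd_add (ha.mul hae) (ha.mul hae), pd_mul ha hae]
  ring

theorem SolvesGL.norm_le {Γ Ω : Set ℂ} {W : ℂ → ℝ} {R₀ ε : ℝ} {u : ℂ → ℂ}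
    (h : SolvesGL W Ω ε u) (hW : PotentialHyp Γ W R₀) (ho : IsOpen Ω) (hb : IsBounded Ω)
    (hu : ∀ x ∈ frontier Ω, u x ∈ Γ) {x : ℂ} (hx : x ∈ closure Ω) : ‖u x‖ ≤ R₀ := by
  by_contra! hlt
  have hR0 : 0 ≤ R₀ := by
    by_contra! hneg
    have hne : frontier Ω = ∅ := by
      refine eq_empty_of_forall_notMem fun y hy => ?_
      linarith [hW.R0_large _ (hu y hy), norm_nonneg (u y)]
    have hcl : IsClopen Ω := isClopen_iff_frontier_eq_empty.2 hne
    rcases isClopen_iff.1 hcl with h | h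
    · simp [h] at hx
    · rw [h] at hb
      exact NoncompactSpace.noncompact_univ (isCompact_of_isClosed_isBounded isClosed_univ hb)
  have hre := h.1.re'
  have him := h.1.im'
  have hK := hb.isCompact_closure
  obtain ⟨M, hM⟩ := hK.exists_bound_of_continuousOn (f := fun x : ℂ => x.re * x.re + x.im * x.im)
    (by fun_prop)
  have hM0 : 0 ≤ M := (norm_nonneg _).trans (hM x hx)
  set hh : ℂ → ℝ := fun x => (u x).re * (u x).re + (u x).im * (u x).im with hhdef
  have hhn : ∀ y, hh y = ‖u y‖ ^ 2 := fun y => by rw [norm_sq_eq, hhdef]; ring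
  obtain ⟨η, hη, hηM⟩ : ∃ η > 0, η * M < hh x - R₀ ^ 2 := by
    have : 0 < hh x - R₀ ^ 2 := by rw [hhn]; nlinarith
    refine ⟨(hh x - R₀ ^ 2) / (2 * (M + 1)), by positivity, ?_⟩
    rw [div_mul_eq_mul_div, div_lt_iff₀ (by positivity)]
    nlinarith
  set q : ℂ → ℝ := fun x => η * (x.re * x.re + x.im * x.im) with hq
  have shh : ContDiff ℝ (⊤ : ℕ∞) hh := (hre.mul hre).add (him.mul him)
  have sq : ContDiff ℝ (⊤ : ℕ∞) q :=
    contDiff_const.mul ((contDiff_re.mul contDiff_re).add (contDiff_im.mul contDiff_im))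
  obtain ⟨x0, hx0, hmax⟩ := hK.exists_isMaxOn ⟨x, hx⟩ (f := fun x => hh x + q x)
    (shh.add sq).continuous.continuousOn
  have hx0' : R₀ ^ 2 < hh x0 := by
    have h1 : hh x + q x ≤ hh x0 + q x0 := hmax hx
    have h2 : 0 ≤ q x := by
      simp only [hq]; exact mul_nonneg hη.le (add_nonneg (mul_self_nonneg _) (mul_self_nonneg _))
    have h3 : q x0 ≤ η * M := mul_le_mul_of_nonneg_left ((le_abs_self _).trans (hM x0 hx0)) hη.le
    linarith
  have hx0n : R₀ < ‖u x0‖ := by rw [hhn] at hx0'; exact lt_of_pow_lt_pow_left₀ 2 (norm_nonneg _) hx0'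
  have hin : x0 ∈ Ω := by
    by_contra hnot
    have : x0 ∈ frontier Ω := ⟨hx0, by rwa [ho.interior_eq]⟩
    linarith [hW.R0_large _ (hu x0 this)]
  have hloc : IsLocalMax (fun x => hh x + q x) x0 :=
    (hmax.on_subset subset_closure).isLocalMax (ho.mem_nhds hin)
  have c1 := pd_pd_nonpos_of_isLocalMax (shh.add sq) hloc 1
  have c2 := pd_pd_nonpos_of_isLocalMax (shh.add sq) hloc I
  have hadd : ∀ e, pd e (pd e (fun x => hh x + q x)) x0 = pd e (pd e hh) x0 + pd e (pd e q) x0 := by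
    intro e
    rw [funext fun x => pd_add shh sq e x, pd_add (shh.pd e) (sq.pd e)]
  have hhadd : ∀ e, pd e (pd e hh) x0 = 2 * (pd e (fun x => (u x).re) x0 ^ 2 +
      (u x0).re * pd e (pd e (fun x => (u x).re)) x0) + 2 * (pd e (fun x => (u x).im) x0 ^ 2 +
      (u x0).im * pd e (pd e (fun x => (u x).im)) x0) := by
    intro e
    have s1 := hre.mul hre
    have s2 := him.mul him
    rw [hhdef, funext fun x => pd_add s1 s2 e x, pd_add (s1.pd e) (s2.pd e), pd_pd_sq hre,
      pd_pd_sq him]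
  have hqe : ∀ e, pd e (pd e q) x0 = 2 * η * (e.re ^ 2 + e.im ^ 2) := by
    intro e
    have s1 : ContDiff ℝ (⊤ : ℕ∞) (fun x : ℂ => x.re * x.re) := contDiff_re.mul contDiff_re
    have s2 : ContDiff ℝ (⊤ : ℕ∞) (fun x : ℂ => x.im * x.im) := contDiff_im.mul contDiff_im
    have e1 : pd e q = fun x => η * (2 * (x.re * e.re + x.im * e.im)) := by
      funext x
      rw [hq, pd_mul contDiff_const (s1.add s2), pd_const, pd_add s1 s2, pd_mul contDiff_re contDiff_re,
        pd_mul contDiff_im contDiff_im, pd_re_id, pd_im_id]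
      ring
    have s3 : ContDiff ℝ (⊤ : ℕ∞) (fun x : ℂ => x.re * e.re) := contDiff_re.mul contDiff_const
    have s4 : ContDiff ℝ (⊤ : ℕ∞) (fun x : ℂ => x.im * e.im) := contDiff_im.mul contDiff_const
    rw [e1, pd_mul contDiff_const (contDiff_const.mul (s3.add s4)), pd_const,
      pd_mul contDiff_const (s3.add s4), pd_const, pd_add s3 s4, pd_mul contDiff_re contDiff_const,
      pd_mul contDiff_im contDiff_const, pd_const, pd_const, pd_re_id, pd_im_id]
    ring
  rw [hadd, hhadd, hqe] at c1 c2
  have l1 := h.lap_re hin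
  have l2 := h.lap_im hin
  have hco := hW.coercive _ hx0n
  have e3 : (gradW W (u x0)).re = pd 1 W (u x0) := by simp [gradW, pd]
  have e4 : (gradW W (u x0)).im = pd I W (u x0) := by simp [gradW, pd]
  rw [e3, e4] at hco
  have hco' : 0 ≤ (ε ^ 2)⁻¹ * (pd 1 W (u x0) * (u x0).re + pd I W (u x0) * (u x0).im) :=
    mul_nonneg (by positivity) hco
  have l1' := congrArg (fun t => (u x0).re * t) l1
  have l2' := congrArg (fun t => (u x0).im * t) l2
  simp only [one_re, one_im, I_re, I_im] at c1 c2
  nlinarith [sq_nonneg (pd 1 (fun x => (u x).re) x0), sq_nonneg (pd I (fun x => (u x).re) x0),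
    sq_nonneg (pd 1 (fun x => (u x).im) x0), sq_nonneg (pd I (fun x => (u x).im) x0)]

/-! ### Estimates for solutions, uniform in the parameter -/

namespace StarDomain
variable {Ω : Set ℂ} {γ n : ℝ → ℂ} {L c σ : ℝ}

/-- The `L⁴` norm of the gradient of a bounded function with prescribed boundary values is
controlled by its Laplacian and its gradient on the boundary. -/
lemma grad_fourth_bound_of_boundary (H : StarDomain Ω γ n L c σ) {h : ℂ → ℝ}
    (hh : ContDiff ℝ (⊤ : ℕ∞) h) (M : ℝ) :
    ∃ C, 0 ≤ C ∧ ∀ (U : ℂ → ℝ) (S : ℝ), ContDiff ℝ (⊤ : ℕ∞) U → (∀ s, U (γ s) = h (γ s)) →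
      (∀ x ∈ Ω, |U x| ≤ M) → ∫ x in Ω, (pd 1 (pd 1 U) x + pd I (pd I U) x) ^ 2 ≤ S →
      ∫ s in (0 : ℝ)..L, (pd 1 U (γ s) ^ 2 + pd I U (γ s) ^ 2) ≤ S →
      ∫ x in Ω, (pd 1 U x ^ 2 + pd I U x ^ 2) ^ 2 ≤ C * (1 + S) := by
  obtain ⟨K, hK, hHess⟩ := H.hessian_bound
  obtain ⟨N, hN⟩ := H.isCompact.exists_bound_of_continuousOn hh.continuous.continuousOn
  have h1 := hh.pd 1
  have h2 := hh.pd I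
  have h11 := h1.pd 1
  have h22 := h2.pd I
  have c1 := h1.continuous
  have c2 := h2.continuous
  have c11 := h11.continuous
  have c22 := h22.continuous
  have cγ := H.continuous
  set k₁ := ∫ x in Ω, (pd 1 (pd 1 h) x + pd I (pd I h) x) ^ 2 with hk₁
  set k₂ := ∫ s in (0 : ℝ)..L, (pd 1 h (γ s) ^ 2 + pd I h (γ s) ^ 2) with hk₂
  set k₃ := ∫ x in Ω, (pd 1 h x ^ 2 + pd I h x ^ 2) ^ 2 with hk₃
  have k₁0 : 0 ≤ k₁ := integral_nonneg fun x => by positivity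
  have k₂0 : 0 ≤ k₂ := intervalIntegral.integral_nonneg H.Lpos.le fun x _ => by positivity
  have k₃0 : 0 ≤ k₃ := integral_nonneg fun x => by positivity
  refine ⟨8 * (27 * (M + N) ^ 2 * (2 + 2 * k₁ + K * (2 + 2 * k₂))) + 8 * k₃, by positivity,
    fun U S hU hb hM hS hS' => ?_⟩
  have g1 := hU.pd 1
  have g2 := hU.pd I
  have g11 := g1.pd 1
  have g22 := g2.pd I
  have d1 := g1.continuous
  have d2 := g2.continuous
  have d11 := g11.continuous
  have d22 := g22.continuous
  have S0 : 0 ≤ S := (integral_nonneg fun x => by positivity).trans hS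
  set a : ℂ → ℝ := fun x => U x - h x with ha'
  have ha : ContDiff ℝ (⊤ : ℕ∞) a := hU.sub hh
  have ea : ∀ e, pd e a = fun x => pd e U x - pd e h x := fun e => funext fun x => pd_sub hU hh e x
  have ea2 : ∀ e x, pd e (pd e a) x = pd e (pd e U) x - pd e (pd e h) x := fun e x => by
    rw [ea, pd_sub (hU.pd e) (hh.pd e)]
  have hlap : ∫ x in Ω, (pd 1 (pd 1 a) x + pd I (pd I a) x) ^ 2 ≤ 2 * S + 2 * k₁ := by
    calc _ ≤ ∫ x in Ω, (2 * (pd 1 (pd 1 U) x + pd I (pd I U) x) ^ 2 +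
          2 * (pd 1 (pd 1 h) x + pd I (pd I h) x) ^ 2) := by
          simp only [ea2]
          refine H.setIntegral_mono (by fun_prop) (by fun_prop) fun x _ => ?_
          nlinarith [sq_nonneg (pd 1 (pd 1 U) x + pd I (pd I U) x +
            (pd 1 (pd 1 h) x + pd I (pd I h) x))]
      _ = 2 * (∫ x in Ω, (pd 1 (pd 1 U) x + pd I (pd I U) x) ^ 2) + 2 * k₁ := by
          rw [integral_add (H.integrableOn (by fun_prop)) (H.integrableOn (by fun_prop)),
            integral_const_mul, integral_const_mul]
      _ ≤ _ := by linarith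
  have hbd : ∫ s in (0 : ℝ)..L, (pd 1 a (γ s) ^ 2 + pd I a (γ s) ^ 2) ≤ 2 * S + 2 * k₂ := by
    calc _ ≤ ∫ s in (0 : ℝ)..L, (2 * (pd 1 U (γ s) ^ 2 + pd I U (γ s) ^ 2) +
          2 * (pd 1 h (γ s) ^ 2 + pd I h (γ s) ^ 2)) := by
          simp only [ea]
          refine intervalIntegral.integral_mono_on H.Lpos.le
            (Continuous.intervalIntegrable (by fun_prop) _ _)
            (Continuous.intervalIntegrable (by fun_prop) _ _) fun s _ => ?_
          nlinarith [sq_nonneg (pd 1 U (γ s) + pd 1 h (γ s)),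
            sq_nonneg (pd I U (γ s) + pd I h (γ s))]
      _ = 2 * (∫ s in (0 : ℝ)..L, (pd 1 U (γ s) ^ 2 + pd I U (γ s) ^ 2)) + 2 * k₂ := by
          rw [intervalIntegral.integral_add (Continuous.intervalIntegrable (by fun_prop) _ _)
            (Continuous.intervalIntegrable (by fun_prop) _ _),
            intervalIntegral.integral_const_mul, intervalIntegral.integral_const_mul]
      _ ≤ _ := by linarith
  have h0 : ∀ s, a (γ s) = 0 := fun s => by simp [ha', hb s]
  have hH := hHess a ha h0
  have haM : ∀ x ∈ Ω, |a x| ≤ M + N := fun x hx =>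
    (abs_sub _ _).trans (add_le_add (hM x hx) (hN x (subset_closure hx)))
  have h4 := H.grad_fourth_bound ha h0 haM
  have hU4 : ∫ x in Ω, (pd 1 U x ^ 2 + pd I U x ^ 2) ^ 2 ≤
      8 * (∫ x in Ω, (pd 1 a x ^ 2 + pd I a x ^ 2) ^ 2) + 8 * k₃ := by
    have e1 := (ha.pd 1).continuous
    have e2 := (ha.pd I).continuous
    calc _ ≤ ∫ x in Ω, (8 * (pd 1 a x ^ 2 + pd I a x ^ 2) ^ 2 +
          8 * (pd 1 h x ^ 2 + pd I h x ^ 2) ^ 2) := by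
          refine H.setIntegral_mono (by fun_prop) (by fun_prop) fun x _ => ?_
          have i1 : pd 1 U x = pd 1 a x + pd 1 h x := by simp [ea]
          have i2 : pd I U x = pd I a x + pd I h x := by simp [ea]
          rw [i1, i2]
          generalize pd 1 a x = p, pd I a x = q, pd 1 h x = r, pd I h x = t
          have j : (p + r) ^ 2 + (q + t) ^ 2 ≤ 2 * (p ^ 2 + q ^ 2) + 2 * (r ^ 2 + t ^ 2) := by
            nlinarith [sq_nonneg (p - r), sq_nonneg (q - t)]
          calc _ ≤ (2 * (p ^ 2 + q ^ 2) + 2 * (r ^ 2 + t ^ 2)) ^ 2 := by gcongr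
            _ ≤ _ := by nlinarith [sq_nonneg (p ^ 2 + q ^ 2 - (r ^ 2 + t ^ 2))]
      _ = _ := by
          rw [integral_add (H.integrableOn (by fun_prop)) (H.integrableOn (by fun_prop)),
            integral_const_mul, integral_const_mul]
  have hHS : ∫ x in Ω, (pd 1 (pd 1 a) x ^ 2 + 2 * pd 1 (pd I a) x ^ 2 + pd I (pd I a) x ^ 2) ≤
      (2 + 2 * k₁ + K * (2 + 2 * k₂)) * (1 + S) := by
    refine hH.trans ?_
    have := mul_le_mul_of_nonneg_left hbd hK
    have i1 : 0 ≤ k₁ * S := by positivity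
    have i2 : 0 ≤ K * (k₂ * S) := by positivity
    nlinarith
  have := mul_le_mul_of_nonneg_left hHS (show 0 ≤ 27 * (M + N) ^ 2 by positivity)
  have i3 : 0 ≤ k₃ * S := by positivity
  nlinarith

/-- The `L⁴` bound for the gradient of solutions. -/
lemma gradSq_sq_bound (H : StarDomain Ω γ n L c σ) {W : ℂ → ℝ} (hW : ContDiff ℝ (⊤ : ℕ∞) W)
    {R k : ℝ} (hk : 0 ≤ k) (hWk : ∀ z, ‖z‖ ≤ R → pd 1 W z ^ 2 + pd I W z ^ 2 ≤ k * W z)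
    {g : ℂ → ℂ} (hg : ContDiff ℝ (⊤ : ℕ∞) g) {P : ℝ} (hP : 0 ≤ P) :
    ∃ C, 0 ≤ C ∧ ∀ (ε : ℝ) (u : ℂ → ℂ), 0 < ε → SolvesGL W Ω ε u →
      (∀ s, u (γ s) = g (γ s)) → (∀ x ∈ Ω, ‖u x‖ ≤ R) →
      (ε ^ 2)⁻¹ * (∫ x in Ω, W (u x)) ≤ P → ∫ s in (0 : ℝ)..L, gradSq u (γ s) ≤ P →
      ∫ x in Ω, gradSq u x ^ 2 ≤ C * (1 + (ε ^ 2)⁻¹) := by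
  obtain ⟨C₁, hC₁, h1⟩ := H.grad_fourth_bound_of_boundary hg.re' R
  obtain ⟨C₂, hC₂, h2⟩ := H.grad_fourth_bound_of_boundary hg.im' R
  refine ⟨2 * (C₁ + C₂) * (1 + k * P + P), by positivity, fun ε u hε hu hb hR hp1 hp2 => ?_⟩
  have hus := hu.1
  have ca1 := (hus.re'.pd 1).continuous
  have ca2 := (hus.re'.pd I).continuous
  have cb1 := (hus.im'.pd 1).continuous
  have cb2 := (hus.im'.pd I).continuous
  have ca11 := ((hus.re'.pd 1).pd 1).continuous
  have ca22 := ((hus.re'.pd I).pd I).continuous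
  have cb11 := ((hus.im'.pd 1).pd 1).continuous
  have cb22 := ((hus.im'.pd I).pd I).continuous
  have cW : Continuous fun x => W (u x) := (hW.comp hus).continuous
  have cγ := H.continuous
  have cG := (contDiff_gradSq hus).continuous
  set S := k * P * (ε ^ 2)⁻¹ + P with hS
  have hlap : ∀ f : ℂ → ℝ, Continuous f → (∀ x ∈ Ω, f x ^ 2 ≤ ((ε ^ 2)⁻¹) ^ 2 *
      (pd 1 W (u x) ^ 2 + pd I W (u x) ^ 2)) → ∫ x in Ω, f x ^ 2 ≤ S := by
    intro f hf hle
    calc _ ≤ ∫ x in Ω, (k * (ε ^ 2)⁻¹) * ((ε ^ 2)⁻¹ * W (u x)) := by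
          refine H.setIntegral_mono (by fun_prop) (by fun_prop) fun x hx => ?_
          refine (hle x hx).trans ?_
          have := mul_le_mul_of_nonneg_left (hWk _ (hR x hx)) (sq_nonneg (ε ^ 2)⁻¹)
          linarith
      _ = k * (ε ^ 2)⁻¹ * ((ε ^ 2)⁻¹ * ∫ x in Ω, W (u x)) := by
          rw [integral_const_mul, integral_const_mul]
      _ ≤ k * (ε ^ 2)⁻¹ * P := by gcongr
      _ ≤ S := by rw [hS]; linarith
  have hbd : ∀ f : ℝ → ℝ, Continuous f → (∀ s, f s ≤ gradSq u (γ s)) →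
      ∫ s in (0 : ℝ)..L, f s ≤ S := by
    intro f hf hle
    calc _ ≤ ∫ s in (0 : ℝ)..L, gradSq u (γ s) :=
          intervalIntegral.integral_mono H.Lpos.le (hf.intervalIntegrable _ _)
            ((cG.comp cγ).intervalIntegrable _ _) hle
      _ ≤ P := hp2
      _ ≤ S := by rw [hS]; have : 0 ≤ k * P * (ε ^ 2)⁻¹ := by positivity
                  linarith
  have k1 := h1 _ S hus.re' (fun s => by rw [hb]) (fun x hx => (abs_re_le_norm _).trans (hR x hx))
    (hlap _ (by fun_prop) fun x hx => by
      rw [hu.lap_re hx, mul_pow]; gcongr; linarith [sq_nonneg (pd I W (u x))])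
    (hbd _ (by fun_prop) fun s => by
      rw [gradSq_eq hus]
      linarith [sq_nonneg (pd 1 (fun y => (u y).im) (γ s)),
        sq_nonneg (pd I (fun y => (u y).im) (γ s))])
  have k2 := h2 _ S hus.im' (fun s => by rw [hb]) (fun x hx => (abs_im_le_norm _).trans (hR x hx))
    (hlap _ (by fun_prop) fun x hx => by
      rw [hu.lap_im hx, mul_pow]; gcongr; linarith [sq_nonneg (pd 1 W (u x))])
    (hbd _ (by fun_prop) fun s => by
      rw [gradSq_eq hus]
      linarith [sq_nonneg (pd 1 (fun y => (u y).re) (γ s)),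
        sq_nonneg (pd I (fun y => (u y).re) (γ s))])
  have k3 : ∫ x in Ω, gradSq u x ^ 2 ≤
      2 * (∫ x in Ω, (pd 1 (fun y => (u y).re) x ^ 2 + pd I (fun y => (u y).re) x ^ 2) ^ 2) +
      2 * ∫ x in Ω, (pd 1 (fun y => (u y).im) x ^ 2 + pd I (fun y => (u y).im) x ^ 2) ^ 2 := by
    rw [← integral_const_mul, ← integral_const_mul,
      ← integral_add (H.integrableOn (by fun_prop)) (H.integrableOn (by fun_prop))]
    refine H.setIntegral_mono (by fun_prop) (by fun_prop) fun x _ => ?_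
    rw [gradSq_eq hus]
    exact add_sq_le.trans (by linarith)
  have i : 1 + S ≤ (1 + k * P + P) * (1 + (ε ^ 2)⁻¹) := by
    have : 0 ≤ (ε ^ 2)⁻¹ := by positivity
    have : 0 ≤ k * P := by positivity
    have : 0 ≤ P * (ε ^ 2)⁻¹ := by positivity
    rw [hS]; nlinarith
  have := mul_le_mul_of_nonneg_left i (show 0 ≤ 2 * (C₁ + C₂) by positivity)
  linarith

end StarDomain

lemma pd_pd_comp {f : ℂ → ℝ} {u : ℂ → ℂ} (hf : ContDiff ℝ (⊤ : ℕ∞) f)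
    (hu : ContDiff ℝ (⊤ : ℕ∞) u) (e x : ℂ) :
    pd e (pd e fun y => f (u y)) x =
      pd 1 (pd 1 f) (u x) * pd e (fun y => (u y).re) x ^ 2 +
        2 * pd 1 (pd I f) (u x) * pd e (fun y => (u y).re) x * pd e (fun y => (u y).im) x +
        pd I (pd I f) (u x) * pd e (fun y => (u y).im) x ^ 2 +
      (pd 1 f (u x) * pd e (pd e fun y => (u y).re) x +
        pd I f (u x) * pd e (pd e fun y => (u y).im) x) := by
  have h1 := hf.pd 1
  have h2 := hf.pd I
  have s1 : ContDiff ℝ (⊤ : ℕ∞) fun y => pd 1 f (u y) := h1.comp hu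
  have s2 : ContDiff ℝ (⊤ : ℕ∞) fun y => pd I f (u y) := h2.comp hu
  have r := hu.re'.pd e
  have i := hu.im'.pd e
  rw [show (pd e fun y => f (u y)) = fun y => pd 1 f (u y) * pd e (fun y => (u y).re) y +
    pd I f (u y) * pd e (fun y => (u y).im) y from funext fun y => pd_comp' hf hu e y,
    pd_add (s1.mul r) (s2.mul i), pd_mul s1 r, pd_mul s2 i, pd_comp' h1 hu, pd_comp' h2 hu,
    pd_comm hf I 1]
  ring

/-- The derivative in direction `e'` of the `e` component of the pull-back of a vector field. -/
lemma pd_pullback {A₁ A₂ : ℂ → ℝ} {u : ℂ → ℂ} (h1 : ContDiff ℝ (⊤ : ℕ∞) A₁)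
    (h2 : ContDiff ℝ (⊤ : ℕ∞) A₂) (hu : ContDiff ℝ (⊤ : ℕ∞) u) (e' e x : ℂ) :
    pd e' (fun y => A₁ (u y) * pd e (fun y => (u y).re) y +
        A₂ (u y) * pd e (fun y => (u y).im) y) x =
      (pd 1 A₁ (u x) * pd e' (fun y => (u y).re) x + pd I A₁ (u x) * pd e' (fun y => (u y).im) x) *
          pd e (fun y => (u y).re) x +
        (pd 1 A₂ (u x) * pd e' (fun y => (u y).re) x +
          pd I A₂ (u x) * pd e' (fun y => (u y).im) x) * pd e (fun y => (u y).im) x +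
      (A₁ (u x) * pd e' (pd e fun y => (u y).re) x +
        A₂ (u x) * pd e' (pd e fun y => (u y).im) x) := by
  have s1 : ContDiff ℝ (⊤ : ℕ∞) fun y => A₁ (u y) := h1.comp hu
  have s2 : ContDiff ℝ (⊤ : ℕ∞) fun y => A₂ (u y) := h2.comp hu
  have r := hu.re'.pd e
  have i := hu.im'.pd e
  rw [pd_add (s1.mul r) (s2.mul i), pd_mul s1 r, pd_mul s2 i, pd_comp' h1 hu, pd_comp' h2 hu]
  ring

set_option maxHeartbeats 1600000 in
/-- Up to an integrable remainder, the gradient of a solution is given by a vector field `v` with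
integrable curl which is close in `L²` to a vector field with integrable divergence, uniformly in
the parameter `ε`. -/
theorem StarDomain.exists_div_curl_estimates {Ω : Set ℂ} {γ n : ℝ → ℂ} {L c σ : ℝ}
    (H : StarDomain Ω γ n L c σ) {Γ : Set ℂ} {τ : ℝ → ℂ} {W : ℂ → ℝ} {R₀ : ℝ}
    (hW : PotentialHyp Γ W R₀) (hΓ : ArcParam Γ τ) {g : ℂ → ℂ} (hg : ContDiff ℝ (⊤ : ℕ∞) g)
    (hgΓ : ∀ s, g (γ s) ∈ Γ) :
    ∃ M, 0 ≤ M ∧ ∀ (ε : ℝ) (u : ℂ → ℂ), 0 < ε → SolvesGL W Ω ε u →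
      (∀ s, u (γ s) = g (γ s)) → ∃ a₁ a₂ v₁ v₂ ρ : ℂ → ℝ, ContDiff ℝ (⊤ : ℕ∞) a₁ ∧
        ContDiff ℝ (⊤ : ℕ∞) a₂ ∧ ContDiff ℝ (⊤ : ℕ∞) v₁ ∧ ContDiff ℝ (⊤ : ℕ∞) v₂ ∧
        Continuous ρ ∧ (∀ x, 0 ≤ ρ x) ∧
        ∫ x in Ω, |pd 1 a₁ x + pd I a₂ x| ≤ M ∧ ∫ x in Ω, |pd 1 v₂ x - pd I v₁ x| ≤ M ∧
        ∫ x in Ω, ((v₁ x - a₁ x) ^ 2 + (v₂ x - a₂ x) ^ 2) ≤ M ∧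
        ∫ s in (0 : ℝ)..L, (|a₁ (γ s)| + |a₂ (γ s)| + |v₁ (γ s)| + |v₂ (γ s)|) ≤ M ∧
        ∫ x in Ω, ρ x ≤ M ∧ ∀ x ∈ Ω, gradSq u x ≤ v₁ x ^ 2 + v₂ x ^ 2 + ρ x := by
  obtain ⟨A₁, A₂, B₁, B₂, T₁, T₂, C, c₁, F⟩ :=
    hW.exists_targetFrame hΓ (R := R₀) fun z hz => (hW.R0_large z hz).le
  obtain ⟨P, hP, hpoh⟩ := H.pohozaev_bound hW.smooth hW.nonneg hg
    fun s => hW.eq_zero_iff.2 (hgΓ s)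
  obtain ⟨Q, hQ, h4⟩ := H.gradSq_sq_bound hW.smooth F.C_nonneg F.grad_sq_le hg hP
  have hC := F.C_nonneg
  have hc₁ := F.pos
  have hL := H.Lpos
  set m := ∫ x in Ω, (1 : ℝ) with hm
  have hm0 : 0 ≤ m := integral_nonneg fun x => zero_le_one
  set E := 1 / 2 * (C * P + C ^ 2 * m + Q) with hE
  have hE0 : 0 ≤ E := by positivity
  set E₂ := C * E / c₁ with hE₂
  have hE₂0 : 0 ≤ E₂ := by positivity
  clear_value E E₂ m
  refine ⟨C * E + C * E₂ + C * P + 2 * C ^ 3 * E + 2 * C * (4 * L + P) + E₂, by positivity,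
    fun ε u hε hu hb => ?_⟩
  have p1 : 0 ≤ C * E := by positivity
  have p2 : 0 ≤ C * E₂ := by positivity
  have p3 : 0 ≤ C * P := by positivity
  have p4 : 0 ≤ 2 * C ^ 3 * E := by positivity
  have p5 : 0 ≤ 2 * C * (4 * L + P) := by positivity
  have hus := hu.1
  have cA₁ := F.smooth_A₁.continuous
  have cA₂ := F.smooth_A₂.continuous
  have cB₁ := F.smooth_B₁.continuous
  have cB₂ := F.smooth_B₂.continuous
  have cT₁ := F.smooth_T₁.continuous
  have cT₂ := F.smooth_T₂.continuous
  have sA₁ : ContDiff ℝ (⊤ : ℕ∞) fun x => A₁ (u x) := F.smooth_A₁.comp hus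
  have sA₂ : ContDiff ℝ (⊤ : ℕ∞) fun x => A₂ (u x) := F.smooth_A₂.comp hus
  have sB₁ : ContDiff ℝ (⊤ : ℕ∞) fun x => B₁ (u x) := F.smooth_B₁.comp hus
  have sB₂ : ContDiff ℝ (⊤ : ℕ∞) fun x => B₂ (u x) := F.smooth_B₂.comp hus
  have cu := hus.continuous
  have sW : ContDiff ℝ (⊤ : ℕ∞) fun x => W (u x) := hW.smooth.comp hus
  have cW := hW.smooth.continuous
  have cG := (contDiff_gradSq hus).continuous
  have cγ := H.continuous
  have hcl : ∀ x ∈ closure Ω, ‖u x‖ ≤ R₀ := fun x hx =>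
    hu.norm_le hW H.isOpen H.bdd (fun y hy => by
      rw [H.bdry] at hy; obtain ⟨s, rfl⟩ := hy; rw [hb]; exact hgΓ s) hx
  have hR : ∀ x ∈ Ω, ‖u x‖ ≤ R₀ := fun x hx => hcl x (subset_closure hx)
  have hRγ : ∀ s, ‖u (γ s)‖ ≤ R₀ := fun s => hcl _ (frontier_subset_closure (by
    rw [H.bdry]; exact mem_range_self s))
  obtain ⟨hp1, hp2⟩ := hpoh ε u hu hb
  have h4 := h4 ε u hε hu hb hR hp1 hp2
  have hre := fun x (hx : x ∈ Ω) => hu.lap_re hx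
  have him := fun x (hx : x ∈ Ω) => hu.lap_im hx
  have hGe := gradSq_eq hus
  have hWpp := pd_pd_comp hW.smooth hus
  have hWp := pd_comp' hW.smooth hus
  have hAp := pd_pullback F.smooth_A₁ F.smooth_A₂ hus
  have hBp := pd_pullback F.smooth_B₁ F.smooth_B₂ hus
  have hcm1 := pd_comm hus.re' 1 I
  have hcm2 := pd_comm hus.im' 1 I
  set U : ℂ → ℝ := fun y => (u y).re with hU
  set V : ℂ → ℝ := fun y => (u y).im with hV
  have sU : ContDiff ℝ (⊤ : ℕ∞) U := hus.re'
  have sV : ContDiff ℝ (⊤ : ℕ∞) V := hus.im'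
  have sU1 := sU.pd 1
  have sUI := sU.pd I
  have sV1 := sV.pd 1
  have sVI := sV.pd I
  have cU1 := sU1.continuous
  have cUI := sUI.continuous
  have cV1 := sV1.continuous
  have cVI := sVI.continuous
  clear_value U V
  set d : ℂ → ℝ := fun x => infDist (u x) Γ with hd
  have cd : Continuous d := (continuous_infDist_pt Γ).comp cu
  have d0 : ∀ x, 0 ≤ d x := fun x => infDist_nonneg
  have G0 := gradSq_nonneg u
  set q := 1 + (ε ^ 2)⁻¹ with hq
  have hq0 : 0 < q := by positivity
  -- the weighted gradient bound
  have hdG : ∫ x in Ω, d x * gradSq u x ≤ E := by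
    have i1 : ∫ x in Ω, d x * gradSq u x ≤
        ∫ x in Ω, (1 / 2 * (C * ((ε ^ 2)⁻¹ * W (u x)) + C ^ 2 * 1) +
          1 / 2 * (q⁻¹ * gradSq u x ^ 2)) := by
      refine H.setIntegral_mono (by fun_prop) (by fun_prop) fun x hx => ?_
      have j1 := F.dist_sq_le _ (hR x hx)
      have j2 : d x ^ 2 ≤ C ^ 2 := pow_le_pow_left₀ (d0 x) (F.dist_le _ (hR x hx)) 2
      have j3 : q * d x ^ 2 ≤ C * ((ε ^ 2)⁻¹ * W (u x)) + C ^ 2 * 1 := by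
        have := mul_le_mul_of_nonneg_left j1 (show 0 ≤ (ε ^ 2)⁻¹ by positivity)
        simp only [hq, hd] at j2 ⊢
        linarith
      have j4 : d x * gradSq u x ≤ 1 / 2 * (q * d x ^ 2) + 1 / 2 * (q⁻¹ * gradSq u x ^ 2) := by
        have : 0 ≤ q⁻¹ * (q * d x - gradSq u x) ^ 2 := by positivity
        have e : q⁻¹ * (q * d x - gradSq u x) ^ 2 =
          q * d x ^ 2 - 2 * (d x * gradSq u x) + q⁻¹ * gradSq u x ^ 2 := by
          field_simp
          ring
        linarith
      linarith
    rw [integral_add (H.integrableOn (by fun_prop)) (H.integrableOn (by fun_prop)),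
      integral_const_mul, integral_const_mul,
      integral_add (H.integrableOn (by fun_prop)) (H.integrableOn (by fun_prop)),
      integral_const_mul, integral_const_mul, integral_const_mul, integral_const_mul, ← hm] at i1
    have i2 : q⁻¹ * ∫ x in Ω, gradSq u x ^ 2 ≤ Q := by
      rw [inv_mul_le_iff₀ hq0, mul_comm]; exact h4
    have i3 := mul_le_mul_of_nonneg_left hp1 hC
    rw [hE]
    linarith
  -- the normal component bound
  set N : ℂ → ℝ := fun x => (T₁ (u x) * pd 1 V x - T₂ (u x) * pd 1 U x) ^ 2 +
    (T₁ (u x) * pd I V x - T₂ (u x) * pd I U x) ^ 2 with hN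
  have cN : Continuous N := by fun_prop
  have N0 : ∀ x, 0 ≤ N x := fun x => by positivity
  have hNint : ∫ x in Ω, N x ≤ E₂ := by
    have hz : ∫ x in Ω, (pd 1 (pd 1 fun y => W (u y)) x + pd I (pd I fun y => W (u y)) x) = 0 := by
      rw [H.ibp _ _ (sW.pd 1) (sW.pd I)]
      have : ∀ s e, pd e (fun y => W (u y)) (γ s) = 0 := fun s e => by
        have hz : u (γ s) ∈ Γ := by rw [hb]; exact hgΓ s
        rw [hWp, hW.pd_eq_zero hz, hW.pd_eq_zero hz]
        ring
      simp [this]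
    have c1 := ((sW.pd 1).pd 1).continuous
    have c2 := ((sW.pd I).pd I).continuous
    have i1 : ∫ x in Ω, c₁ * N x ≤ ∫ x in Ω,
        ((pd 1 (pd 1 fun y => W (u y)) x + pd I (pd I fun y => W (u y)) x) +
          C * (d x * gradSq u x)) := by
      refine H.setIntegral_mono (by fun_prop) (by fun_prop) fun x hx => ?_
      have j1 := F.le_hessian _ (hR x hx) (pd 1 U x) (pd 1 V x)
      have j2 := F.le_hessian _ (hR x hx) (pd I U x) (pd I V x)
      have j3 : pd 1 W (u x) * (pd 1 (pd 1 U) x + pd I (pd I U) x) +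
          pd I W (u x) * (pd 1 (pd 1 V) x + pd I (pd I V) x) =
          (ε ^ 2)⁻¹ * (pd 1 W (u x) ^ 2 + pd I W (u x) ^ 2) := by
        rw [hre x hx, him x hx]; ring
      have j4 : 0 ≤ (ε ^ 2)⁻¹ * (pd 1 W (u x) ^ 2 + pd I W (u x) ^ 2) := by positivity
      rw [hWpp, hWpp, hGe]
      simp only [hN, hd]
      linarith
    rw [integral_add (H.integrableOn (by fun_prop)) (H.integrableOn (by fun_prop)), hz,
      integral_const_mul, integral_const_mul, zero_add] at i1
    rw [hE₂, le_div_iff₀ hc₁]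
    have := mul_le_mul_of_nonneg_left hdG hC
    linarith
  have cdiv : ∀ A₁ A₂ : ℂ → ℝ, ContDiff ℝ (⊤ : ℕ∞) (fun x => A₁ (u x)) →
      ContDiff ℝ (⊤ : ℕ∞) (fun x => A₂ (u x)) → ∀ e,
      ContDiff ℝ (⊤ : ℕ∞) fun x => A₁ (u x) * pd e U x + A₂ (u x) * pd e V x :=
    fun A₁ A₂ h1 h2 e => (h1.mul (sU.pd e)).add (h2.mul (sV.pd e))
  have sa1 := cdiv A₁ A₂ sA₁ sA₂ 1
  have sa2 := cdiv A₁ A₂ sA₁ sA₂ I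
  have sv1 := cdiv B₁ B₂ sB₁ sB₂ 1
  have sv2 := cdiv B₁ B₂ sB₁ sB₂ I
  have ca1 := (sa1.pd 1).continuous
  have ca2 := (sa2.pd I).continuous
  have cv1 := (sv1.pd I).continuous
  have cv2 := (sv2.pd 1).continuous
  refine ⟨_, _, _, _, fun x => N x + C * (d x * gradSq u x), sa1, sa2, sv1, sv2, by fun_prop,
    fun x => ?_, ?_, ?_, ?_, ?_, ?_, fun x hx => ?_⟩
  · have := N0 x; have := d0 x; have := G0 x; positivity
  · have i1 := H.setIntegral_mono (f := fun x => |pd 1 (fun x => A₁ (u x) * pd 1 U x +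
        A₂ (u x) * pd 1 V x) x + pd I (fun x => A₁ (u x) * pd I U x + A₂ (u x) * pd I V x) x|)
      (g := fun x => C * (d x * gradSq u x) + C * N x + C * ((ε ^ 2)⁻¹ * W (u x)))
      (by fun_prop) (by fun_prop) fun x hx => ?_
    · rw [integral_add (H.integrableOn (by fun_prop)) (H.integrableOn (by fun_prop)),
        integral_add (H.integrableOn (by fun_prop)) (H.integrableOn (by fun_prop)),
        integral_const_mul, integral_const_mul, integral_const_mul, integral_const_mul] at i1
      have j1 := mul_le_mul_of_nonneg_left hdG hC
      have j2 := mul_le_mul_of_nonneg_left hNint hC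
      have j3 := mul_le_mul_of_nonneg_left hp1 hC
      linarith
    · have j1 := F.antisymm_A _ (hR x hx) (pd 1 U x) (pd 1 V x)
      have j2 := F.antisymm_A _ (hR x hx) (pd I U x) (pd I V x)
      have j3 := F.A_grad _ (hR x hx)
      have j4 : |(ε ^ 2)⁻¹ * (A₁ (u x) * pd 1 W (u x) + A₂ (u x) * pd I W (u x))| ≤
          C * ((ε ^ 2)⁻¹ * W (u x)) := by
        rw [abs_mul, abs_of_pos (show 0 < (ε ^ 2)⁻¹ by positivity)]
        have := mul_le_mul_of_nonneg_left j3 (show 0 ≤ (ε ^ 2)⁻¹ by positivity)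
        linarith
      have j5 : A₁ (u x) * (pd 1 (pd 1 U) x + pd I (pd I U) x) +
          A₂ (u x) * (pd 1 (pd 1 V) x + pd I (pd I V) x) =
          (ε ^ 2)⁻¹ * (A₁ (u x) * pd 1 W (u x) + A₂ (u x) * pd I W (u x)) := by
        rw [hre x hx, him x hx]; ring
      rw [hAp, hAp, hGe]
      simp only [hN, hd]
      rw [abs_le] at j1 j2 j4 ⊢
      constructor <;> linarith
  · have i1 := H.setIntegral_mono (f := fun x => |pd 1 (fun x => B₁ (u x) * pd I U x +
        B₂ (u x) * pd I V x) x - pd I (fun x => B₁ (u x) * pd 1 U x + B₂ (u x) * pd 1 V x) x|)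
      (g := fun x => C * (d x * gradSq u x))
      (by fun_prop) (by fun_prop) fun x hx => ?_
    · rw [integral_const_mul] at i1
      have j1 := mul_le_mul_of_nonneg_left hdG hC
      linarith
    · rw [hBp, hBp, hGe, hcm1, hcm2]
      have j := F.symm_B _ (hR x hx)
      calc _ = |(pd 1 B₂ (u x) - pd I B₁ (u x)) * (pd 1 U x * pd I V x - pd I U x * pd 1 V x)| := by
            congr 1; ring
        _ ≤ C * d x * (pd 1 U x ^ 2 + pd I U x ^ 2 + (pd 1 V x ^ 2 + pd I V x ^ 2)) := by
            rw [abs_mul]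
            refine mul_le_mul j ?_ (abs_nonneg _) (mul_nonneg hC (d0 x))
            rw [abs_le]
            constructor <;> nlinarith [sq_nonneg (pd 1 U x + pd I V x),
              sq_nonneg (pd 1 U x - pd I V x), sq_nonneg (pd I U x + pd 1 V x),
              sq_nonneg (pd I U x - pd 1 V x)]
        _ = _ := by ring
  · have i1 := H.setIntegral_mono (f := fun x => (B₁ (u x) * pd 1 U x + B₂ (u x) * pd 1 V x -
        (A₁ (u x) * pd 1 U x + A₂ (u x) * pd 1 V x)) ^ 2 + (B₁ (u x) * pd I U x +
        B₂ (u x) * pd I V x - (A₁ (u x) * pd I U x + A₂ (u x) * pd I V x)) ^ 2)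
      (g := fun x => 2 * C ^ 3 * (d x * gradSq u x)) (by fun_prop) (by fun_prop) fun x hx => ?_
    · rw [integral_const_mul] at i1
      have j1 := mul_le_mul_of_nonneg_left hdG (show 0 ≤ 2 * C ^ 3 by positivity)
      linarith
    · have j1 := sq_le_sq' (abs_le.1 (F.A_sub_B₁ _ (hR x hx))).1 (abs_le.1 (F.A_sub_B₁ _ (hR x hx))).2
      have j2 := sq_le_sq' (abs_le.1 (F.A_sub_B₂ _ (hR x hx))).1 (abs_le.1 (F.A_sub_B₂ _ (hR x hx))).2
      have j3 : (C * infDist (u x) Γ) ^ 2 ≤ C ^ 3 * d x := by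
        have := mul_le_mul_of_nonneg_left (F.dist_le _ (hR x hx))
          (show 0 ≤ C ^ 2 * infDist (u x) Γ by have := d0 x; positivity)
        simp only [hd]
        linarith
      have key : ∀ α β y z : ℝ, α ^ 2 ≤ C ^ 3 * d x → β ^ 2 ≤ C ^ 3 * d x →
          (α * y + β * z) ^ 2 ≤ 2 * (C ^ 3 * d x) * (y ^ 2 + z ^ 2) := fun α β y z h1 h2 => by
        have k1 := mul_le_mul_of_nonneg_right h1 (sq_nonneg y)
        have k2 := mul_le_mul_of_nonneg_right h2 (sq_nonneg z)
        nlinarith [sq_nonneg (α * y - β * z)]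
      have k1 := key _ _ (pd 1 U x) (pd 1 V x) (j1.trans j3) (j2.trans j3)
      have k2 := key _ _ (pd I U x) (pd I V x) (j1.trans j3) (j2.trans j3)
      rw [hGe]
      linarith
  · have i1 : ∫ s in (0 : ℝ)..L, (|A₁ (u (γ s)) * pd 1 U (γ s) + A₂ (u (γ s)) * pd 1 V (γ s)| +
        |A₁ (u (γ s)) * pd I U (γ s) + A₂ (u (γ s)) * pd I V (γ s)| +
        |B₁ (u (γ s)) * pd 1 U (γ s) + B₂ (u (γ s)) * pd 1 V (γ s)| +
        |B₁ (u (γ s)) * pd I U (γ s) + B₂ (u (γ s)) * pd I V (γ s)|) ≤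
        ∫ s in (0 : ℝ)..L, 2 * C * (4 + gradSq u (γ s)) := by
      refine intervalIntegral.integral_mono hL.le (Continuous.intervalIntegrable (by fun_prop) _ _)
        (Continuous.intervalIntegrable (by fun_prop) _ _) fun s => ?_
      have key : ∀ α β y z : ℝ, |α| ≤ C ∧ |β| ≤ C →
          |α * y + β * z| ≤ C * (2 + y ^ 2 + z ^ 2) := fun α β y z h => by
        calc _ ≤ |α| * |y| + |β| * |z| := by rw [← abs_mul, ← abs_mul]; exact abs_add_le _ _
          _ ≤ C * |y| + C * |z| := add_le_add (mul_le_mul_of_nonneg_right h.1 (abs_nonneg _))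
              (mul_le_mul_of_nonneg_right h.2 (abs_nonneg _))
          _ = C * (|y| + |z|) := by ring
          _ ≤ _ := by
            refine mul_le_mul_of_nonneg_left ?_ hC
            nlinarith [sq_nonneg (|y| - 1), sq_nonneg (|z| - 1), sq_abs y, sq_abs z,
              abs_nonneg y, abs_nonneg z]
      have a := F.A_le _ (hRγ s)
      have b := F.B_le _ (hRγ s)
      have k1 := key _ _ (pd 1 U (γ s)) (pd 1 V (γ s)) a
      have k2 := key _ _ (pd I U (γ s)) (pd I V (γ s)) a
      have k3 := key _ _ (pd 1 U (γ s)) (pd 1 V (γ s)) b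
      have k4 := key _ _ (pd I U (γ s)) (pd I V (γ s)) b
      beta_reduce
      rw [hGe]
      linarith
    have i2 : ∫ s in (0 : ℝ)..L, 2 * C * (4 + gradSq u (γ s)) =
        2 * C * (4 * L + ∫ s in (0 : ℝ)..L, gradSq u (γ s)) := by
      rw [intervalIntegral.integral_const_mul,
        intervalIntegral.integral_add (Continuous.intervalIntegrable (by fun_prop) _ _)
          (Continuous.intervalIntegrable (by fun_prop) _ _), intervalIntegral.integral_const,
        smul_eq_mul, sub_zero, mul_comm L]
    rw [i2] at i1
    have := mul_le_mul_of_nonneg_left hp2 (show 0 ≤ 2 * C by positivity)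
    linarith
  · rw [integral_add (H.integrableOn (by fun_prop)) (H.integrableOn (by fun_prop)),
      integral_const_mul]
    have := mul_le_mul_of_nonneg_left hdG hC
    linarith
  · have j1 := F.sq_le _ (hR x hx) (pd 1 U x) (pd 1 V x)
    have j2 := F.sq_le _ (hR x hx) (pd I U x) (pd I V x)
    simp only [hN, hd, hGe]
    linarith

/-! ### The Cauchy transform -/

/-- The Cauchy–Pompeiu formula at the origin for compactly supported functions. -/
lemma integral_inv_mul_dbar {φ : ℂ → ℂ} (hφ : ContDiff ℝ (⊤ : ℕ∞) φ) (hc : HasCompactSupport φ) :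
    ∫ t, t⁻¹ * (pd 1 φ t + I * pd I φ t) = -(2 * Real.pi) * φ 0 := by
  obtain ⟨R, hR0, hR⟩ : ∃ R : ℝ, 0 < R ∧ tsupport φ ⊆ ball 0 R := by
    obtain ⟨R, hR⟩ := hc.isCompact.isBounded.subset_ball 0
    exact ⟨max R 1, by positivity, hR.trans (ball_subset_ball (le_max_left _ _))⟩
  have hz0 : ∀ z : ℂ, R ≤ ‖z‖ → z ∉ tsupport φ := by
    intro z hz h
    have := hR h
    rw [mem_ball_zero_iff] at this
    linarith
  have hφ0 : ∀ z : ℂ, R ≤ ‖z‖ → φ z = 0 := fun z hz => image_eq_zero_of_notMem_tsupport (hz0 z hz)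
  have hd0 : ∀ z : ℂ, R ≤ ‖z‖ → fderiv ℝ φ z = 0 := fun z hz =>
    image_eq_zero_of_notMem_tsupport fun h => hz0 z hz (tsupport_fderiv_subset ℝ h)
  have hcd : Continuous (fderiv ℝ φ) := hφ.continuous_fderiv (by simp)
  set e : ℝ → ℂ := fun θ => (Real.cos θ : ℂ) + Real.sin θ * I with he
  have hec : Continuous e := by rw [he]; fun_prop
  have hen : ∀ θ, ‖e θ‖ = 1 := by
    intro θ
    have : e θ = exp (θ * I) := by
      simp only [he]; rw [exp_mul_I]; push_cast; ring
    rw [this, norm_exp_ofReal_mul_I]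
  have hed : ∀ θ, HasDerivAt e (I * e θ) θ := by
    intro θ
    have h1 := (Real.hasDerivAt_cos θ).ofReal_comp
    have h2 := (Real.hasDerivAt_sin θ).ofReal_comp
    refine (h1.add (h2.mul_const I)).congr_deriv ?_
    simp only [he]
    push_cast
    linear_combination (-(Complex.sin θ)) * I_mul_I
  set G1 : ℝ × ℝ → ℂ := fun p => fderiv ℝ φ (p.1 * e p.2) (e p.2) with hG1
  set G2 : ℝ × ℝ → ℂ := fun p => fderiv ℝ φ (p.1 * e p.2) (I * e p.2) with hG2
  have c1 : Continuous G1 := by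
    rw [hG1]; exact (hcd.comp (by fun_prop)).clm_apply (by fun_prop)
  have c2 : Continuous G2 := by
    rw [hG2]; exact (hcd.comp (by fun_prop)).clm_apply (by fun_prop)
  set S : Set (ℝ × ℝ) := Ioc 0 R ×ˢ Ioo (-Real.pi) Real.pi with hS
  have hSc : S ⊆ Icc 0 R ×ˢ Icc (-Real.pi) Real.pi :=
    prod_mono Ioc_subset_Icc_self Ioo_subset_Icc_self
  have hint : ∀ G : ℝ × ℝ → ℂ, Continuous G → IntegrableOn G S := fun G hG =>
    (hG.continuousOn.integrableOn_compact (isCompact_Icc.prod isCompact_Icc)).mono_set hSc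
  have hA : ∫ t, t⁻¹ * (pd 1 φ t + I * pd I φ t) = ∫ p in S, (G1 p + I * G2 p) := by
    rw [← Complex.integral_comp_polarCoord_symm]
    have h1 : ∫ p in S, (G1 p + I * G2 p) =
        ∫ p in Ioi 0 ×ˢ Ioo (-Real.pi) Real.pi, (G1 p + I * G2 p) := by
      symm
      apply setIntegral_eq_of_subset_of_forall_sdiff_eq_zero
      · exact measurableSet_Ioi.prod measurableSet_Ioo
      · exact prod_mono Ioc_subset_Ioi_self subset_rfl
      · rintro ⟨r, θ⟩ ⟨h, h'⟩
        have hr : R ≤ r := by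
          by_contra hlt
          exact h' ⟨⟨h.1, (not_le.1 hlt).le⟩, h.2⟩
        have : R ≤ ‖(r : ℂ) * e θ‖ := by
          rw [norm_mul, hen, mul_one, norm_real, Real.norm_eq_abs]
          exact hr.trans (le_abs_self r)
        simp [hG1, hG2, hd0 _ this]
    rw [h1]
    have ht : polarCoord.target = Ioi 0 ×ˢ Ioo (-Real.pi) Real.pi := rfl
    rw [ht]
    refine setIntegral_congr_fun (measurableSet_Ioi.prod measurableSet_Ioo) ?_
    rintro ⟨r, θ⟩ ⟨hr, -⟩
    have hr' : (r : ℂ) ≠ 0 := by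
      have : (0 : ℝ) < r := hr
      exact_mod_cast this.ne'
    have hs : (Real.cos θ : ℂ) ^ 2 + (Real.sin θ : ℂ) ^ 2 = 1 := by
      exact_mod_cast Real.cos_sq_add_sin_sq θ
    have he1 : e θ * ((Real.cos θ : ℂ) - Real.sin θ * I) = 1 := by
      simp only [he]
      linear_combination hs - (Real.sin θ : ℂ) ^ 2 * I_sq
    have hinv : ((r : ℂ) * e θ)⁻¹ = (r : ℂ)⁻¹ * ((Real.cos θ : ℂ) - Real.sin θ * I) := by
      rw [mul_inv, inv_eq_of_mul_eq_one_right he1]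
    simp only [Complex.polarCoord_symm_apply]
    change r • (((r : ℂ) * e θ)⁻¹ * (pd 1 φ (r * e θ) + I * pd I φ (r * e θ))) = _
    rw [hinv]
    simp only [hG1, hG2]
    rw [fderiv_eq_pd φ _ (e θ), fderiv_eq_pd φ _ (I * e θ)]
    have r1 : (e θ).re = Real.cos θ := by simp only [he]; simp [-ofReal_cos, -ofReal_sin]
    have r2 : (e θ).im = Real.sin θ := by simp only [he]; simp [-ofReal_cos, -ofReal_sin]
    simp only [mul_re, mul_im, I_re, I_im, r1, r2, real_smul]
    have : (r : ℂ) * (r : ℂ)⁻¹ = 1 := mul_inv_cancel₀ hr'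
    generalize pd 1 φ (↑r * e θ) = A
    generalize pd I φ (↑r * e θ) = B
    push_cast
    linear_combination ((Complex.cos θ) - Complex.sin θ * I) * (A + I * B) * this -
      Complex.sin θ * B * I_sq
  have hB1 : ∫ p in S, G1 p = -(2 * Real.pi) * φ 0 := by
    rw [hS, Measure.volume_eq_prod, ← setIntegral_prod_swap, setIntegral_prod]
    · have : ∀ θ : ℝ, ∫ r in Ioc 0 R, G1 (r, θ) = - φ 0 := by
        intro θ
        rw [← intervalIntegral.integral_of_le hR0.le]
        have hd : ∀ r : ℝ, HasDerivAt (fun r : ℝ => φ (r * e θ)) (G1 (r, θ)) r := by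
          intro r
          have h1 : HasDerivAt (fun r : ℝ => (r : ℂ) * e θ) (e θ) r := by
            simpa using (Complex.ofRealCLM.hasDerivAt (x := r)).mul_const (e θ)
          exact (hφ.diffAt _).hasFDerivAt.comp_hasDerivAt r h1
        rw [intervalIntegral.integral_eq_sub_of_hasDerivAt (fun r _ => hd r)
          ((c1.comp (by fun_prop : Continuous fun r : ℝ => (r, θ))).intervalIntegrable _ _)]
        rw [hφ0 ((R : ℂ) * e θ)]
        · simp
        · rw [norm_mul, hen, mul_one, norm_real, Real.norm_eq_abs]
          exact le_abs_self R
      simp only [Prod.swap_prod_mk, this]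
      simp [Real.pi_pos.le, ← two_mul]
    · exact (hint G1 c1).swap
  have hB2 : ∫ p in S, G2 p = 0 := by
    rw [hS, Measure.volume_eq_prod, setIntegral_prod _ (hint G2 c2)]
    refine setIntegral_eq_zero_of_forall_eq_zero fun r hr => ?_
    rw [← integral_Ioc_eq_integral_Ioo, ← intervalIntegral.integral_of_le
      (by linarith [Real.pi_pos])]
    have hd : ∀ θ : ℝ, HasDerivAt (fun θ : ℝ => φ (r * e θ)) (r * G2 (r, θ)) θ := by
      intro θ
      refine ((hφ.diffAt _).hasFDerivAt.comp_hasDerivAt θ ((hed θ).const_mul (r : ℂ))).congr_deriv ?_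
      simp only [hG2]
      rw [← real_smul (z := I * e θ), map_smul, real_smul]
    have h0 := intervalIntegral.integral_eq_sub_of_hasDerivAt
      (a := -Real.pi) (b := Real.pi) (fun θ _ => hd θ)
      ((continuous_const.mul (c2.comp (by fun_prop : Continuous fun θ : ℝ =>
        (r, θ)))).intervalIntegrable _ _)
    rw [intervalIntegral.integral_const_mul] at h0
    have h1 : e Real.pi = e (-Real.pi) := by simp [he]
    rw [h1, sub_self] at h0
    rcases mul_eq_zero.1 h0 with h | h
    · have : r = 0 := by exact_mod_cast h
      exact absurd this hr.1.ne'
    · exact h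
  have c2' : Continuous fun p => I * G2 p := continuous_const.mul c2
  rw [hA, integral_add (hint _ c1) (hint _ c2'), integral_const_mul, hB1, hB2]
  simp

lemma exists_integrable_bound_inv_norm_rpow {p : ℝ} (hp0 : 0 < p) (hp : p < 2) :
    ∃ h : ℂ → ℝ, Integrable h ∧ (∀ t, 0 ≤ h t) ∧ ∀ t, (‖t‖⁻¹) ^ p ≤ 1 + h t := by
  refine ⟨(ball (0 : ℂ) 1).indicator fun t => (‖t‖⁻¹) ^ p, ?_, ?_, ?_⟩
  · rw [integrable_indicator_iff measurableSet_ball]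
    refine integrableOn_ball_of_norm_le_rpow (α := p) (C := 1)
      (by rw [Complex.finrank_real_complex]; norm_num) 
      (by rw [Complex.finrank_real_complex]; exact_mod_cast hp) ?_ ?_
    · refine Eventually.of_forall fun t => ?_
      rw [Real.norm_of_nonneg (by positivity), Real.rpow_neg (norm_nonneg _),
        Real.inv_rpow (norm_nonneg _), one_mul]
    · exact ((measurable_norm.inv).pow_const p).aestronglyMeasurable
  · intro t
    exact indicator_nonneg (fun t _ => by positivity) t
  · intro t
    by_cases ht : t ∈ ball (0 : ℂ) 1
    · rw [indicator_of_mem ht]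
      linarith
    · rw [indicator_of_notMem ht, add_zero]
      rw [mem_ball_zero_iff, not_lt] at ht
      exact Real.rpow_le_one (by positivity) (inv_le_one_of_one_le₀ ht) hp0.le

lemma locallyIntegrable_inv : LocallyIntegrable (fun t : ℂ => t⁻¹) :=
  locallyIntegrable_of_norm_le_rpow (α := 1) (C := 1)
    (by rw [Complex.finrank_real_complex]; norm_num)
    (by rw [Complex.finrank_real_complex]; norm_num)
    (Eventually.of_forall fun t => by rw [Real.rpow_neg_one, norm_inv, one_mul])
    measurable_inv.aestronglyMeasurable

/-- The inhomogeneous Cauchy–Riemann equation is solved by the Cauchy transform. -/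
lemma exists_dbar_primitive {f : ℂ → ℂ} (hf : ContDiff ℝ (⊤ : ℕ∞) f) (hc : HasCompactSupport f) :
    ∃ P : ℂ → ℂ, ContDiff ℝ (⊤ : ℕ∞) P ∧ (∀ x, pd 1 P x + I * pd I P x = f x) ∧
      ∀ x, ‖P x‖ ≤ ∫ t, ‖x - t‖⁻¹ * ‖f t‖ := by
  set C : ℂ → ℂ := convolution (fun t : ℂ => t⁻¹) f (ContinuousLinearMap.mul ℝ ℂ) volume with hC
  have hCs : ContDiff ℝ (⊤ : ℕ∞) C := hc.contDiff_convolution_right _ locallyIntegrable_inv hf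
  have hpd : ∀ e x, pd e C x = ∫ t, t⁻¹ * pd e f (x - t) := by
    intro e x
    unfold pd
    rw [(hc.hasFDerivAt_convolution_right (ContinuousLinearMap.mul ℝ ℂ) locallyIntegrable_inv
      (hf.of_le (by simp)) x).fderiv, convolution_precompR_apply _ locallyIntegrable_inv
      (hc.fderiv ℝ) (hf.continuous_fderiv (by simp))]
    rfl
  have hint : ∀ e x, Integrable fun t => t⁻¹ * pd e f (x - t) := by
    intro e x
    have := (hc.fderiv_apply ℝ e).convolutionExists_right (ContinuousLinearMap.mul ℝ ℂ)
      locallyIntegrable_inv ((hf.pd e).continuous) x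
    exact this
  have hpi : (2 * Real.pi : ℂ) ≠ 0 := by
    exact_mod_cast (by positivity : (2 * Real.pi : ℝ) ≠ 0)
  refine ⟨fun x => (2 * Real.pi : ℂ)⁻¹ * C x, contDiff_const.mul hCs, fun x => ?_, fun x => ?_⟩
  · have h1 : ∀ e, pd e (fun x => (2 * Real.pi : ℂ)⁻¹ * C x) x = (2 * Real.pi : ℂ)⁻¹ * pd e C x := by
      intro e
      exact pd_clm (ContinuousLinearMap.mul ℝ ℂ (2 * Real.pi : ℂ)⁻¹) hCs e x
    have hφ : ContDiff ℝ (⊤ : ℕ∞) fun t => f (x - t) := hf.comp (contDiff_const.sub contDiff_id)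
    have hφc : HasCompactSupport fun t => f (x - t) :=
      hc.comp_homeomorph (Homeomorph.subLeft x)
    have h2 : ∀ e t, pd e (fun t => f (x - t)) t = - pd e f (x - t) := by
      intro e t
      rw [pd_comp (u := fun t => x - t) hf (contDiff_const.sub contDiff_id)]
      have : pd e (fun t => x - t) t = -e := by
        unfold pd
        rw [fderiv_const_sub]
        simp
      rw [this, map_neg]
      rfl
    have h3 := integral_inv_mul_dbar hφ hφc
    simp only [h2, sub_zero] at h3
    rw [h1, h1, hpd, hpd]
    have h4 : ∫ t, t⁻¹ * (-pd 1 f (x - t) + I * -pd I f (x - t)) =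
        -((∫ t, t⁻¹ * pd 1 f (x - t)) + I * ∫ t, t⁻¹ * pd I f (x - t)) := by
      rw [← integral_const_mul, ← integral_add (hint 1 x) ((hint I x).const_mul I), ← integral_neg]
      congr 1
      ext t
      ring
    rw [h4] at h3
    generalize (∫ t, t⁻¹ * pd 1 f (x - t)) = A at h3 ⊢
    generalize (∫ t, t⁻¹ * pd I f (x - t)) = B at h3 ⊢
    field_simp
    linear_combination -h3
  · have h1 : ‖C x‖ ≤ ∫ t, ‖x - t‖⁻¹ * ‖f t‖ := by
      have : C x = ∫ t, t⁻¹ * f (x - t) := rfl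
      rw [this]
      refine (norm_integral_le_integral_norm _).trans (le_of_eq ?_)
      rw [← integral_sub_left_eq_self _ volume x]
      congr 1
      ext t
      rw [norm_mul, norm_inv, sub_sub_cancel]
    rw [norm_mul]
    refine (mul_le_of_le_one_left (norm_nonneg _) ?_).trans h1
    rw [norm_inv, norm_mul, norm_real, Real.norm_of_nonneg Real.pi_pos.le]
    refine inv_le_one_of_one_le₀ ?_
    simp only [Complex.norm_ofNat]
    linarith [Real.pi_gt_three]

lemma integral_gradSq_eq {Q : ℂ → ℂ} (hQ : ContDiff ℝ (⊤ : ℕ∞) Q) (hc : HasCompactSupport Q) :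
    ∫ x, gradSq Q x = ∫ x, ‖pd 1 Q x + I * pd I Q x‖ ^ 2 := by
  have hre : HasCompactSupport fun y => (Q y).re := hc.comp_left (g := Complex.re) rfl
  have him : HasCompactSupport fun y => (Q y).im := hc.comp_left (g := Complex.im) rfl
  have hpc : ∀ e, ∀ f : ℂ → ℝ, HasCompactSupport f → HasCompactSupport (pd e f) :=
    fun e f hf => hf.fderiv_apply ℝ e
  have r1 := (hQ.re'.pd 1).continuous
  have r2 := (hQ.re'.pd I).continuous
  have i1 := (hQ.im'.pd 1).continuous
  have i2 := (hQ.im'.pd I).continuous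
  have key : ∀ e e', ∫ x, (Q x).re * pd e (pd e' fun y => (Q y).im) x =
      - ∫ x, pd e (fun y => (Q y).re) x * pd e' (fun y => (Q y).im) x := by
    intro e e'
    refine integral_mul_fderiv_eq_neg_fderiv_mul_of_integrable ?_ ?_ ?_ ?_ ?_
    · exact Continuous.integrable_of_hasCompactSupport
        ((hQ.re'.pd e).continuous.mul (hQ.im'.pd e').continuous) (hpc e' _ him).mul_left
    · exact Continuous.integrable_of_hasCompactSupport
        (hQ.re'.continuous.mul ((hQ.im'.pd e').pd e).continuous) hre.mul_right
    · exact Continuous.integrable_of_hasCompactSupport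
        (hQ.re'.continuous.mul (hQ.im'.pd e').continuous) hre.mul_right
    · exact fun x _ => hQ.re'.diffAt x
    · exact fun x _ => (hQ.im'.pd e').diffAt x
  have h1 := key 1 I
  have h2 := key I 1
  have h3 : (fun x => (Q x).re * pd I (pd 1 fun y => (Q y).im) x) =
      fun x => (Q x).re * pd 1 (pd I fun y => (Q y).im) x := by
    ext x; rw [pd_comm hQ.im']
  rw [h3, h1, neg_inj] at h2
  have e1 : ∀ x, ‖pd 1 Q x + I * pd I Q x‖ ^ 2 = gradSq Q x +
      (2 * (pd I (fun y => (Q y).re) x * pd 1 (fun y => (Q y).im) x) -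
        2 * (pd 1 (fun y => (Q y).re) x * pd I (fun y => (Q y).im) x)) := by
    intro x
    rw [gradSq_eq hQ, pd_re hQ, pd_re hQ, pd_im hQ, pd_im hQ, ← normSq_eq_norm_sq, normSq_apply]
    simp
    ring
  have hg : Integrable (gradSq Q) := by
    refine Continuous.integrable_of_hasCompactSupport (contDiff_gradSq hQ).continuous ?_
    refine (hc.fderiv ℝ).mono fun x hx => ?_
    contrapose! hx
    rw [Function.notMem_support] at hx ⊢
    simp [gradSq, hx]
  have hi1 : Integrable fun x => pd I (fun y => (Q y).re) x * pd 1 (fun y => (Q y).im) x :=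
    Continuous.integrable_of_hasCompactSupport (r2.mul i1) (hpc 1 _ him).mul_left
  have hi2 : Integrable fun x => pd 1 (fun y => (Q y).re) x * pd I (fun y => (Q y).im) x :=
    Continuous.integrable_of_hasCompactSupport (r1.mul i2) (hpc I _ him).mul_left
  have hi3 : Integrable fun x => 2 * (pd I (fun y => (Q y).re) x * pd 1 (fun y => (Q y).im) x) -
      2 * (pd 1 (fun y => (Q y).re) x * pd I (fun y => (Q y).im) x) :=
    (hi1.const_mul 2).sub (hi2.const_mul 2)
  simp only [e1]
  rw [integral_add hg hi3,
    integral_sub (hi1.const_mul 2) (hi2.const_mul 2), integral_const_mul, integral_const_mul, h2]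
  ring

lemma exists_gradSq_bound_of_dbar {Ω : Set ℂ} (ho : IsOpen Ω) (hb : IsBounded Ω) :
    ∃ K : ℝ, 0 ≤ K ∧ ∀ (P f : ℂ → ℂ) (N : ℝ), ContDiff ℝ (⊤ : ℕ∞) P → Continuous f →
      HasCompactSupport f → (∀ x, pd 1 P x + I * pd I P x = f x) → (∀ x, ‖P x‖ ≤ N) →
      ∫ x in Ω, gradSq P x ≤ K * ((∫ x, ‖f x‖ ^ 2) + N ^ 2) := by
  obtain ⟨R, hR0, hR⟩ : ∃ R : ℝ, 0 < R ∧ Ω ⊆ ball 0 R := by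
    obtain ⟨R, hR⟩ := hb.subset_ball 0
    exact ⟨max R 1, by positivity, hR.trans (ball_subset_ball (le_max_left _ _))⟩
  let b : ContDiffBump (0 : ℂ) := ⟨R, R + 1, hR0, by linarith⟩
  set ζ : ℂ → ℂ := fun x => (b x : ℂ) with hζ
  have hζs : ContDiff ℝ (⊤ : ℕ∞) ζ := Complex.ofRealCLM.contDiff.comp b.contDiff
  have hζc : HasCompactSupport ζ := b.hasCompactSupport.comp_left (g := Complex.ofReal) rfl
  set D : ℂ → ℂ := fun x => pd 1 ζ x + I * pd I ζ x with hD
  have hDc : Continuous D := (hζs.pd 1).continuous.add (continuous_const.mul (hζs.pd I).continuous)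
  have hDs : HasCompactSupport D :=
    (hζc.fderiv_apply ℝ (1 : ℂ)).add ((hζc.fderiv_apply ℝ I).mul_left)
  have sqc : ∀ f : ℂ → ℂ, HasCompactSupport f → HasCompactSupport fun x => ‖f x‖ ^ 2 := by
    intro f hf
    exact hf.comp_left (g := fun z : ℂ => ‖z‖ ^ 2) (by simp)
  have hDi : Integrable fun x => ‖D x‖ ^ 2 :=
    Continuous.integrable_of_hasCompactSupport (by fun_prop) (sqc D hDs)
  have hD0 : 0 ≤ ∫ x, ‖D x‖ ^ 2 := integral_nonneg fun x => by positivity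
  refine ⟨2 + 2 * ∫ x, ‖D x‖ ^ 2, by positivity, fun P f N hP hfc hfs hPf hN => ?_⟩
  set Q : ℂ → ℂ := fun x => ζ x * P x with hQ
  have hQs : ContDiff ℝ (⊤ : ℕ∞) Q := hζs.mul hP
  have hQc : HasCompactSupport Q := hζc.mul_right
  have hQd : ∀ x, pd 1 Q x + I * pd I Q x = ζ x * f x + P x * D x := by
    intro x
    have : ∀ e, pd e Q x = ζ x * pd e P x + P x * pd e ζ x := by
      intro e
      unfold pd
      rw [fderiv_fun_mul (hζs.diffAt x) (hP.diffAt x)]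
      simp
    rw [this, this, ← hPf]
    simp only [hD]
    ring
  have hloc : ∀ x ∈ Ω, gradSq P x = gradSq Q x := by
    intro x hx
    have : P =ᶠ[𝓝 x] Q := by
      filter_upwards [ho.mem_nhds hx] with y hy
      have : b y = 1 := b.one_of_mem_closedBall (ball_subset_closedBall (hR hy))
      simp [hQ, hζ, this]
    unfold gradSq
    rw [this.fderiv_eq]
  have hgi : Integrable (gradSq Q) := by
    refine Continuous.integrable_of_hasCompactSupport (contDiff_gradSq hQs).continuous ?_
    refine (hQc.fderiv ℝ).mono fun x hx => ?_
    contrapose! hx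
    rw [Function.notMem_support] at hx ⊢
    simp [gradSq, hx]
  have hN0 : 0 ≤ N := (norm_nonneg _).trans (hN 0)
  have hfi : Integrable fun x => ‖f x‖ ^ 2 :=
    Continuous.integrable_of_hasCompactSupport (by fun_prop) (sqc f hfs)
  have hf0 : 0 ≤ ∫ x, ‖f x‖ ^ 2 := integral_nonneg fun x => by positivity
  calc ∫ x in Ω, gradSq P x = ∫ x in Ω, gradSq Q x :=
        setIntegral_congr_fun ho.measurableSet hloc
    _ ≤ ∫ x, gradSq Q x := setIntegral_le_integral hgi (Eventually.of_forall fun x => gradSq_nonneg _ _)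
    _ = ∫ x, ‖ζ x * f x + P x * D x‖ ^ 2 := by
        rw [integral_gradSq_eq hQs hQc]; simp only [hQd]
    _ ≤ ∫ x, (2 * ‖f x‖ ^ 2 + 2 * N ^ 2 * ‖D x‖ ^ 2) := by
        refine integral_mono_of_nonneg (Eventually.of_forall fun x => by positivity)
          ((hfi.const_mul 2).add (hDi.const_mul _)) (Eventually.of_forall fun x => ?_)
        have h1 : ‖ζ x * f x‖ ≤ ‖f x‖ := by
          rw [norm_mul]
          refine mul_le_of_le_one_left (norm_nonneg _) ?_
          simp only [hζ, norm_real, Real.norm_eq_abs]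
          rw [abs_of_nonneg b.nonneg]
          exact b.le_one
        have h2 : ‖P x * D x‖ ≤ N * ‖D x‖ := by
          rw [norm_mul]
          exact mul_le_mul_of_nonneg_right (hN x) (norm_nonneg _)
        have h3 : ‖ζ x * f x + P x * D x‖ ≤ ‖f x‖ + N * ‖D x‖ := (norm_add_le _ _).trans (by linarith)
        have h4 := pow_le_pow_left₀ (norm_nonneg _) h3 2
        simp only
        nlinarith [sq_nonneg (‖f x‖ - N * ‖D x‖)]
    _ = 2 * (∫ x, ‖f x‖ ^ 2) + 2 * N ^ 2 * ∫ x, ‖D x‖ ^ 2 := by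
        rw [integral_add (hfi.const_mul 2) (hDi.const_mul _), integral_const_mul, integral_const_mul]
    _ ≤ _ := by nlinarith [mul_nonneg hf0 hD0, sq_nonneg N]

/-! ### An `Lᵖ` bound from `L¹` control of divergence and curl -/

namespace StarDomain
variable {Ω : Set ℂ} {γ n : ℝ → ℂ} {L c σ : ℝ}

lemma integral_mul_dbar_le (H : StarDomain Ω γ n L c σ) {a₁ a₂ v₁ v₂ : ℂ → ℝ} {P : ℂ → ℂ}
    {M N η : ℝ} (ha₁ : ContDiff ℝ (⊤ : ℕ∞) a₁) (ha₂ : ContDiff ℝ (⊤ : ℕ∞) a₂)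
    (hv₁ : ContDiff ℝ (⊤ : ℕ∞) v₁) (hv₂ : ContDiff ℝ (⊤ : ℕ∞) v₂) (hP : ContDiff ℝ (⊤ : ℕ∞) P)
    (hdiv : ∫ x in Ω, |pd 1 a₁ x + pd I a₂ x| ≤ M)
    (hcurl : ∫ x in Ω, |pd 1 v₂ x - pd I v₁ x| ≤ M)
    (hdiff : ∫ x in Ω, ((v₁ x - a₁ x) ^ 2 + (v₂ x - a₂ x) ^ 2) ≤ M)
    (hbd : ∫ s in (0 : ℝ)..L, (|a₁ (γ s)| + |a₂ (γ s)| + |v₁ (γ s)| + |v₂ (γ s)|) ≤ M)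
    (hN : ∀ x, ‖P x‖ ≤ N) (hη : 0 < η) :
    ∫ x in Ω, ((pd 1 P x + I * pd I P x).re * v₁ x + (pd 1 P x + I * pd I P x).im * v₂ x) ≤
      3 * N * M + M / η + η * ∫ x in Ω, gradSq P x := by
  have hN0 : 0 ≤ N := (norm_nonneg _).trans (hN 0)
  have hp := hP.re'
  have hq := hP.im'
  set p : ℂ → ℝ := fun x => (P x).re with hpdef
  set q : ℂ → ℝ := fun x => (P x).im with hqdef
  have hpN : ∀ x, |p x| ≤ N := fun x => (abs_re_le_norm _).trans (hN x)
  have hqN : ∀ x, |q x| ≤ N := fun x => (abs_im_le_norm _).trans (hN x)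
  have I1 := H.ibp (fun x => p x * a₁ x) (fun x => p x * a₂ x) (hp.mul ha₁) (hp.mul ha₂)
  have I2 := H.ibp (fun x => q x * v₂ x) (fun x => q x * (-v₁ x)) (hq.mul hv₂) (hq.mul hv₁.neg)
  have hneg : ∀ x, pd I (fun x => -v₁ x) x = -pd I v₁ x := by
    intro x; unfold pd; rw [fderiv_fun_neg]; rfl
  simp only [pd_mul hp ha₁, pd_mul hp ha₂, pd_mul hq hv₂, pd_mul hq hv₁.neg, hneg] at I1 I2
  have c1 := (hp.pd 1).continuous
  have c2 := (hp.pd I).continuous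
  have c3 := (hq.pd 1).continuous
  have c4 := (hq.pd I).continuous
  have c5 := (ha₁.pd 1).continuous
  have c6 := (ha₂.pd I).continuous
  have c7 := (hv₂.pd 1).continuous
  have c8 := (hv₁.pd I).continuous
  have b1 := ha₁.continuous
  have b2 := ha₂.continuous
  have b3 := hv₁.continuous
  have b4 := hv₂.continuous
  have b5 := hp.continuous
  have b6 := hq.continuous
  have hγc := H.continuous
  have hnc := H.continuous_n
  have hgc := (contDiff_gradSq hP).continuous
  have hnre : ∀ s, |(n s).re| ≤ 1 := fun s => by
    have := H.unit s; exact abs_le_one_iff_mul_self_le_one.2 (by nlinarith [sq_nonneg (n s).im])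
  have hnim : ∀ s, |(n s).im| ≤ 1 := fun s => by
    have := H.unit s; exact abs_le_one_iff_mul_self_le_one.2 (by nlinarith [sq_nonneg (n s).re])
  have B : (∫ s in (0 : ℝ)..L, (p (γ s) * a₁ (γ s) * (n s).re + p (γ s) * a₂ (γ s) * (n s).im)) +
      ∫ s in (0 : ℝ)..L, (q (γ s) * v₂ (γ s) * (n s).re + q (γ s) * -v₁ (γ s) * (n s).im) ≤
      N * M := by
    rw [← intervalIntegral.integral_add (Continuous.intervalIntegrable (by fun_prop) _ _)
      (Continuous.intervalIntegrable (by fun_prop) _ _)]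
    refine le_trans ?_ (mul_le_mul_of_nonneg_left hbd hN0)
    rw [← intervalIntegral.integral_const_mul]
    refine intervalIntegral.integral_mono_on H.Lpos.le
      (Continuous.intervalIntegrable (by fun_prop) _ _)
      (Continuous.intervalIntegrable (by fun_prop) _ _) fun s _ => ?_
    have t : ∀ a b d : ℝ, |a| ≤ N → |d| ≤ 1 → a * b * d ≤ N * |b| := by
      intro a b d ha hd
      refine (le_abs_self _).trans ?_
      rw [abs_mul, abs_mul]
      refine (mul_le_of_le_one_right (by positivity) hd).trans ?_
      exact mul_le_mul_of_nonneg_right ha (abs_nonneg _)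
    have t1 := t _ (a₁ (γ s)) _ (hpN (γ s)) (hnre s)
    have t2 := t _ (a₂ (γ s)) _ (hpN (γ s)) (hnim s)
    have t3 := t _ (v₂ (γ s)) _ (hqN (γ s)) (hnre s)
    have t4 := t _ (-v₁ (γ s)) _ (hqN (γ s)) (hnim s)
    rw [abs_neg] at t4
    linarith
  have D1 : ∫ x in Ω, (-(p x * (pd 1 a₁ x + pd I a₂ x))) ≤ N * M := by
    refine le_trans ?_ (mul_le_mul_of_nonneg_left hdiv hN0)
    rw [← integral_const_mul]
    refine H.setIntegral_mono (by fun_prop) (by fun_prop) fun x _ => ?_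
    refine (neg_le_abs _).trans ?_
    rw [abs_mul]
    exact mul_le_mul_of_nonneg_right (hpN x) (abs_nonneg _)
  have D2 : ∫ x in Ω, (-(q x * (pd 1 v₂ x - pd I v₁ x))) ≤ N * M := by
    refine le_trans ?_ (mul_le_mul_of_nonneg_left hcurl hN0)
    rw [← integral_const_mul]
    refine H.setIntegral_mono (by fun_prop) (by fun_prop) fun x _ => ?_
    refine (neg_le_abs _).trans ?_
    rw [abs_mul]
    exact mul_le_mul_of_nonneg_right (hqN x) (abs_nonneg _)
  have D3 : ∫ x in Ω, ((v₁ x - a₁ x) * pd 1 p x + (v₂ x - a₂ x) * pd I p x) ≤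
      M / η + η * ∫ x in Ω, gradSq P x := by
    have : M / η + η * ∫ x in Ω, gradSq P x ≥
        ∫ x in Ω, (η⁻¹ * ((v₁ x - a₁ x) ^ 2 + (v₂ x - a₂ x) ^ 2) + η * gradSq P x) := by
      rw [integral_add (H.integrableOn (by fun_prop)) (H.integrableOn (by fun_prop)),
        integral_const_mul, integral_const_mul, div_eq_inv_mul]
      have := mul_le_mul_of_nonneg_left hdiff (inv_nonneg.2 hη.le)
      linarith
    refine le_trans ?_ this
    refine H.setIntegral_mono (by fun_prop) (by fun_prop) fun x _ => ?_
    have hg := gradSq_eq hP x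
    have y : ∀ a b : ℝ, a * b ≤ η⁻¹ * a ^ 2 + η * b ^ 2 := by
      intro a b
      have : η⁻¹ * a ^ 2 + η * b ^ 2 - a * b = η⁻¹ * ((a - η * b / 2) ^ 2 + 3 / 4 * (η * b) ^ 2) := by
        field_simp
        ring
      have h2 : 0 ≤ η⁻¹ * ((a - η * b / 2) ^ 2 + 3 / 4 * (η * b) ^ 2) := by positivity
      linarith
    have y1 := y (v₁ x - a₁ x) (pd 1 p x)
    have y2 := y (v₂ x - a₂ x) (pd I p x)
    have y3 : 0 ≤ η * (pd 1 q x ^ 2 + pd I q x ^ 2) := by positivity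
    rw [hg]
    simp only [hpdef, hqdef] at y1 y2 y3 ⊢
    linarith
  have split : ∫ x in Ω, ((pd 1 P x + I * pd I P x).re * v₁ x +
        (pd 1 P x + I * pd I P x).im * v₂ x) =
      (∫ x in Ω, (p x * pd 1 a₁ x + a₁ x * pd 1 p x + (p x * pd I a₂ x + a₂ x * pd I p x))) +
      (∫ x in Ω, (q x * pd 1 v₂ x + v₂ x * pd 1 q x + (q x * -pd I v₁ x + -v₁ x * pd I q x))) +
      (∫ x in Ω, (-(p x * (pd 1 a₁ x + pd I a₂ x)))) +
      (∫ x in Ω, (-(q x * (pd 1 v₂ x - pd I v₁ x)))) +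
      ∫ x in Ω, ((v₁ x - a₁ x) * pd 1 p x + (v₂ x - a₂ x) * pd I p x) := by
    rw [← integral_add (H.integrableOn (by fun_prop)) (H.integrableOn (by fun_prop)),
      ← integral_add (H.integrableOn (by fun_prop)) (H.integrableOn (by fun_prop)),
      ← integral_add (H.integrableOn (by fun_prop)) (H.integrableOn (by fun_prop)),
      ← integral_add (H.integrableOn (by fun_prop)) (H.integrableOn (by fun_prop))]
    congr 1
    ext x
    have e1 : pd 1 p x = (pd 1 P x).re := pd_re hP 1 x
    have e2 : pd I p x = (pd I P x).re := pd_re hP I x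
    have e3 : pd 1 q x = (pd 1 P x).im := pd_im hP 1 x
    have e4 : pd I q x = (pd I P x).im := pd_im hP I x
    simp only [e1, e2, e3, e4, add_re, add_im, mul_re, mul_im, I_re, I_im]
    ring
  rw [split, I1, I2]
  linarith

set_option maxHeartbeats 1600000 in
lemma exists_div_curl_rpow_bound_cutoff (H : StarDomain Ω γ n L c σ) {p M : ℝ} (hp1 : 1 < p)
    (hp2 : p < 2) (hM : 0 ≤ M) :
    ∃ C, ∀ (a₁ a₂ v₁ v₂ χ : ℂ → ℝ), ContDiff ℝ (⊤ : ℕ∞) a₁ → ContDiff ℝ (⊤ : ℕ∞) a₂ →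
      ContDiff ℝ (⊤ : ℕ∞) v₁ → ContDiff ℝ (⊤ : ℕ∞) v₂ →
      ∫ x in Ω, |pd 1 a₁ x + pd I a₂ x| ≤ M →
      ∫ x in Ω, |pd 1 v₂ x - pd I v₁ x| ≤ M →
      ∫ x in Ω, ((v₁ x - a₁ x) ^ 2 + (v₂ x - a₂ x) ^ 2) ≤ M →
      ∫ s in (0 : ℝ)..L, (|a₁ (γ s)| + |a₂ (γ s)| + |v₁ (γ s)| + |v₂ (γ s)|) ≤ M →
      ContDiff ℝ (⊤ : ℕ∞) χ → (∀ x, 0 ≤ χ x) → (∀ x, χ x ≤ 1) → (∀ x, x ∉ Ω → χ x = 0) →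
      ∫ x in Ω, χ x * √(1 + v₁ x ^ 2 + v₂ x ^ 2) ^ p ≤ C := by
  obtain ⟨h, hhi, hh0, hh⟩ := exists_integrable_bound_inv_norm_rpow (by linarith) hp2
  obtain ⟨K, hK0, hK⟩ := exists_gradSq_bound_of_dbar H.isOpen H.bdd
  set V : ℝ := volume.real Ω with hV
  set l : ℝ := (4 * (4 * M + K + 1))⁻¹ with hl
  have hl0 : 0 < l := by positivity
  set Cl : ℝ := l ^ (1 - p) with hCl
  have hCl0 : 0 < Cl := Real.rpow_pos_of_pos hl0 _
  have young : ∀ m k : ℝ, 1 ≤ m → 0 ≤ k → k * m ^ (p - 1) ≤ l * m ^ p + Cl * k ^ p := by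
    intro m k hm hk
    have hm0 : 0 < m := by linarith
    have hmp : 0 ≤ m ^ (p - 1) := by positivity
    have hkp : 0 ≤ k ^ p := by positivity
    by_cases hkm : k ≤ l * m
    · have h1 := mul_le_mul_of_nonneg_right hkm hmp
      have h2 : l * m * m ^ (p - 1) = l * m ^ p := by
        rw [Real.rpow_sub_one hm0.ne']; field_simp
      nlinarith [mul_nonneg hCl0.le hkp]
    · push Not at hkm
      have hk0 : 0 < k := lt_of_le_of_lt (by positivity) hkm
      have h1 : m ≤ k / l := by rw [le_div_iff₀ hl0]; linarith
      have h2 : m ^ (p - 1) ≤ (k / l) ^ (p - 1) := Real.rpow_le_rpow hm0.le h1 (by linarith)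
      have h3 : k * (k / l) ^ (p - 1) = Cl * k ^ p := by
        rw [Real.div_rpow hk0.le hl0.le, hCl, show 1 - p = -(p - 1) by ring,
          Real.rpow_neg hl0.le, Real.rpow_sub_one hk0.ne']
        field_simp
      have h4 := mul_le_mul_of_nonneg_left h2 hk0.le
      have h5 : 0 ≤ l * m ^ p := by positivity
      linarith
  set D : ℝ := Cl * (V + ∫ t, h t) with hD
  have hV0 : 0 ≤ V := measureReal_nonneg
  have hhI : 0 ≤ ∫ t, h t := integral_nonneg hh0
  have hD0 : 0 ≤ D := by positivity
  have hfin : volume Ω ≠ ⊤ := H.bdd.measure_lt_top.ne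
  refine ⟨2 * (V + M + (M + K) ^ 2 + (4 * M + K) * D), ?_⟩
  intro a₁ a₂ v₁ v₂ χ ha₁ ha₂ hv₁ hv₂ hdiv hcurl hdiff hbd hχ hχ0 hχ1 hχΩ
  set m : ℂ → ℝ := fun x => √(1 + v₁ x ^ 2 + v₂ x ^ 2) with hm
  have hmsq : ∀ x, m x ^ 2 = 1 + v₁ x ^ 2 + v₂ x ^ 2 := fun x => Real.sq_sqrt (by positivity)
  have hm1 : ∀ x, 1 ≤ m x := fun x => Real.one_le_sqrt.2 (by nlinarith [sq_nonneg (v₁ x), sq_nonneg (v₂ x)])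
  have hm0 : ∀ x, 0 < m x := fun x => by linarith [hm1 x]
  have hmS : ContDiff ℝ (⊤ : ℕ∞) m :=
    ((contDiff_const.add (hv₁.pow 2)).add (hv₂.pow 2)).sqrt fun x => by positivity
  have hmp : ∀ r : ℝ, ContDiff ℝ (⊤ : ℕ∞) fun x => m x ^ r := fun r =>
    hmS.rpow_const_of_ne fun x => (hm0 x).ne'
  have hχc : HasCompactSupport χ := HasCompactSupport.intro H.isCompact fun x hx =>
    hχΩ x fun h => hx (subset_closure h)
  set w : ℂ → ℝ := fun x => χ x * m x ^ (p - 2) with hw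
  have hwS : ContDiff ℝ (⊤ : ℕ∞) w := hχ.mul (hmp _)
  set f : ℂ → ℂ := fun x => (w x : ℂ) * ((v₁ x : ℂ) + v₂ x * I) with hf
  have hfS : ContDiff ℝ (⊤ : ℕ∞) f := by
    have o : ∀ g : ℂ → ℝ, ContDiff ℝ (⊤ : ℕ∞) g → ContDiff ℝ (⊤ : ℕ∞) fun x => (g x : ℂ) :=
      fun g hg => Complex.ofRealCLM.contDiff.comp hg
    exact (o w hwS).mul ((o _ hv₁).add ((o _ hv₂).mul contDiff_const))
  have hfc : HasCompactSupport f := HasCompactSupport.intro H.isCompact fun x hx => by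
    simp [hf, hw, hχΩ x fun h => hx (subset_closure h)]
  have hfn : ∀ x, ‖f x‖ ≤ χ x * m x ^ (p - 1) := by
    intro x
    have h1 : ‖(v₁ x : ℂ) + v₂ x * I‖ ≤ m x := by
      rw [← abs_of_pos (hm0 x), ← abs_of_nonneg (norm_nonneg ((v₁ x : ℂ) + v₂ x * I)), ← sq_le_sq,
        hmsq, ← normSq_eq_norm_sq, normSq_add_mul_I]
      linarith
    have hw0 : 0 ≤ w x := mul_nonneg (hχ0 x) (Real.rpow_nonneg (hm0 x).le _)
    rw [hf, norm_mul, norm_real, Real.norm_of_nonneg hw0]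
    refine (mul_le_mul_of_nonneg_left h1 hw0).trans (le_of_eq ?_)
    simp only [hw]
    rw [show p - 1 = (p - 2) + 1 by ring, Real.rpow_add_one (hm0 x).ne']
    ring
  obtain ⟨P, hP, hPf, hPn⟩ := exists_dbar_primitive hfS hfc
  have cχ := hχ.continuous
  have cmp := (hmp p).continuous
  have hYi : Integrable fun x => χ x * m x ^ p :=
    Continuous.integrable_of_hasCompactSupport (by fun_prop) hχc.mul_right
  have hYeq : ∫ x in Ω, χ x * m x ^ p = ∫ x, χ x * m x ^ p :=
    setIntegral_eq_integral_of_forall_compl_eq_zero fun x hx => by rw [hχΩ x hx, zero_mul]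
  have hY0 : 0 ≤ ∫ x, χ x * m x ^ p :=
    integral_nonneg fun x => mul_nonneg (hχ0 x) (Real.rpow_nonneg (hm0 x).le _)
  rw [hYeq]
  have hN : ∀ x, ‖P x‖ ≤ l * (∫ x, χ x * m x ^ p) + D := by
    intro x
    refine (hPn x).trans ?_
    have hhx : Integrable fun t => h (x - t) := hhi.comp_sub_left x
    have hind : Integrable (Ω.indicator (1 : ℂ → ℝ)) :=
      (integrable_indicator_iff H.isOpen.measurableSet).2 (integrableOn_const hfin)
    have hi2 : Integrable fun t => Cl * (Ω.indicator 1 t + h (x - t)) :=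
      (hind.add hhx).const_mul Cl
    calc ∫ t, ‖x - t‖⁻¹ * ‖f t‖ ≤
          ∫ t, (l * (χ t * m t ^ p) + Cl * (Ω.indicator 1 t + h (x - t))) := by
          refine integral_mono_of_nonneg (Eventually.of_forall fun t => by positivity)
            ((hYi.const_mul l).add hi2) (Eventually.of_forall fun t => ?_)
          beta_reduce
          have h1 := young (m t) ‖x - t‖⁻¹ (hm1 t) (by positivity)
          have h2 := hh (x - t)
          have h3 := hfn t
          have h4 := hh0 (x - t)
          by_cases ht : t ∈ Ω
          · rw [indicator_of_mem ht]
            calc ‖x - t‖⁻¹ * ‖f t‖ ≤ ‖x - t‖⁻¹ * (χ t * m t ^ (p - 1)) :=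
                  mul_le_mul_of_nonneg_left h3 (by positivity)
              _ = χ t * (‖x - t‖⁻¹ * m t ^ (p - 1)) := by ring
              _ ≤ χ t * (l * m t ^ p + Cl * (1 + h (x - t))) := by
                  refine mul_le_mul_of_nonneg_left (h1.trans ?_) (hχ0 t)
                  linarith [mul_le_mul_of_nonneg_left h2 hCl0.le]
              _ ≤ l * (χ t * m t ^ p) + Cl * ((1 : ℂ → ℝ) t + h (x - t)) := by
                  have h5 : 0 ≤ Cl * (1 + h (x - t)) := by positivity
                  have h6 := mul_le_mul_of_nonneg_right (hχ1 t) h5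
                  simp only [Pi.one_apply]
                  linarith
          · have : f t = 0 := by simp [hf, hw, hχΩ t ht]
            rw [indicator_of_notMem ht, this, hχΩ t ht]
            simp only [norm_zero, mul_zero, zero_mul, zero_add]
            positivity
      _ = _ := by
          rw [integral_add (hYi.const_mul l) hi2, integral_const_mul,
            integral_const_mul, integral_add hind hhx, integral_indicator_one H.isOpen.measurableSet,
            integral_sub_left_eq_self]
  set Y : ℝ := ∫ x, χ x * m x ^ p with hYdef
  set N : ℝ := l * Y + D with hNdef
  have hN0 : 0 ≤ N := by positivity
  have hfsq : ∫ x, ‖f x‖ ^ 2 ≤ Y := by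
    refine integral_mono_of_nonneg (Eventually.of_forall fun x => by positivity) hYi
      (Eventually.of_forall fun x => ?_)
    simp only
    refine (pow_le_pow_left₀ (norm_nonneg _) (hfn x) 2).trans ?_
    rw [mul_pow, ← Real.rpow_mul_natCast (hm0 x).le]
    refine mul_le_mul ?_ (Real.rpow_le_rpow_of_exponent_le (hm1 x) (by push_cast; linarith))
      (Real.rpow_nonneg (hm0 x).le _) (hχ0 x)
    nlinarith [hχ0 x, hχ1 x]
  have hG := hK P f N hP hfS.continuous hfc hPf hN
  set η : ℝ := (1 + √Y + N)⁻¹ with hη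
  have hη0 : 0 < η := by positivity
  have hmain := H.integral_mul_dbar_le ha₁ ha₂ hv₁ hv₂ hP hdiv hcurl hdiff hbd hN hη0
  have hlow : Y - V ≤ ∫ x in Ω, ((pd 1 P x + I * pd I P x).re * v₁ x +
      (pd 1 P x + I * pd I P x).im * v₂ x) := by
    have e1 : Y - V = ∫ x in Ω, (χ x * m x ^ p - 1) := by
      rw [integral_sub (H.integrableOn (by fun_prop)) (integrableOn_const hfin), hYeq,
        setIntegral_const]
      simp [hV]
    rw [e1]
    simp only [hPf]
    have cw := hwS.continuous
    have cf := hfS.continuous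
    have cv1 := hv₁.continuous
    have cv2 := hv₂.continuous
    refine H.setIntegral_mono (by fun_prop) (by fun_prop) fun x _ => ?_
    have r1 : (f x).re = w x * v₁ x := by simp [hf]
    have r2 : (f x).im = w x * v₂ x := by simp [hf]
    rw [r1, r2]
    have e2 : w x * v₁ x * v₁ x + w x * v₂ x * v₂ x = χ x * m x ^ p - w x := by
      have : m x ^ p = m x ^ (p - 2) * m x ^ 2 := by
        rw [← Real.rpow_natCast, ← Real.rpow_add (hm0 x)]
        norm_num
      rw [this, hmsq]
      simp only [hw]
      ring
    have e3 : w x ≤ 1 := by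
      have : m x ^ (p - 2) ≤ 1 := Real.rpow_le_one_of_one_le_of_nonpos (hm1 x) (by linarith)
      exact mul_le_one₀ (hχ1 x) (Real.rpow_nonneg (hm0 x).le _) this
    linarith
  clear_value η N Y
  have s0 : 0 ≤ √Y := Real.sqrt_nonneg _
  have ssq : √Y ^ 2 = Y := Real.sq_sqrt hY0
  have hG2 : η * ∫ x in Ω, gradSq P x ≤ K * (√Y + N) := by
    have h1 : ∫ x in Ω, gradSq P x ≤ K * ((√Y + N) * (1 + √Y + N)) := by
      refine hG.trans (mul_le_mul_of_nonneg_left ?_ hK0)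
      nlinarith [mul_nonneg s0 hN0]
    have h2 := mul_le_mul_of_nonneg_left h1 hη0.le
    have h3 : η * (K * ((√Y + N) * (1 + √Y + N))) = K * (√Y + N) := by
      rw [hη]
      have : 1 + √Y + N ≠ 0 := by positivity
      field_simp
    linarith
  have hMη : M / η = M * (1 + √Y + N) := by rw [hη, div_inv_eq_mul]
  have h5 : Y ≤ V + M + (M + K) * √Y + (4 * M + K) * N := by
    rw [hMη] at hmain
    linarith
  have h6 : (4 * M + K) * l ≤ 1 / 4 := by
    rw [hl, mul_inv, ← mul_assoc, mul_comm, ← mul_assoc, ← div_eq_inv_mul]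
    rw [div_mul_eq_mul_div, div_le_iff₀ (by positivity)]
    linarith
  have h7 := mul_le_mul_of_nonneg_right h6 hY0
  have h8 : (M + K) * √Y ≤ Y / 4 + (M + K) ^ 2 := by
    nlinarith [sq_nonneg (√Y / 2 - (M + K))]
  have h9 : (4 * M + K) * N = (4 * M + K) * l * Y + (4 * M + K) * D := by rw [hNdef]; ring
  linarith

lemma exists_div_curl_rpow_bound (H : StarDomain Ω γ n L c σ) {p M : ℝ} (hp1 : 1 < p)
    (hp2 : p < 2) (hM : 0 ≤ M) :
    ∃ C, ∀ (a₁ a₂ v₁ v₂ : ℂ → ℝ), ContDiff ℝ (⊤ : ℕ∞) a₁ → ContDiff ℝ (⊤ : ℕ∞) a₂ →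
      ContDiff ℝ (⊤ : ℕ∞) v₁ → ContDiff ℝ (⊤ : ℕ∞) v₂ →
      ∫ x in Ω, |pd 1 a₁ x + pd I a₂ x| ≤ M →
      ∫ x in Ω, |pd 1 v₂ x - pd I v₁ x| ≤ M →
      ∫ x in Ω, ((v₁ x - a₁ x) ^ 2 + (v₂ x - a₂ x) ^ 2) ≤ M →
      ∫ s in (0 : ℝ)..L, (|a₁ (γ s)| + |a₂ (γ s)| + |v₁ (γ s)| + |v₂ (γ s)|) ≤ M →
      ∫ x in Ω, √(1 + v₁ x ^ 2 + v₂ x ^ 2) ^ p ≤ C := by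
  obtain ⟨C, hC⟩ := H.exists_div_curl_rpow_bound_cutoff hp1 hp2 hM
  refine ⟨C + 1, fun a₁ a₂ v₁ v₂ ha₁ ha₂ hv₁ hv₂ hdiv hcurl hdiff hbd => ?_⟩
  set m : ℂ → ℝ := fun x => √(1 + v₁ x ^ 2 + v₂ x ^ 2) ^ p with hm
  have cv1 := hv₁.continuous
  have cv2 := hv₂.continuous
  have hmc : Continuous m := by
    rw [hm]
    exact (by fun_prop : Continuous fun x => √(1 + v₁ x ^ 2 + v₂ x ^ 2)).rpow_const
      fun x => Or.inr (by linarith)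
  have hm0 : ∀ x, 0 ≤ m x := fun x => Real.rpow_nonneg (Real.sqrt_nonneg _) _
  obtain ⟨B, hB⟩ := H.isCompact.exists_bound_of_continuousOn hmc.continuousOn
  set B' : ℝ := max B 1 with hB'
  have hB'0 : 0 < B' := by positivity
  have hfin : volume Ω ≠ ⊤ := H.bdd.measure_lt_top.ne
  obtain ⟨K, hKΩ, hKc, hKv⟩ := H.isOpen.measurableSet.exists_isCompact_sdiff_lt hfin
    (ε := ENNReal.ofReal (1 / B')) (by
      rw [ne_eq, ENNReal.ofReal_eq_zero, not_le]; positivity)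
  obtain ⟨χ, h0, h1, hχ⟩ := exists_contMDiffMap_zero_one_of_isClosed (n := (⊤ : ℕ∞))
    (modelWithCornersSelf ℝ ℂ)
    H.isOpen.isClosed_compl hKc.isClosed (disjoint_compl_left_iff_subset.2 hKΩ)
  have hχs : ContDiff ℝ (⊤ : ℕ∞) χ := χ.contMDiff.contDiff
  have hC' := hC a₁ a₂ v₁ v₂ χ ha₁ ha₂ hv₁ hv₂ hdiv hcurl hdiff hbd hχs (fun x => (hχ x).1)
    (fun x => (hχ x).2) (fun x hx => h0 hx)
  have cχ : Continuous χ := hχs.continuous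
  have hsplit : ∫ x in Ω, m x ≤ (∫ x in Ω, χ x * m x) + ∫ x in Ω, (Ω \ K).indicator (fun _ => B') x := by
    have hmeas : MeasurableSet (Ω \ K) := H.isOpen.measurableSet.diff hKc.measurableSet
    have hi : IntegrableOn ((Ω \ K).indicator fun _ => B') Ω :=
      (integrableOn_const hfin).indicator hmeas
    rw [← integral_add (H.integrableOn (by fun_prop)) hi]
    refine setIntegral_mono_on (H.integrableOn hmc) ((H.integrableOn (by fun_prop)).add hi)
      H.isOpen.measurableSet fun x hx => ?_
    by_cases hxK : x ∈ K
    · have : χ x = 1 := h1 hxK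
      rw [indicator_of_notMem (fun h => h.2 hxK), this]
      simp
    · rw [indicator_of_mem (show x ∈ Ω \ K from ⟨hx, hxK⟩)]
      have := hB x (subset_closure hx)
      have h3 := (le_abs_self _).trans this
      have h4 := mul_nonneg (hχ x).1 (hm0 x)
      have h5 : B ≤ B' := le_max_left _ _
      linarith
  have hsmall : ∫ x in Ω, (Ω \ K).indicator (fun _ => B') x ≤ 1 := by
    have hmeas : MeasurableSet (Ω \ K) := H.isOpen.measurableSet.diff hKc.measurableSet
    rw [setIntegral_indicator hmeas, inter_eq_right.2 sdiff_subset, setIntegral_const, smul_eq_mul]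
    have : volume.real (Ω \ K) ≤ 1 / B' := by
      rw [measureReal_def]
      exact ENNReal.toReal_le_of_le_ofReal (by positivity) hKv.le
    calc _ ≤ 1 / B' * B' := mul_le_mul_of_nonneg_right this hB'0.le
      _ = 1 := by field_simp
  linarith

end StarDomain

/-! ### Radial coordinates given by a star-shaped curve -/

/-- The cross product `z × w` in the plane. -/
def cross (z w : ℂ) : ℝ := z.re * w.im - z.im * w.re

/-- Radial coordinates `(t, s) ↦ t γ(s)` associated with a curve `γ`. -/
def radialMap (γ : ℝ → ℂ) (z : ℂ) : ℂ := (z.re : ℂ) * γ z.im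

/-- The derivative of `radialMap γ` at `z`. -/
def radialDeriv (γ : ℝ → ℂ) (z : ℂ) : ℂ →L[ℝ] ℂ :=
  reCLM.smulRight (γ z.im) + imCLM.smulRight ((z.re : ℂ) * deriv γ z.im)

lemma radialDeriv_apply (γ : ℝ → ℂ) (z w : ℂ) :
    radialDeriv γ z w = w.re * γ z.im + w.im * ((z.re : ℂ) * deriv γ z.im) := by
  simp [radialDeriv]

lemma det_radialDeriv (γ : ℝ → ℂ) (z : ℂ) :
    (radialDeriv γ z).det = z.re * cross (γ z.im) (deriv γ z.im) := by
  rw [ContinuousLinearMap.det, ← LinearMap.det_toMatrix Complex.basisOneI, Matrix.det_fin_two]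
  simp [LinearMap.toMatrix_apply, radialDeriv_apply, cross]
  ring

lemma contDiff_radialMap {γ : ℝ → ℂ} (hγ : ContDiff ℝ (⊤ : ℕ∞) γ) :
    ContDiff ℝ (⊤ : ℕ∞) (radialMap γ) := by
  unfold radialMap
  exact (ofRealCLM.contDiff.comp reCLM.contDiff).mul (hγ.comp imCLM.contDiff)

lemma hasFDerivAt_radialMap {γ : ℝ → ℂ} (hγ : ContDiff ℝ (⊤ : ℕ∞) γ) (z : ℂ) :
    HasFDerivAt (radialMap γ) (radialDeriv γ z) z := by
  have h1 : HasFDerivAt (fun z : ℂ => (z.re : ℂ)) (ofRealCLM ∘L reCLM) z :=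
    (ofRealCLM ∘L reCLM).hasFDerivAt
  have h2 : HasFDerivAt (fun z : ℂ => γ z.im) (imCLM.smulRight (deriv γ z.im)) z := by
    have h := ((hγ.differentiable (by simp)) z.im).hasDerivAt.hasFDerivAt.comp z
      (imCLM.hasFDerivAt (x := z))
    refine h.congr_fderiv ?_
    ext
    simp
  refine (h1.mul h2).congr_fderiv ?_
  apply ContinuousLinearMap.ext
  intro w
  simp [radialDeriv_apply]
  ring

/-- A smooth simple closed curve whose position vector is nowhere tangent to it. -/
structure StarCurve (γ : ℝ → ℂ) (L : ℝ) : Prop where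
  smooth : ContDiff ℝ (⊤ : ℕ∞) γ
  Lpos : 0 < L
  per : Function.Periodic γ L
  inj : ∀ s t : ℝ, γ s = γ t → ∃ k : ℤ, s - t = L * k
  transversal : ∀ s, cross (γ s) (deriv γ s) ≠ 0

namespace StarCurve
variable {γ : ℝ → ℂ} {L : ℝ}

lemma ne_zero (H : StarCurve γ L) (s : ℝ) : γ s ≠ 0 := fun h =>
  H.transversal s (by simp [cross, h])

lemma hasStrictFDerivAt (H : StarCurve γ L) {z : ℂ} (hz : 0 < z.re) :
    ∃ e : ℂ ≃L[ℝ] ℂ, HasStrictFDerivAt (radialMap γ) (e : ℂ →L[ℝ] ℂ) z := by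
  have hdet : (radialDeriv γ z).det ≠ 0 := by
    rw [det_radialDeriv]; exact mul_ne_zero hz.ne' (H.transversal _)
  refine ⟨(radialDeriv γ z).toContinuousLinearEquivOfDetNeZero hdet, ?_⟩
  rw [ContinuousLinearMap.coe_toContinuousLinearEquivOfDetNeZero]
  exact (contDiff_radialMap H.smooth).contDiffAt.hasStrictFDerivAt'
    (hasFDerivAt_radialMap H.smooth z) (by simp)

lemma isOpen_image (H : StarCurve γ L) {U : Set ℂ} (hU : IsOpen U) (h : ∀ z ∈ U, 0 < z.re) :
    IsOpen (radialMap γ '' U) := by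
  rw [isOpen_iff_mem_nhds]
  rintro _ ⟨z, hz, rfl⟩
  obtain ⟨e, he⟩ := H.hasStrictFDerivAt (h z hz)
  rw [← he.map_nhds_eq_of_equiv]
  exact image_mem_map (hU.mem_nhds hz)

lemma eventually_injective (H : StarCurve γ L) {z : ℂ} (hz : 0 < z.re) :
    ∃ U ∈ 𝓝 z, InjOn (radialMap γ) U := by
  obtain ⟨e, he⟩ := H.hasStrictFDerivAt hz
  refine ⟨_, he.eventually_left_inverse, fun x hx y hy hxy => ?_⟩
  simp only [mem_ofPred_eq] at hx hy
  rw [← hx, hxy, hy]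

lemma exists_bounds (H : StarCurve γ L) : ∃ m > 0, ∃ s₀, ‖γ s₀‖ = m ∧ ∃ B, ∀ s, m ≤ ‖γ s‖ ∧ ‖γ s‖ ≤ B := by
  have hc : Continuous γ := H.smooth.continuous
  have hK : IsCompact (range γ) := H.per.compact_of_continuous H.Lpos.ne' hc
  obtain ⟨_, ⟨s₀, rfl⟩, h0⟩ := hK.exists_isMinOn (range_nonempty γ) continuous_norm.continuousOn
  obtain ⟨B, hB⟩ := hK.isBounded.exists_norm_le
  exact ⟨_, norm_pos_iff.2 (H.ne_zero s₀), s₀, rfl, B,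
    fun s => ⟨isMinOn_iff.1 h0 _ ⟨s, rfl⟩, hB _ ⟨s, rfl⟩⟩⟩

lemma exists_mem_Ioc (H : StarCurve γ L) (s : ℝ) : ∃ s' ∈ Ioc 0 L, γ s = γ s' := by
  obtain ⟨y, hy, h⟩ := H.per.exists_mem_Ioc H.Lpos s 0
  exact ⟨y, by simpa using hy, h⟩

/-- No ray from the origin meets the curve twice. -/
lemma eq_one_of_eq_mul (H : StarCurve γ L) {t s s' : ℝ} (ht : 1 ≤ t) (h : γ s = t * γ s') :
    t = 1 := by
  obtain ⟨m, hm, s₀, hs₀, B, hB⟩ := H.exists_bounds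
  set A : Set ℝ := {s | ∃ t : ℝ, 1 < t ∧ ∃ s', γ s = t * γ s'} with hA
  have hc : Continuous γ := H.smooth.continuous
  have hopen : IsOpen A := by
    have : A = γ ⁻¹' (radialMap γ '' {z | 1 < z.re}) := by
      ext s
      constructor
      · rintro ⟨t, ht, s', h⟩
        exact ⟨⟨t, s'⟩, ht, h.symm⟩
      · rintro ⟨z, hz, h⟩
        exact ⟨z.re, hz, z.im, h.symm⟩
    rw [this]
    exact (H.isOpen_image (isOpen_lt continuous_const continuous_re)
      fun z hz => lt_trans one_pos hz).preimage hc
  have hclosed : IsClosed A := by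
    apply isClosed_of_closure_subset
    intro s hs
    obtain ⟨x, hxA, hx⟩ := mem_closure_iff_seq_limit.1 hs
    choose t ht s' hs' using hxA
    choose r hr hr' using fun k => H.exists_mem_Ioc (s' k)
    have htB : ∀ k, t k ≤ B / m := by
      intro k
      rw [le_div_iff₀ hm]
      have := congrArg norm (hs' k)
      rw [norm_mul, norm_real, Real.norm_of_nonneg (by linarith [ht k])] at this
      have h1 := (hB (x k)).2
      have h2 := (hB (s' k)).1
      nlinarith [ht k]
    have hK : IsCompact (Icc 1 (B / m) ×ˢ Icc 0 L) := isCompact_Icc.prod isCompact_Icc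
    obtain ⟨⟨t0, r0⟩, hmem, φ, hφ, hlim⟩ := hK.tendsto_subseq (x := fun k => (t k, r k))
      fun k => ⟨⟨(ht k).le, htB k⟩, Ioc_subset_Icc_self (hr k)⟩
    have hlt : Tendsto (fun k => t (φ k)) atTop (𝓝 t0) := (continuous_fst.tendsto _).comp hlim
    have hlr : Tendsto (fun k => r (φ k)) atTop (𝓝 r0) := (continuous_snd.tendsto _).comp hlim
    have hlx : Tendsto (fun k => x (φ k)) atTop (𝓝 s) := hx.comp hφ.tendsto_atTop
    have heq : γ s = t0 * γ r0 := by
      refine tendsto_nhds_unique ((hc.tendsto s).comp hlx) ?_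
      have : Tendsto (fun k => (t (φ k) : ℂ) * γ (r (φ k))) atTop (𝓝 (t0 * γ r0)) :=
        ((continuous_ofReal.tendsto _).comp hlt).mul ((hc.tendsto _).comp hlr)
      refine this.congr fun k => ?_
      simp only [Function.comp]
      rw [hs', ← hr']
    rcases (hmem.1.1 : 1 ≤ t0).eq_or_lt with h1 | h1
    · exfalso
      subst h1
      obtain ⟨k, hk⟩ := H.inj s r0 (by simpa using heq)
      obtain ⟨U, hU, hinj⟩ := H.eventually_injective (z := ⟨1, s⟩) (by simp)
      have hmk : ∀ {a b : ℕ → ℝ} {a0 b0 : ℝ}, Tendsto a atTop (𝓝 a0) → Tendsto b atTop (𝓝 b0) →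
          Tendsto (fun k => (⟨a k, b k⟩ : ℂ)) atTop (𝓝 ⟨a0, b0⟩) := by
        intro a b a0 b0 ha hb
        have := ((continuous_ofReal.tendsto _).comp ha).add
          (((continuous_ofReal.tendsto _).comp hb).mul_const I)
        rw [mk_eq_add_mul_I]
        exact this.congr fun k => (mk_eq_add_mul_I _ _).symm
      have e1 := (hmk (tendsto_const_nhds (x := (1 : ℝ))) hlx).eventually hU
      have hrs : Tendsto (fun i => r (φ i) + L * k) atTop (𝓝 s) := by
        have := hlr.add_const (L * k)
        rwa [show r0 + L * k = s by linarith] at this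
      have e2 := (hmk hlt hrs).eventually hU
      obtain ⟨i, hi1, hi2⟩ := (e1.and e2).exists
      have := hinj hi1 hi2 (by
        have hp : γ (r (φ i) + L * k) = γ (r (φ i)) := by
          rw [mul_comm]; exact H.per.int_mul k _
        simp only [radialMap, hp, ← hr', ofReal_one, one_mul]
        exact hs' _)
      have h2 := congrArg re this
      simp only at h2
      exact absurd h2 (ht (φ i)).ne
    · exact ⟨t0, h1, r0, heq⟩
  have hempty : A = ∅ := by
    rcases isClopen_iff.1 ⟨hclosed, hopen⟩ with h | h
    · exact h
    · exfalso
      obtain ⟨t, ht, s', hs'⟩ : s₀ ∈ A := h ▸ mem_univ _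
      have := congrArg norm hs'
      rw [norm_mul, norm_real, Real.norm_of_nonneg (by linarith), hs₀] at this
      nlinarith [(hB s').1]
  by_contra hne
  exact eq_empty_iff_forall_notMem.1 hempty s ⟨t, lt_of_le_of_ne ht (Ne.symm hne), s', h⟩

lemma surjOn (H : StarCurve γ L) : radialMap γ '' {z | 0 < z.re} = {0}ᶜ := by
  obtain ⟨m, hm, s₀, hs₀, B, hB⟩ := H.exists_bounds
  apply Subset.antisymm
  · rintro _ ⟨z, hz, rfl⟩
    exact mul_ne_zero (ofReal_ne_zero.2 (ne_of_gt hz)) (H.ne_zero _)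
  have hpre : IsPreconnected ({0}ᶜ : Set ℂ) :=
    (isConnected_compl_singleton_of_one_lt_rank (by rw [rank_real_complex]; norm_num) 0).2
  refine hpre.subset_of_closure_inter_subset
    (H.isOpen_image (isOpen_lt continuous_const continuous_re) fun z hz => hz) ?_ ?_
  · exact ⟨γ s₀, H.ne_zero _, ⟨1, s₀⟩, by simp, by simp [radialMap]⟩
  · rintro y ⟨hy, hy0⟩
    have hc := (contDiff_radialMap H.smooth).continuous
    set T := (‖y‖ + 1) / m
    have hK : IsCompact (radialMap γ '' (Icc 0 T ×ℂ Icc 0 L)) :=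
      (isCompact_Icc.reProdIm isCompact_Icc).image hc
    have hsub : radialMap γ '' {z | 0 < z.re} ∩ ball 0 (‖y‖ + 1) ⊆
        radialMap γ '' (Icc 0 T ×ℂ Icc 0 L) := by
      rintro _ ⟨⟨z, hz, rfl⟩, hb⟩
      obtain ⟨r, hr, hr'⟩ := H.exists_mem_Ioc z.im
      refine ⟨⟨z.re, r⟩, ⟨⟨le_of_lt hz, ?_⟩, Ioc_subset_Icc_self hr⟩, by simp [radialMap, hr']⟩
      rw [mem_ball_zero_iff, radialMap, norm_mul, norm_real, Real.norm_of_nonneg (le_of_lt hz)] at hb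
      simp only [T]
      rw [le_div_iff₀ hm]
      have hz' : 0 < z.re := hz
      nlinarith [(hB z.im).1]
    have hy' : y ∈ closure (radialMap γ '' {z | 0 < z.re} ∩ ball 0 (‖y‖ + 1)) :=
      inter_comm _ _ ▸ isOpen_ball.inter_closure ⟨by simp, hy⟩
    obtain ⟨z, hz, rfl⟩ := closure_minimal hsub hK.isClosed hy'
    refine ⟨z, lt_of_le_of_ne hz.1.1 fun h => hy0 ?_, rfl⟩
    simp [radialMap, ← h]

lemma image_eq (H : StarCurve γ L) {Ω : Set ℂ} (hΩ : IsOpen Ω) (hb : Bornology.IsBounded Ω)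
    (h0 : (0 : ℂ) ∈ Ω) (hfr : frontier Ω = range γ) :
    Ω = insert 0 (radialMap γ '' {z | 0 < z.re ∧ z.re < 1}) := by
  have hc := (contDiff_radialMap H.smooth).continuous
  have hdisj : ∀ z : ℂ, 0 < z.re → radialMap γ z ∈ frontier Ω → z.re = 1 := by
    intro z hz h
    rw [hfr] at h
    obtain ⟨s, hs⟩ := h
    rcases le_total 1 z.re with h1 | h1
    · exact H.eq_one_of_eq_mul h1 hs
    · have : γ z.im = ((z.re⁻¹ : ℝ) : ℂ) * γ s := by
        rw [hs, radialMap, ofReal_inv, inv_mul_cancel_left₀ (ofReal_ne_zero.2 hz.ne')]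
      exact inv_eq_one.1 (H.eq_one_of_eq_mul ((one_le_inv₀ hz).2 h1) this)
  have hfro : ∀ {x}, x ∈ closure Ω → x ∉ Ω → x ∈ frontier Ω := by
    intro x h h'
    rw [hΩ.frontier_eq]
    exact ⟨h, h'⟩
  have hsub : ∀ S : Set ℂ, Convex ℝ S → (∀ z ∈ S, 0 < z.re ∧ z.re ≠ 1) →
      (radialMap γ '' S ∩ Ω).Nonempty → radialMap γ '' S ⊆ Ω := by
    intro S hS hS1 hne
    refine (hS.isPreconnected.image _ hc.continuousOn).subset_of_closure_inter_subset hΩ hne ?_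
    rintro _ ⟨hx, z, hz, rfl⟩
    by_contra hx'
    exact (hS1 z hz).2 (hdisj z (hS1 z hz).1 (hfro hx hx'))
  have hin : radialMap γ '' {z | 0 < z.re ∧ z.re < 1} ⊆ Ω := by
    refine hsub _ ?_ (fun z hz => ⟨hz.1, hz.2.ne⟩) ?_
    · exact (convex_halfSpace_re_gt 0).inter (convex_halfSpace_re_lt 1)
    · have h1 : Tendsto (fun t : ℝ => (t : ℂ) * γ 0) (𝓝[>] 0) (𝓝 0) := by
        have : Continuous fun t : ℝ => (t : ℂ) * γ 0 := by fun_prop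
        simpa using (this.tendsto 0).mono_left nhdsWithin_le_nhds
      obtain ⟨t, ht, ht'⟩ := ((h1.eventually (hΩ.mem_nhds h0)).and
        (Ioo_mem_nhdsGT (zero_lt_one (α := ℝ)))).exists
      exact ⟨_, ⟨⟨t, 0⟩, ht', rfl⟩, ht⟩
  have hout : ¬ (radialMap γ '' {z | 1 < z.re} ∩ Ω).Nonempty := by
    intro hne
    have hE := hsub _ (convex_halfSpace_re_gt 1)
      (fun z hz => ⟨lt_trans one_pos hz, ne_of_gt hz⟩) hne
    obtain ⟨R, hR⟩ := hb.exists_norm_le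
    have hγ0 : 0 < ‖γ 0‖ := norm_pos_iff.2 (H.ne_zero 0)
    have hR0 : 0 ≤ R := by simpa using hR 0 h0
    have h2 : 1 < R / ‖γ 0‖ + 2 := by have : 0 ≤ R / ‖γ 0‖ := by positivity
                                      linarith
    have := hR _ (hE ⟨⟨R / ‖γ 0‖ + 2, 0⟩, h2, rfl⟩)
    rw [radialMap, norm_mul, norm_real, Real.norm_of_nonneg (by simp only; linarith)] at this
    simp only [add_mul] at this
    rw [div_mul_cancel₀ _ hγ0.ne'] at this
    linarith
  apply Subset.antisymm
  · intro x hx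
    by_cases hx0 : x = 0
    · exact Or.inl hx0
    obtain ⟨z, hz, rfl⟩ : x ∈ radialMap γ '' {z | 0 < z.re} := H.surjOn ▸ hx0
    refine Or.inr ⟨z, ⟨hz, ?_⟩, rfl⟩
    by_contra h
    rcases (not_lt.1 h).eq_or_lt with h1 | h1
    · have : radialMap γ z ∈ frontier Ω := by
        rw [hfr]; exact ⟨z.im, by simp [radialMap, ← h1]⟩
      rw [hΩ.frontier_eq] at this
      exact this.2 hx
    · exact hout ⟨_, ⟨z, h1, rfl⟩, hx⟩
  · exact insert_subset h0 hin

lemma injOn (H : StarCurve γ L) : InjOn (radialMap γ) (Ioo 0 1 ×ℂ Ioc 0 L) := by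
  have key : ∀ z w : ℂ, z ∈ Ioo (0 : ℝ) 1 ×ℂ Ioc 0 L → w ∈ Ioo (0 : ℝ) 1 ×ℂ Ioc 0 L → z.re ≤ w.re →
      radialMap γ z = radialMap γ w → z = w := by
    intro z w hz hw hle h
    have hz0 : 0 < z.re := hz.1.1
    have hzw : γ z.im = ((w.re / z.re : ℝ) : ℂ) * γ w.im := by
      have hz1 : (z.re : ℂ) ≠ 0 := ofReal_ne_zero.2 hz0.ne'
      simp only [radialMap] at h
      rw [ofReal_div, div_mul_eq_mul_div, ← h, mul_div_cancel_left₀ _ hz1]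
    have h1 := H.eq_one_of_eq_mul ((one_le_div hz0).2 hle) hzw
    have hre : w.re = z.re := by rwa [div_eq_one_iff_eq hz0.ne'] at h1
    rw [h1, ofReal_one, one_mul] at hzw
    obtain ⟨k, hk⟩ := H.inj _ _ hzw
    have hz2 := hz.2; have hw2 := hw.2
    have hL := H.Lpos
    have hk1 : k < 1 := by
      have : L * k < L * 1 := by linarith [hz2.1, hz2.2, hw2.1, hw2.2]
      exact_mod_cast lt_of_mul_lt_mul_left this hL.le
    have hk2 : -1 < k := by
      have : L * (-1) < L * k := by linarith [hz2.1, hz2.2, hw2.1, hw2.2]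
      exact_mod_cast lt_of_mul_lt_mul_left this hL.le
    have hk0 : k = 0 := by omega
    refine Complex.ext hre.symm ?_
    rw [hk0] at hk
    simp at hk
    linarith
  intro z hz w hw h
  rcases le_total z.re w.re with h1 | h1
  · exact key z w hz hw h1 h
  · exact (key w z hw hz h1 h.symm).symm

lemma image_eq_image_fundamental (H : StarCurve γ L) :
    radialMap γ '' {z | 0 < z.re ∧ z.re < 1} = radialMap γ '' (Ioo 0 1 ×ℂ Ioc 0 L) := by
  apply Subset.antisymm
  · rintro _ ⟨z, hz, rfl⟩
    obtain ⟨r, hr, hr'⟩ := H.exists_mem_Ioc z.im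
    exact ⟨⟨z.re, r⟩, ⟨hz, hr⟩, by simp [radialMap, hr']⟩
  · exact image_mono fun z hz => hz.1

lemma contDiff_deriv (H : StarCurve γ L) : ContDiff ℝ (⊤ : ℕ∞) (deriv γ) :=
  (contDiff_infty_iff_deriv.1 H.smooth).2

lemma per_deriv (H : StarCurve γ L) : Function.Periodic (deriv γ) L := fun s => by
  rw [← deriv_comp_add_const, funext H.per]

/-- The divergence theorem in radial coordinates, on the coordinate rectangle. -/
lemma integral_div_radial (H : StarCurve γ L) {X Y : ℂ → ℝ} (hX : ContDiff ℝ (⊤ : ℕ∞) X)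
    (hY : ContDiff ℝ (⊤ : ℕ∞) Y) :
    ∫ q in Icc ((0 : ℝ), (0 : ℝ)) (1, L), q.1 * cross (γ q.2) (deriv γ q.2) *
        (pd 1 X (q.1 * γ q.2) + pd I Y (q.1 * γ q.2)) =
      ∫ s in (0 : ℝ)..L, (X (γ s) * (deriv γ s).im - Y (γ s) * (deriv γ s).re) := by
  have hγ := H.smooth
  have hγ' := H.contDiff_deriv
  set P : ℝ × ℝ → ℂ := fun q => (q.1 : ℂ) * γ q.2 with hP
  set F : ℝ × ℝ → ℝ := fun q =>
    q.1 * (X (P q) * (deriv γ q.2).im - Y (P q) * (deriv γ q.2).re) with hF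
  set G : ℝ × ℝ → ℝ := fun q => -(X (P q) * (γ q.2).im - Y (P q) * (γ q.2).re) with hG
  have hPs : ContDiff ℝ (⊤ : ℕ∞) P :=
    (ofRealCLM.contDiff.comp contDiff_fst).mul (hγ.comp contDiff_snd)
  have hFs : ContDiff ℝ (⊤ : ℕ∞) F := by
    have hd : ContDiff ℝ (⊤ : ℕ∞) fun q : ℝ × ℝ => deriv γ q.2 := hγ'.comp contDiff_snd
    exact
    contDiff_fst.mul (((hX.comp hPs).mul (imCLM.contDiff.comp hd)).sub
      ((hY.comp hPs).mul (reCLM.contDiff.comp hd)))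
  have hGs : ContDiff ℝ (⊤ : ℕ∞) G := by
    have hd : ContDiff ℝ (⊤ : ℕ∞) fun q : ℝ × ℝ => γ q.2 := hγ.comp contDiff_snd
    exact
    (((hX.comp hPs).mul (imCLM.contDiff.comp hd)).sub
      ((hY.comp hPs).mul (reCLM.contDiff.comp hd))).neg
  have hXY : ∀ {Z : ℂ → ℝ}, ContDiff ℝ (⊤ : ℕ∞) Z → ∀ {p : ℝ → ℂ} {p' : ℂ} {r : ℝ},
      HasDerivAt p p' r → HasDerivAt (fun r => Z (p r))
        (p'.re * pd 1 Z (p r) + p'.im * pd I Z (p r)) r := by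
    intro Z hZ p p' r hp
    have := ((hZ.differentiable (by simp)) (p r)).hasFDerivAt.comp_hasDerivAt r hp
    rw [fderiv_eq_pd] at this
    exact this
  have hFd : ∀ t s, fderiv ℝ F (t, s) (1, 0) =
      (X (P (t, s)) * (deriv γ s).im - Y (P (t, s)) * (deriv γ s).re) +
      t * (((γ s).re * pd 1 X (P (t, s)) + (γ s).im * pd I X (P (t, s))) * (deriv γ s).im
        - ((γ s).re * pd 1 Y (P (t, s)) + (γ s).im * pd I Y (P (t, s))) * (deriv γ s).re) := by
    intro t s
    have h1 : HasDerivAt (fun r : ℝ => ((r, s) : ℝ × ℝ)) (1, 0) t :=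
      (hasDerivAt_id t).prodMk (hasDerivAt_const t s)
    have h2 := ((hFs.differentiable (by simp)) (t, s)).hasFDerivAt.comp_hasDerivAt t h1
    have hp : HasDerivAt (fun r : ℝ => P (r, s)) (γ s) t := by
      simpa using ((hasDerivAt_id t).ofReal_comp.mul_const (γ s))
    have h3 := (hasDerivAt_id t).mul (((hXY hX hp).mul_const (deriv γ s).im).sub
      ((hXY hY hp).mul_const (deriv γ s).re))
    refine (h2.unique h3).trans ?_
    simp
  have hGd : ∀ t s, fderiv ℝ G (t, s) (0, 1) =
      -((t * (deriv γ s).re * pd 1 X (P (t, s)) + t * (deriv γ s).im * pd I X (P (t, s)))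
          * (γ s).im + X (P (t, s)) * (deriv γ s).im
        - ((t * (deriv γ s).re * pd 1 Y (P (t, s)) + t * (deriv γ s).im * pd I Y (P (t, s)))
          * (γ s).re + Y (P (t, s)) * (deriv γ s).re)) := by
    intro t s
    have h1 : HasDerivAt (fun r : ℝ => ((t, r) : ℝ × ℝ)) (0, 1) s :=
      (hasDerivAt_const s t).prodMk (hasDerivAt_id s)
    have h2 := ((hGs.differentiable (by simp)) (t, s)).hasFDerivAt.comp_hasDerivAt s h1
    have hg : HasDerivAt γ (deriv γ s) s := ((hγ.differentiable (by simp)) s).hasDerivAt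
    have hp : HasDerivAt (fun r : ℝ => P (t, r)) (t * deriv γ s) s := hg.const_mul (t : ℂ)
    have hre : HasDerivAt (fun r => (γ r).re) (deriv γ s).re s :=
      reCLM.hasFDerivAt.comp_hasDerivAt s hg
    have him : HasDerivAt (fun r => (γ r).im) (deriv γ s).im s :=
      imCLM.hasFDerivAt.comp_hasDerivAt s hg
    have h3 := (((hXY hX hp).mul him).sub ((hXY hY hp).mul hre)).neg
    refine (h2.unique h3).trans ?_
    simp
  have hsum : ∀ q : ℝ × ℝ, fderiv ℝ F q (1, 0) + fderiv ℝ G q (0, 1) =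
      q.1 * cross (γ q.2) (deriv γ q.2) * (pd 1 X (q.1 * γ q.2) + pd I Y (q.1 * γ q.2)) := by
    rintro ⟨t, s⟩
    rw [hFd, hGd]
    simp only [cross, hP]
    ring
  have hcont : Continuous fun q : ℝ × ℝ => fderiv ℝ F q (1, 0) + fderiv ℝ G q (0, 1) :=
    ((hFs.continuous_fderiv (by simp)).clm_apply continuous_const).add
      ((hGs.continuous_fderiv (by simp)).clm_apply continuous_const)
  have hdiv := integral_divergence_prod_Icc_of_hasFDerivAt_of_le F G (fderiv ℝ F) (fderiv ℝ G)
    (0, 0) (1, L) ⟨zero_le_one, H.Lpos.le⟩ hFs.continuous.continuousOn hGs.continuous.continuousOn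
    (fun q _ => ((hFs.differentiable (by simp)) q).hasFDerivAt)
    (fun q _ => ((hGs.differentiable (by simp)) q).hasFDerivAt)
    (hcont.continuousOn.integrableOn_compact isCompact_Icc)
  simp only [hsum] at hdiv
  rw [hdiv]
  have hGper : ∀ x, G (x, L) = G (x, 0) := by
    intro x
    have : γ L = γ 0 := by simpa using H.per 0
    simp only [hG, hP, this]
  simp only [hGper]
  simp [hF, hP]

/-- The divergence theorem on the domain enclosed by a star-shaped curve. -/
lemma integral_div (H : StarCurve γ L) {Ω : Set ℂ} (hΩ : IsOpen Ω) (hb : Bornology.IsBounded Ω)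
    (h0 : (0 : ℂ) ∈ Ω) (hfr : frontier Ω = range γ) {σ : ℝ}
    (hσ : ∀ s, |cross (γ s) (deriv γ s)| = σ * cross (γ s) (deriv γ s))
    {X Y : ℂ → ℝ} (hX : ContDiff ℝ (⊤ : ℕ∞) X) (hY : ContDiff ℝ (⊤ : ℕ∞) Y) :
    ∫ x in Ω, (pd 1 X x + pd I Y x) =
      σ * ∫ s in (0 : ℝ)..L, (X (γ s) * (deriv γ s).im - Y (γ s) * (deriv γ s).re) := by
  set S : Set ℂ := Ioo 0 1 ×ℂ Ioc 0 L with hS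
  have hSm : MeasurableSet S :=
    (measurableSet_Ioo.preimage measurable_re).inter (measurableSet_Ioc.preimage measurable_im)
  have hΩS : Ω =ᵐ[volume] radialMap γ '' S := by
    conv_lhs => rw [H.image_eq hΩ hb h0 hfr, H.image_eq_image_fundamental]
    exact insert_ae_eq_self _ _
  rw [setIntegral_congr_set hΩS, integral_image_eq_integral_abs_det_fderiv_smul volume hSm
    (fun z _ => (hasFDerivAt_radialMap H.smooth z).hasFDerivWithinAt) H.injOn,
    ← H.integral_div_radial hX hY, ← integral_const_mul]
  have hR : Icc ((0 : ℝ), (0 : ℝ)) (1, L) =ᵐ[volume] Ioo (0 : ℝ) 1 ×ˢ Ioc 0 L := by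
    rw [← Icc_prod_Icc]
    exact (Measure.set_prod_ae_eq Ioo_ae_eq_Icc Ioc_ae_eq_Icc).symm
  rw [setIntegral_congr_set hR]
  rw [← (volume_preserving_equiv_real_prod).setIntegral_preimage_emb
    measurableEquivRealProd.measurableEmbedding]
  have : (measurableEquivRealProd ⁻¹' (Ioo (0 : ℝ) 1 ×ˢ Ioc 0 L)) = S := by
    ext z; simp [S, mem_reProdIm, measurableEquivRealProd_apply]
  rw [this]
  refine setIntegral_congr_fun hSm fun z hz => ?_
  simp only [measurableEquivRealProd_apply, det_radialDeriv, abs_mul, hσ, smul_eq_mul,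
    abs_of_pos (show 0 < z.re from hz.1.1), radialMap]
  ring

end StarCurve

lemma continuous_pos_or_neg {f : ℝ → ℝ} (hf : Continuous f) (h : ∀ s, f s ≠ 0) :
    (∀ s, 0 < f s) ∨ ∀ s, f s < 0 := by
  by_contra! hcon
  obtain ⟨⟨a, ha⟩, b, hb⟩ := hcon
  obtain ⟨x, hx⟩ := mem_range_of_exists_le_of_exists_ge hf ⟨a, ha⟩ ⟨b, hb⟩
  exact h x hx

/-- The hypotheses on the domain give the divergence theorem and hence a `StarDomain`. -/
theorem exists_starDomain {Ω : Set ℂ} (hΩo : IsOpen Ω) (hΩb : Bornology.IsBounded Ω)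
    (h0 : (0 : ℂ) ∈ Ω) {γ : ℝ → ℂ} {L : ℝ} (hγ : BoundaryParam Ω γ L) {n : ℝ → ℂ}
    (hn : OutwardNormal Ω γ n) {c : ℝ} (hc : 0 < c)
    (hstar : ∀ s, c ≤ (γ s).re * (n s).re + (γ s).im * (n s).im) :
    ∃ σ, StarDomain Ω γ n L c σ := by
  have hunit : ∀ s, (n s).re ^ 2 + (n s).im ^ 2 = 1 := by
    intro s
    have := hn.unit s
    rw [← Complex.sq_norm_sub_sq_re (n s), this]; ring
  have hdunit : ∀ s, (deriv γ s).re ^ 2 + (deriv γ s).im ^ 2 = 1 := by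
    intro s
    have := hγ.arclength s
    rw [← Complex.sq_norm_sub_sq_re (deriv γ s), this]; ring
  have hrot : ∀ s, deriv γ s = cross (n s) (deriv γ s) * (I * n s) := by
    intro s
    have h1 := hunit s
    have h2 := hn.orth s
    apply Complex.ext
    · simp [cross]
      linear_combination (deriv γ s).re * (-h1) + (n s).re * h2
    · simp [cross]
      linear_combination (deriv γ s).im * (-h1) + (n s).im * h2
  have hsq : ∀ s, cross (n s) (deriv γ s) ^ 2 = 1 := by
    intro s
    have h2 := hn.orth s
    simp only [cross]
    linear_combination ((deriv γ s).re ^ 2 + (deriv γ s).im ^ 2) * hunit s + hdunit s -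
      ((n s).re * (deriv γ s).re + (n s).im * (deriv γ s).im) * h2
  have hcr : ∀ s, cross (γ s) (deriv γ s) =
      cross (n s) (deriv γ s) * ((γ s).re * (n s).re + (γ s).im * (n s).im) := by
    intro s
    conv_lhs => rw [cross, hrot s]
    simp
    ring
  have hd : ContDiff ℝ (⊤ : ℕ∞) (deriv γ) := (contDiff_infty_iff_deriv.1 hγ.smooth).2
  have hH : StarCurve γ L := by
    refine ⟨hγ.smooth, hγ.Lpos, hγ.periodic, hγ.inj, fun s h => ?_⟩
    have h1 := hsq s
    rw [hcr] at h
    rcases mul_eq_zero.1 h with h2 | h2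
    · rw [h2] at h1; norm_num at h1
    · linarith [hstar s]
  obtain ⟨σ, hσ2, hσ⟩ : ∃ σ : ℝ, σ ^ 2 = 1 ∧ ∀ s, cross (n s) (deriv γ s) = σ := by
    have hcont : Continuous fun s => cross (γ s) (deriv γ s) := by
      have h1 := hγ.smooth.continuous
      have h2 := hd.continuous
      unfold cross
      fun_prop
    have hval : ∀ s, cross (n s) (deriv γ s) = 1 ∨ cross (n s) (deriv γ s) = -1 := fun s =>
      sq_eq_one_iff.1 (hsq s)
    rcases continuous_pos_or_neg hcont hH.transversal with h | h
    · refine ⟨1, by norm_num, fun s => (hval s).resolve_right fun h1 => ?_⟩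
      have := h s
      rw [hcr, h1] at this
      linarith [hstar s]
    · refine ⟨-1, by norm_num, fun s => (hval s).resolve_left fun h1 => ?_⟩
      have := h s
      rw [hcr, h1] at this
      linarith [hstar s]
  have hne : n = fun s => -σ * I * deriv γ s := by
    funext s
    conv_rhs => rw [hrot s, hσ]
    have : (σ : ℂ) ^ 2 = 1 := by exact_mod_cast hσ2
    linear_combination (-n s) * this + (σ : ℂ) ^ 2 * n s * I_sq
  refine ⟨σ, hΩo, hΩb, hγ.Lpos, hc, hγ.smooth, ?_, hγ.periodic, ?_, hunit, hσ2, ?_, hstar,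
    hγ.srange.symm, ?_⟩
  · rw [hne]; exact contDiff_const.mul hd
  · intro s
    rw [hne]
    simp only [hH.per_deriv s]
  · intro s
    rw [hrot s, hσ s]
  · intro X Y hX hY
    have habs : ∀ s, |cross (γ s) (deriv γ s)| = σ * cross (γ s) (deriv γ s) := by
      intro s
      have h1 : 0 < (γ s).re * (n s).re + (γ s).im * (n s).im := hc.trans_le (hstar s)
      have h2 : |σ| = 1 := by rw [← sq_eq_sq₀ (abs_nonneg _) zero_le_one, sq_abs, hσ2, one_pow]
      rw [hcr, hσ, abs_mul, abs_of_pos h1, ← mul_assoc, ← sq, hσ2, h2]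
    rw [hH.integral_div hΩo hΩb h0 hγ.srange.symm habs hX hY, ← intervalIntegral.integral_const_mul]
    congr 1
    funext s
    rw [hrot s, hσ]
    simp
    linear_combination (X (γ s) * (n s).re + Y (γ s) * (n s).im) * hσ2

lemma norm_fderiv_le_sqrt_gradSq (u : ℂ → ℂ) (x : ℂ) : ‖fderiv ℝ u x‖ ≤ √(gradSq u x) := by
  refine ContinuousLinearMap.opNorm_le_bound _ (Real.sqrt_nonneg _) fun ξ => ?_
  rw [fderiv_eq_pd]
  have h1 : ‖ξ.re • pd 1 u x + ξ.im • pd I u x‖ ≤ |ξ.re| * ‖pd 1 u x‖ + |ξ.im| * ‖pd I u x‖ :=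
    (norm_add_le _ _).trans (by simp)
  refine h1.trans ?_
  have hn : ‖ξ‖ = √(|ξ.re| ^ 2 + |ξ.im| ^ 2) := by
    rw [sq_abs, sq_abs, Complex.norm_eq_sqrt_sq_add_sq]
  rw [hn, ← Real.sqrt_mul (by unfold gradSq; positivity)]
  apply Real.le_sqrt_of_sq_le
  simp only [gradSq, pd]
  nlinarith [sq_nonneg (‖fderiv ℝ u x 1‖ * |ξ.im| - ‖fderiv ℝ u x I‖ * |ξ.re|)]

lemma rpow_le_of_sq_le_add {a b r p q : ℝ} (ha : 0 ≤ a) (hb : 0 ≤ b) (hr : 0 ≤ r) (hp : 0 ≤ p)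
    (hpq : p ≤ q) (hq2 : q ≤ 2) (h : a ^ 2 ≤ b + r) :
    a ^ p ≤ √(1 + b) ^ q + 1 + r := by
  have hq0 : 0 ≤ q := hp.trans hpq
  have hsqrt : ∀ {x : ℝ}, 0 ≤ x → √x ^ q = x ^ (q / 2) := by
    intro x hx
    rw [Real.sqrt_eq_rpow, ← Real.rpow_mul hx]
    congr 1
    ring
  have h1 : a ≤ √(1 + b + r) := Real.le_sqrt_of_sq_le (by linarith)
  have h2 : 1 ≤ √(1 + b + r) := Real.one_le_sqrt.2 (by linarith)
  calc a ^ p ≤ √(1 + b + r) ^ p := Real.rpow_le_rpow ha h1 hp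
    _ ≤ √(1 + b + r) ^ q := Real.rpow_le_rpow_of_exponent_le h2 hpq
    _ = (1 + b + r) ^ (q / 2) := hsqrt (by linarith)
    _ ≤ (1 + b) ^ (q / 2) + r ^ (q / 2) :=
      Real.rpow_add_le_add_rpow (by linarith) hr (by linarith) (by linarith)
    _ ≤ √(1 + b) ^ q + 1 + r := by
      rw [hsqrt (by linarith), add_assoc]
      gcongr
      rcases le_total r 1 with h3 | h3
      · linarith [Real.rpow_le_one hr h3 (show 0 ≤ q / 2 by linarith)]
      · have := Real.rpow_le_rpow_of_exponent_le h3 (show q / 2 ≤ 1 by linarith)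
        rw [Real.rpow_one] at this
        linarith

theorem StarDomain.exists_gradient_rpow_bound {Ω : Set ℂ} {γ n : ℝ → ℂ} {L c σ : ℝ}
    (H : StarDomain Ω γ n L c σ) {Γ : Set ℂ} {τ : ℝ → ℂ} {W : ℂ → ℝ} {R₀ : ℝ}
    (hW : PotentialHyp Γ W R₀) (hΓ : ArcParam Γ τ) {g : ℂ → ℂ} (hg : ContDiff ℝ (⊤ : ℕ∞) g)
    (hgΓ : ∀ s, g (γ s) ∈ Γ) {p : ℝ} (hp1 : 1 ≤ p) (hp2 : p < 2) :
    ∃ C : ℝ, ∀ ε u, 0 < ε → SolvesGL W Ω ε u → (∀ s, u (γ s) = g (γ s)) →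
      ∫ y in Ω, ‖fderiv ℝ u y‖ ^ p ≤ C := by
  obtain ⟨M, hM, hest⟩ := H.exists_div_curl_estimates hW hΓ hg hgΓ
  set q : ℝ := max p (3 / 2)
  have hq1 : 1 < q := lt_of_lt_of_le (by norm_num) (le_max_right _ _)
  have hq2 : q < 2 := max_lt hp2 (by norm_num)
  obtain ⟨C, hC⟩ := H.exists_div_curl_rpow_bound hq1 hq2 hM
  refine ⟨C + (∫ x in Ω, (1 : ℝ)) + M, fun ε u hε hu hb => ?_⟩
  obtain ⟨a₁, a₂, v₁, v₂, ρ, ha₁, ha₂, hv₁, hv₂, hρ, hρ0, h1, h2, h3, h4, h5, h6⟩ :=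
    hest ε u hε hu hb
  have hv := hC a₁ a₂ v₁ v₂ ha₁ ha₂ hv₁ hv₂ h1 h2 h3 h4
  have c₁ := hv₁.continuous
  have c₂ := hv₂.continuous
  have cu : Continuous fun x => ‖fderiv ℝ u x‖ ^ p :=
    (hu.1.continuous_fderiv (by simp)).norm.rpow_const fun _ => Or.inr (by linarith)
  have cv : Continuous fun x => √(1 + v₁ x ^ 2 + v₂ x ^ 2) ^ q :=
    Continuous.rpow_const (by fun_prop) fun _ => Or.inr (by linarith)
  calc ∫ y in Ω, ‖fderiv ℝ u y‖ ^ p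
      ≤ ∫ x in Ω, (√(1 + v₁ x ^ 2 + v₂ x ^ 2) ^ q + 1 + ρ x) := by
        refine H.setIntegral_mono cu (by fun_prop) fun x hx => ?_
        rw [add_assoc 1]
        refine rpow_le_of_sq_le_add (norm_nonneg _) (by positivity) (hρ0 x) (by linarith)
          (le_max_left _ _) hq2.le ?_
        refine le_trans ?_ (h6 x hx)
        refine (pow_le_pow_left₀ (norm_nonneg _) (norm_fderiv_le_sqrt_gradSq u x) 2).trans_eq ?_
        exact Real.sq_sqrt (by unfold gradSq; positivity)
    _ = (∫ x in Ω, √(1 + v₁ x ^ 2 + v₂ x ^ 2) ^ q) + (∫ x in Ω, (1 : ℝ)) + ∫ x in Ω, ρ x := by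
        rw [integral_add (H.integrableOn (by fun_prop)) (H.integrableOn hρ),
          integral_add (H.integrableOn cv) (H.integrableOn continuous_const)]
    _ ≤ C + (∫ x in Ω, (1 : ℝ)) + M := by gcongr
/-- Proposition 5.13: for solutions on a smooth bounded strictly
star-shaped domain with smooth `Γ`-valued boundary datum, for every `p ∈ [1,2)` one has
`‖∇u_ε‖_{L^p(Ω)} ≤ C_p` with `C_p` independent of `ε`. -/
theorem gradient_Lp_bound
    (Γ : Set ℂ) (τ : ℝ → ℂ) (W : ℂ → ℝ) (R₀ : ℝ)
    (hΓ : ArcParam Γ τ) (hW : PotentialHyp Γ W R₀)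
    (Ω : Set ℂ) (hΩo : IsOpen Ω) (hΩb : Bornology.IsBounded Ω) (h0 : (0 : ℂ) ∈ Ω)
    (γ : ℝ → ℂ) (L : ℝ) (hγ : BoundaryParam Ω γ L)
    (nv : ℝ → ℂ) (hn : OutwardNormal Ω γ nv)
    (c : ℝ) (hc : 0 < c)
    (hstar : ∀ s, c ≤ (γ s).re * (nv s).re + (γ s).im * (nv s).im)
    (g : ℂ → ℂ) (hg : ContDiff ℝ (⊤ : ℕ∞) g) (hgΓ : ∀ x ∈ frontier Ω, g x ∈ Γ)
    (u : ℝ → ℂ → ℂ)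
    (hu : ∀ ε > (0 : ℝ), SolvesGL W Ω ε (u ε) ∧ ∀ x ∈ frontier Ω, u ε x = g x)
    :
    ∀ p : ℝ, 1 ≤ p → p < 2 →
      ∃ C : ℝ, ∀ ε > (0 : ℝ), (∫ y in Ω, ‖fderiv ℝ (u ε) y‖ ^ p) ≤ C := by
  intro p hp1 hp2
  obtain ⟨σ, H⟩ := exists_starDomain hΩo hΩb h0 hγ hn hc hstar
  have hmem : ∀ s, γ s ∈ frontier Ω := fun s => hγ.srange ▸ mem_range_self s
  obtain ⟨C, hC⟩ := H.exists_gradient_rpow_bound hW hΓ hg (fun s => hgΓ _ (hmem s)) hp1 hp2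
  exact ⟨C, fun ε hε => hC ε (u ε) hε (hu ε hε).1 fun s => (hu ε hε).2 _ (hmem s)⟩
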